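/- Let m ≥ 1, let F be the free group on m generators, let α be an automorphism of F, and let Γ = F ⋊_α ℤ be the semidirect product in which the generator 1 ∈ ℤ acts on F by α. Suppose that the automorphism ᾱ of the abelianization F^{ab} of F induced by α has no fixed point other than the identity (equivalently, 1 is not an eigenvalue of the induced map on H₁(F;ℝ) ≅ ℝᵐ). Then Γ is weakly stable: for every finite subset S ⊆ Γ and every ε > 0 there exist a finite subset T ⊆ Γ and δ > 0 such that for every n ≥ 1 and every (T,δ)-representation φ : Γ → M_n(ℂ) there exist k ∈ ℕ, a unitary representation θ : Γ → M_k(ℂ), and a unitary representation π : Γ → M_{n+k}(ℂ) such that ‖(φ(s) ⊕ θ(s)) − π(s)‖ < ε for all s ∈ S. -/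

import Mathlib

open scoped Matrix.Norms.L2Operator

noncomputable section

/-- The free-by-cyclic group `F ⋊_α ℤ` associated to an automorphism `α` of the free group
`F` on `m` generators; the generator `1 ∈ ℤ` acts by `α`. -/
abbrev FreeByCyclic (m : ℕ) (α : FreeGroup (Fin m) ≃* FreeGroup (Fin m)) : Type :=
  FreeGroup (Fin m) ⋊[zpowersHom (MulAut (FreeGroup (Fin m))) α] Multiplicative ℤ

/-- A `(T,δ)`-representation of `Γ` on `M_n(ℂ)` (operator norm): a unital map into the closed
unit ball that is `δ`-multiplicative on `T`. -/
def IsQuasiRep {Γ : Type*} [Group Γ] (T : Set Γ) (δ : ℝ) {n : ℕ}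
    (φ : Γ → Matrix (Fin n) (Fin n) ℂ) : Prop :=
  φ 1 = 1 ∧ (∀ x, ‖φ x‖ ≤ 1) ∧ ∀ s ∈ T, ∀ t ∈ T, ‖φ s * φ t - φ (s * t)‖ < δ

/-- A unitary representation of `Γ` on `M_k(ℂ)`. -/
def IsUnitaryRep {Γ : Type*} [Group Γ] {k : ℕ} (θ : Γ → Matrix (Fin k) (Fin k) ℂ) : Prop :=
  θ 1 = 1 ∧ (∀ x y, θ (x * y) = θ x * θ y) ∧
    ∀ x, θ x ∈ unitary (Matrix (Fin k) (Fin k) ℂ)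

/-- Block sum of square matrices. -/
def blockSum {n k : ℕ} (x : Matrix (Fin n) (Fin n) ℂ) (y : Matrix (Fin k) (Fin k) ℂ) :
    Matrix (Fin (n + k)) (Fin (n + k)) ℂ :=
  Matrix.reindex finSumFinEquiv finSumFinEquiv (Matrix.fromBlocks x 0 0 y)

section

set_option linter.unusedSectionVars false

open Matrix Topology

open scoped Kronecker

/-- The group of unitary matrices with rows and columns indexed by `ι`. -/
abbrev MatU (ι : Type) [Fintype ι] [DecidableEq ι] : Type := unitary (Matrix ι ι ℂ)

section Norms

variable {ι κ μ ι' κ' : Type} [Fintype ι] [DecidableEq ι] [Fintype κ] [DecidableEq κ]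
  [Fintype μ] [DecidableEq μ] [Fintype ι'] [DecidableEq ι'] [Fintype κ'] [DecidableEq κ']

lemma norm_le_one_of_isometry {J : Matrix κ ι ℂ} (hJ : Jᴴ * J = 1) : ‖J‖ ≤ 1 := by
  have h := l2_opNorm_conjTranspose_mul_self J
  rw [hJ] at h
  have h1 : ‖(1 : Matrix ι ι ℂ)‖ ≤ 1 := by
    have := l2_opNorm_diagonal (𝕜 := ℂ) (fun _ : ι => (1 : ℂ))
    rw [diagonal_one] at this
    rw [this]
    exact (pi_norm_le_iff_of_nonneg zero_le_one).2 fun _ => by simp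
  nlinarith [norm_nonneg J]

lemma norm_conjTranspose_le_one {J : Matrix κ ι ℂ} (hJ : ‖J‖ ≤ 1) : ‖Jᴴ‖ ≤ 1 := by
  rwa [l2_opNorm_conjTranspose]

lemma MatU.star_mul (u : MatU ι) : (u : Matrix ι ι ℂ)ᴴ * u = 1 := u.2.1

lemma MatU.mul_star (u : MatU ι) : (u : Matrix ι ι ℂ) * (u : Matrix ι ι ℂ)ᴴ = 1 := u.2.2

lemma MatU.coe_inv (u : MatU ι) : ((u⁻¹ : MatU ι) : Matrix ι ι ℂ) = (u : Matrix ι ι ℂ)ᴴ := rfl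

lemma MatU.norm_le (u : MatU ι) : ‖(u : Matrix ι ι ℂ)‖ ≤ 1 := norm_le_one_of_isometry u.star_mul

lemma norm_mul_le_left {A : Matrix μ κ ℂ} {B : Matrix κ ι ℂ} (hA : ‖A‖ ≤ 1) :
    ‖A * B‖ ≤ ‖B‖ :=
  (l2_opNorm_mul A B).trans (mul_le_of_le_one_left (norm_nonneg _) hA)

lemma norm_mul_le_right {A : Matrix μ κ ℂ} {B : Matrix κ ι ℂ} (hB : ‖B‖ ≤ 1) :
    ‖A * B‖ ≤ ‖A‖ :=
  (l2_opNorm_mul A B).trans (mul_le_of_le_one_right (norm_nonneg _) hB)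

/-- Approximate intertwining relations compose. -/
lemma intertwine_comp {J : Matrix κ ι ℂ} {K : Matrix μ κ ℂ} {A : Matrix ι ι ℂ}
    {B : Matrix κ κ ℂ} {C : Matrix μ μ ℂ} {a b : ℝ} (hJ : ‖J‖ ≤ 1) (hK : ‖K‖ ≤ 1)
    (h₁ : ‖J * A - B * J‖ ≤ a) (h₂ : ‖K * B - C * K‖ ≤ b) :
    ‖(K * J) * A - C * (K * J)‖ ≤ a + b := by
  have : (K * J) * A - C * (K * J) = K * (J * A - B * J) + (K * B - C * K) * J := by
    simp only [Matrix.mul_sub, Matrix.sub_mul, Matrix.mul_assoc]; abel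
  rw [this]
  exact (norm_add_le _ _).trans (add_le_add ((norm_mul_le_left hK).trans h₁)
    ((norm_mul_le_right hJ).trans h₂))

lemma intertwine_mul {J : Matrix κ ι ℂ} {A A' : Matrix ι ι ℂ} {B B' : Matrix κ κ ℂ} {a b : ℝ}
    (hA : ‖A'‖ ≤ 1) (hB : ‖B‖ ≤ 1)
    (h₁ : ‖J * A - B * J‖ ≤ a) (h₂ : ‖J * A' - B' * J‖ ≤ b) :
    ‖J * (A * A') - (B * B') * J‖ ≤ a + b := by
  have : J * (A * A') - (B * B') * J = (J * A - B * J) * A' + B * (J * A' - B' * J) := by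
    simp only [Matrix.mul_sub, Matrix.sub_mul, Matrix.mul_assoc]; abel
  rw [this]
  exact (norm_add_le _ _).trans (add_le_add ((norm_mul_le_right hA).trans h₁)
    ((norm_mul_le_left hB).trans h₂))

lemma intertwine_inv {J : Matrix κ ι ℂ} {A : MatU ι} {B : MatU κ} {a : ℝ}
    (h : ‖J * A.1 - B.1 * J‖ ≤ a) : ‖J * (A⁻¹).1 - (B⁻¹).1 * J‖ ≤ a := by
  have : J * (A⁻¹).1 - (B⁻¹).1 * J = -((B⁻¹).1 * (J * A.1 - B.1 * J) * (A⁻¹).1) := by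
    simp only [MatU.coe_inv, Matrix.mul_sub, Matrix.sub_mul]
    rw [← Matrix.mul_assoc B.1ᴴ B.1 J, MatU.star_mul, Matrix.mul_assoc _ (J * _),
      Matrix.mul_assoc J, MatU.mul_star]
    simp
  rw [this, norm_neg]
  exact ((norm_mul_le_right (MatU.norm_le _)).trans (norm_mul_le_left (MatU.norm_le _))).trans h

lemma intertwine_adjoint {J : Matrix κ ι ℂ} {A : MatU ι} {B : MatU κ} {a : ℝ}
    (h : ‖J * A.1 - B.1 * J‖ ≤ a) : ‖Jᴴ * B.1 - A.1 * Jᴴ‖ ≤ a := by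
  have h' := intertwine_inv h
  rw [← l2_opNorm_conjTranspose] at h'
  rw [MatU.coe_inv, MatU.coe_inv, conjTranspose_sub, conjTranspose_mul, conjTranspose_mul,
    conjTranspose_conjTranspose, conjTranspose_conjTranspose, norm_sub_rev] at h'
  exact h'

/-- An approximate intertwiner of the generators of a free group approximately intertwines
every fixed word, uniformly in the dimensions. -/
lemma intertwine_word {X : Type} (g : FreeGroup X) : ∃ C : ℝ, 0 < C ∧
    ∀ (ι κ : Type) [Fintype ι] [DecidableEq ι] [Fintype κ] [DecidableEq κ]
      (A : FreeGroup X →* MatU ι) (B : FreeGroup X →* MatU κ) (J : Matrix κ ι ℂ) (δ : ℝ),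
      0 ≤ δ →
      (∀ x, ‖J * (A (FreeGroup.of x)).1 - (B (FreeGroup.of x)).1 * J‖ ≤ δ) →
      ‖J * (A g).1 - (B g).1 * J‖ ≤ C * δ := by
  induction g using FreeGroup.induction_on with
  | C1 => exact ⟨1, one_pos, fun ι κ _ _ _ _ A B J δ hδ h => by simpa using hδ⟩
  | of x => exact ⟨1, one_pos, fun ι κ _ _ _ _ A B J δ hδ h => by simpa using h x⟩
  | inv_of x _ =>
    refine ⟨1, one_pos, fun ι κ _ _ _ _ A B J δ hδ h => ?_⟩
    rw [map_inv, map_inv, one_mul]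
    exact intertwine_inv (h x)
  | mul x y hx hy =>
    obtain ⟨C, hC, hx⟩ := hx
    obtain ⟨D, hD, hy⟩ := hy
    refine ⟨C + D, by positivity, fun ι κ _ _ _ _ A B J δ hδ h => ?_⟩
    rw [map_mul, map_mul, add_mul]
    exact intertwine_mul (MatU.norm_le _) (MatU.norm_le _) (hx ι κ A B J δ hδ h)
      (hy ι κ A B J δ hδ h)

/-- The extension of a unitary `u` along an isometry `J`, by the identity on the complement. -/
def extU (J : Matrix κ ι ℂ) (u : Matrix ι ι ℂ) : Matrix κ κ ℂ := J * u * Jᴴ + (1 - J * Jᴴ)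

lemma extU_mem {J : Matrix κ ι ℂ} (hJ : Jᴴ * J = 1) (u : MatU ι) :
    extU J u ∈ unitary (Matrix κ κ ℂ) := by
  have key : ∀ v w : Matrix ι ι ℂ, v * w = 1 → extU J v * extU J w = 1 := by
    intro v w hvw
    have e1 : J * v * Jᴴ * (J * w * Jᴴ) = J * Jᴴ := by
      calc J * v * Jᴴ * (J * w * Jᴴ) = J * v * (Jᴴ * J) * w * Jᴴ := by simp only [Matrix.mul_assoc]
        _ = J * (v * w) * Jᴴ := by rw [hJ]; simp only [Matrix.mul_assoc, Matrix.one_mul]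
        _ = J * Jᴴ := by rw [hvw, Matrix.mul_one]
    have e2 : J * v * Jᴴ * (J * Jᴴ) = J * v * Jᴴ := by
      calc J * v * Jᴴ * (J * Jᴴ) = J * v * (Jᴴ * J) * Jᴴ := by simp only [Matrix.mul_assoc]
        _ = _ := by rw [hJ, Matrix.mul_one]
    have e3 : J * Jᴴ * (J * w * Jᴴ) = J * w * Jᴴ := by
      calc J * Jᴴ * (J * w * Jᴴ) = J * (Jᴴ * J) * w * Jᴴ := by simp only [Matrix.mul_assoc]
        _ = _ := by rw [hJ, Matrix.mul_one]
    have e4 : J * Jᴴ * (J * Jᴴ) = J * Jᴴ := by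
      calc J * Jᴴ * (J * Jᴴ) = J * (Jᴴ * J) * Jᴴ := by simp only [Matrix.mul_assoc]
        _ = _ := by rw [hJ, Matrix.mul_one]
    simp only [extU, Matrix.add_mul, Matrix.mul_add, Matrix.mul_sub, Matrix.sub_mul, e1, e2, e3, e4,
      Matrix.one_mul, Matrix.mul_one]
    abel
  have hstar : star (extU J u) = extU J (u : Matrix ι ι ℂ)ᴴ := by
    simp [extU, star_eq_conjTranspose, conjTranspose_mul, Matrix.mul_assoc]
  constructor
  · rw [hstar]; exact key _ _ u.star_mul
  · rw [hstar]; exact key _ _ u.mul_star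

/-- If `u` approximately intertwines `D` with `D'`, then its extension along an approximate
intertwiner `J` approximately intertwines the ambient unitaries. -/
lemma extU_intertwine {J : Matrix κ ι ℂ} (hJ : Jᴴ * J = 1) {u D D' : MatU ι} {X X' : MatU κ}
    {a b : ℝ} (h₁ : ‖J * D.1 - X.1 * J‖ ≤ a) (h₂ : ‖J * D'.1 - X'.1 * J‖ ≤ a)
    (hu : ‖u.1 * D.1 - D'.1 * u.1‖ ≤ b)
    (hc : ‖(1 - J * Jᴴ) * X.1 - X'.1 * (1 - J * Jᴴ)‖ ≤ 2 * a) :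
    ‖extU J u.1 * X.1 - X'.1 * extU J u.1‖ ≤ 4 * a + b := by
  have hJ1 := norm_le_one_of_isometry hJ
  have h3 : ‖J * u.1 * Jᴴ * X.1 - X'.1 * (J * u.1 * Jᴴ)‖ ≤ a + (b + a) := by
    have := intertwine_comp (norm_conjTranspose_le_one hJ1)
      ((norm_mul_le_left hJ1).trans u.norm_le) (intertwine_adjoint h₁)
      (intertwine_comp u.norm_le hJ1 hu h₂)
    exact this
  have : extU J u.1 * X.1 - X'.1 * extU J u = (J * u.1 * Jᴴ * X.1 - X'.1 * (J * u.1 * Jᴴ))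
      + ((1 - J * Jᴴ) * X.1 - X'.1 * (1 - J * Jᴴ)) := by
    simp only [extU, Matrix.add_mul, Matrix.mul_add]; abel
  rw [this]
  linarith [norm_add_le (J * u.1 * Jᴴ * X.1 - X'.1 * (J * u.1 * Jᴴ))
    ((1 - J * Jᴴ) * X.1 - X'.1 * (1 - J * Jᴴ))]

lemma norm_blockDiagonal_le {o : Type} [Fintype o] [DecidableEq o] (D : o → Matrix ι κ ℂ) {c : ℝ}
    (hc : 0 ≤ c) (h : ∀ k, ‖D k‖ ≤ c) : ‖blockDiagonal D‖ ≤ c := by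
  have sq : ∀ (E : o → Matrix κ κ ℂ) {c : ℝ}, 0 ≤ c → (∀ k, ‖E k‖ ≤ c) →
      ‖blockDiagonal E‖ ≤ c := by
    intro E c hc h
    let f : (o → Matrix κ κ ℂ) →⋆ₙₐ[ℂ] Matrix (κ × o) (κ × o) ℂ :=
      { toFun := blockDiagonal
        map_zero' := blockDiagonal_zero
        map_add' := blockDiagonal_add
        map_smul' := fun c M => blockDiagonal_smul c M
        map_mul' := fun M N => blockDiagonal_mul M N
        map_star' := fun M => (blockDiagonal_conjTranspose M).symm }
    exact (NonUnitalStarAlgHom.norm_apply_le f E).trans ((pi_norm_le_iff_of_nonneg hc).2 h)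
  have h1 : ‖blockDiagonal D‖ * ‖blockDiagonal D‖ ≤ c * c := by
    rw [← l2_opNorm_conjTranspose_mul_self, blockDiagonal_conjTranspose, ← blockDiagonal_mul]
    refine sq _ (by positivity) fun k => ?_
    rw [l2_opNorm_conjTranspose_mul_self]
    exact mul_self_le_mul_self (norm_nonneg _) (h k)
  exact le_of_sq_le_sq (by nlinarith) hc

lemma norm_fromBlocks_le (A : Matrix ι ι' ℂ) (D : Matrix κ κ' ℂ) {c : ℝ} (hc : 0 ≤ c)
    (hA : ‖A‖ ≤ c) (hD : ‖D‖ ≤ c) : ‖fromBlocks A 0 0 D‖ ≤ c := by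
  have sq : ∀ (A : Matrix ι' ι' ℂ) (D : Matrix κ' κ' ℂ) {c : ℝ}, 0 ≤ c → ‖A‖ ≤ c → ‖D‖ ≤ c →
      ‖fromBlocks A 0 0 D‖ ≤ c := by
    intro A D c hc hA hD
    let f : (Matrix ι' ι' ℂ × Matrix κ' κ' ℂ) →⋆ₙₐ[ℂ] Matrix (ι' ⊕ κ') (ι' ⊕ κ') ℂ :=
      { toFun := fun p => fromBlocks p.1 0 0 p.2
        map_zero' := by simp
        map_add' := fun M N => by simp [fromBlocks_add]
        map_smul' := fun c M => by simp [fromBlocks_smul]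
        map_mul' := fun M N => by simp [fromBlocks_multiply]
        map_star' := fun M => by simp [star_eq_conjTranspose, fromBlocks_conjTranspose] }
    exact (NonUnitalStarAlgHom.norm_apply_le f (A, D)).trans (max_le hA hD)
  have h1 : ‖fromBlocks A 0 0 D‖ * ‖fromBlocks A 0 0 D‖ ≤ c * c := by
    rw [← l2_opNorm_conjTranspose_mul_self, fromBlocks_conjTranspose, fromBlocks_multiply]
    simp only [conjTranspose_zero, Matrix.zero_mul, Matrix.mul_zero, add_zero, zero_add]
    refine sq _ _ (by positivity) ?_ ?_ <;> rw [l2_opNorm_conjTranspose_mul_self] <;>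
      exact mul_self_le_mul_self (norm_nonneg _) (by assumption)
  exact le_of_sq_le_sq (by nlinarith) hc

end Norms

section Lattice

open MeasureTheory

variable {ι : Type} [Fintype ι] [DecidableEq ι]

/-- The vector of Gaussian integers with the given real and imaginary parts. -/
def gauss (x : ι → ℤ × ℤ) : EuclideanSpace ℂ ι := WithLp.toLp 2 fun a => ⟨(x a).1, (x a).2⟩

/-- The coordinatewise integer part of a complex vector. -/
def gfloor (z : EuclideanSpace ℂ ι) : ι → ℤ × ℤ := fun a => (⌊(z a).re⌋, ⌊(z a).im⌋)

lemma norm_sub_gauss_gfloor_le (z : EuclideanSpace ℂ ι) :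
    ‖z - gauss (gfloor z)‖ ≤ √(2 * Fintype.card ι) := by
  rw [EuclideanSpace.norm_eq]
  refine Real.sqrt_le_sqrt ?_
  have : ∀ a ∈ Finset.univ, ‖(z - gauss (gfloor z)) a‖ ^ 2 ≤ 2 := by
    intro a _
    rw [← Complex.normSq_eq_norm_sq, Complex.normSq_apply]
    simp only [gauss, gfloor, PiLp.sub_apply, Complex.sub_re, Complex.sub_im]
    have h1 := Int.floor_le (z a).re
    have h2 := Int.lt_floor_add_one (z a).re
    have h3 := Int.floor_le (z a).im
    have h4 := Int.lt_floor_add_one (z a).im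
    nlinarith
  refine (Finset.sum_le_sum this).trans ?_
  simp [mul_comm]

lemma finite_gauss_norm_le (v : EuclideanSpace ℂ ι) (R : ℝ) :
    {x : ι → ℤ × ℤ | ‖gauss x - v‖ ≤ R}.Finite := by
  set k : ℝ := R + ‖v‖
  refine (Fintype.piFinset fun _ : ι => Finset.Icc (-⌈k⌉) ⌈k⌉ ×ˢ Finset.Icc (-⌈k⌉) ⌈k⌉)
    |>.finite_toSet.subset fun x hx => ?_
  simp only [Set.mem_ofPred_eq] at hx
  have hk : ‖gauss x‖ ≤ k := by
    have := norm_add_le (gauss x - v) v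
    simp only [sub_add_cancel] at this
    linarith
  simp only [Finset.mem_coe, Fintype.mem_piFinset, Finset.mem_product, Finset.mem_Icc, ← abs_le]
  intro a
  have ha : ‖gauss x a‖ ≤ k := (PiLp.norm_apply_le (gauss x) a).trans hk
  have h1 := (Complex.abs_re_le_norm (gauss x a)).trans ha
  have h2 := (Complex.abs_im_le_norm (gauss x a)).trans ha
  simp only [gauss] at h1 h2
  constructor
  · exact_mod_cast h1.trans (Int.le_ceil k)
  · exact_mod_cast h2.trans (Int.le_ceil k)

lemma measurable_gfloor : Measurable (gfloor : EuclideanSpace ℂ ι → ι → ℤ × ℤ) := by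
  refine measurable_pi_lambda _ fun a => ?_
  have h : Measurable fun z : EuclideanSpace ℂ ι => z a := by fun_prop
  exact (Int.measurable_floor.comp (Complex.measurable_re.comp h)).prodMk
    (Int.measurable_floor.comp (Complex.measurable_im.comp h))

lemma volume_gfloor_preimage (S : Finset (ι → ℤ × ℤ)) :
    volume (gfloor ⁻¹' (S : Set (ι → ℤ × ℤ)) : Set (EuclideanSpace ℂ ι))
      = S.card * volume (gfloor ⁻¹' {0} : Set (EuclideanSpace ℂ ι)) := by
  rw [← sum_measure_preimage_singleton _ fun y _ => measurable_gfloor (measurableSet_singleton y)]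
  rw [← nsmul_eq_mul, ← Finset.sum_const]
  refine Finset.sum_congr rfl fun x _ => ?_
  rw [← measure_preimage_add_right volume (-gauss x) (gfloor ⁻¹' {0})]
  congr 1
  ext z
  simp only [Set.mem_preimage, Set.mem_singleton_iff, funext_iff, gfloor, gauss, PiLp.add_apply,
    PiLp.neg_apply, Complex.add_re, Complex.add_im, Complex.neg_re, Complex.neg_im, Pi.zero_apply,
    Prod.ext_iff, Prod.fst_zero, Prod.snd_zero, Int.floor_eq_iff, Int.cast_zero]
  refine forall_congr' fun a => ?_
  constructor <;> rintro ⟨⟨h1, h2⟩, h3, h4⟩ <;> refine ⟨⟨?_, ?_⟩, ?_, ?_⟩ <;> linarith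

lemma volume_cell_ne_top : volume (gfloor ⁻¹' {0} : Set (EuclideanSpace ℂ ι)) ≠ ⊤ := by
  refine ((Metric.isBounded_iff_subset_closedBall 0).2
    ⟨√(2 * Fintype.card ι), fun z hz => ?_⟩).measure_lt_top.ne
  have := norm_sub_gauss_gfloor_le z
  rw [Set.mem_preimage, Set.mem_singleton_iff] at hz
  have h0 : gauss (0 : ι → ℤ × ℤ) = 0 := by ext a; simp [gauss, Complex.ext_iff]
  rw [hz, h0, sub_zero] at this
  simpa using this

lemma volume_cell_pos : 0 < volume (gfloor ⁻¹' {0} : Set (EuclideanSpace ℂ ι)) := by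
  by_contra h
  have h0 : volume (gfloor ⁻¹' {0} : Set (EuclideanSpace ℂ ι)) = 0 := by simpa using h
  have h1 : volume (Set.univ : Set (EuclideanSpace ℂ ι)) = 0 := by
    rw [← Set.preimage_univ (f := gfloor), ← Set.biUnion_of_singleton Set.univ,
      Set.preimage_iUnion₂]
    refine (measure_biUnion_null_iff (Set.to_countable _)).2 fun x _ => ?_
    have := volume_gfloor_preimage (ι := ι) {x}
    rw [h0, mul_zero] at this
    simpa using this
  exact isOpen_univ.measure_ne_zero volume ⟨0, trivial⟩ h1

/-- Every linear isometry is at bounded distance from an injection of the lattice of Gaussian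
integer vectors. -/
lemma exists_injective_gauss (u : EuclideanSpace ℂ ι ≃ₗᵢ[ℝ] EuclideanSpace ℂ ι) :
    ∃ f : (ι → ℤ × ℤ) → ι → ℤ × ℤ, Function.Injective f ∧
      ∀ x, ‖gauss (f x) - u (gauss x)‖ ≤ 2 * √(2 * Fintype.card ι) := by
  classical
  have key := (Finset.all_card_le_biUnion_card_iff_exists_injective fun x : ι → ℤ × ℤ =>
    (finite_gauss_norm_le (u (gauss x)) (2 * √(2 * Fintype.card ι))).toFinset).1 ?_
  · obtain ⟨f, hf, hf'⟩ := key
    exact ⟨f, hf, fun x => by simpa using hf' x⟩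
  intro S
  set N := S.biUnion fun x =>
    (finite_gauss_norm_le (u (gauss x)) (2 * √(2 * Fintype.card ι))).toFinset
  have h1 : (gfloor ⁻¹' (S : Set (ι → ℤ × ℤ)) : Set (EuclideanSpace ℂ ι))
      ⊆ u ⁻¹' (gfloor ⁻¹' (N : Set (ι → ℤ × ℤ))) := by
    intro z hz
    simp only [Set.mem_preimage, Finset.mem_coe, N, Finset.mem_biUnion, Set.Finite.mem_toFinset,
      Set.mem_ofPred_eq] at hz ⊢
    refine ⟨_, hz, ?_⟩
    have h2 := norm_sub_gauss_gfloor_le z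
    have h3 := norm_sub_gauss_gfloor_le (u z)
    rw [← u.norm_map, map_sub] at h2
    have h4 := norm_sub_le (u z - u (gauss (gfloor z))) (u z - gauss (gfloor (u z)))
    rw [sub_sub_sub_cancel_left] at h4
    linarith
  have h2 := measure_mono (μ := volume) h1
  rw [u.measurePreserving.measure_preimage
      (measurable_gfloor N.measurableSet).nullMeasurableSet,
    volume_gfloor_preimage, volume_gfloor_preimage,
    ENNReal.mul_le_mul_iff_left volume_cell_pos.ne' volume_cell_ne_top] at h2
  exact_mod_cast h2

/-- The lattice vectors of norm at most `R`. -/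
def latticeBall (ι : Type) [Fintype ι] [DecidableEq ι] (R : ℝ) : Finset (ι → ℤ × ℤ) :=
  (finite_gauss_norm_le (0 : EuclideanSpace ℂ ι) R).toFinset

lemma mem_latticeBall {R : ℝ} {x : ι → ℤ × ℤ} : x ∈ latticeBall ι R ↔ ‖gauss x‖ ≤ R := by
  simp [latticeBall]

end Lattice

section Lattice

open MeasureTheory Filter

variable {ι : Type} [Fintype ι] [DecidableEq ι]

lemma tendsto_card_latticeBall [Nonempty ι] : ∃ L : ℝ, 0 < L ∧
    Tendsto (fun R : ℝ => ((latticeBall ι R).card : ℝ)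
      / R ^ Module.finrank ℝ (EuclideanSpace ℂ ι)) atTop (𝓝 L) := by
  set D := Module.finrank ℝ (EuclideanSpace ℂ ι)
  set V := volume.real (Metric.ball (0 : EuclideanSpace ℂ ι) 1)
  set c := volume.real (gfloor ⁻¹' {0} : Set (EuclideanSpace ℂ ι))
  set d := √(2 * Fintype.card ι)
  have hc : 0 < c := ENNReal.toReal_pos volume_cell_pos.ne' volume_cell_ne_top
  have hV : 0 < V := ENNReal.toReal_pos (Metric.measure_ball_pos _ _ one_pos).ne'
    measure_ball_lt_top.ne
  have hd : 0 ≤ d := Real.sqrt_nonneg _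
  have hvol : ∀ R : ℝ, 0 ≤ R → volume.real (Metric.closedBall (0 : EuclideanSpace ℂ ι) R)
      = R ^ D * V := by
    intro R hR
    rw [measureReal_def, Measure.addHaar_closedBall _ _ hR, ENNReal.toReal_mul,
      ENNReal.toReal_ofReal (by positivity)]
    rfl
  have hcell : ∀ R : ℝ, volume.real (gfloor ⁻¹' (latticeBall ι R : Set (ι → ℤ × ℤ)) :
      Set (EuclideanSpace ℂ ι)) = (latticeBall ι R).card * c := by
    intro R
    rw [measureReal_def, volume_gfloor_preimage, ENNReal.toReal_mul]
    simp [c, measureReal_def]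
  have hlow : ∀ R, d ≤ R → (R - d) ^ D * V ≤ (latticeBall ι R).card * c := by
    intro R hR
    rw [← hcell, ← hvol _ (by linarith)]
    refine measureReal_mono (fun z hz => ?_) ?_
    · simp only [Set.mem_preimage, Finset.mem_coe, mem_latticeBall, Metric.mem_closedBall,
        dist_zero_right] at hz ⊢
      have := norm_sub_le z (z - gauss (gfloor z))
      rw [sub_sub_cancel] at this
      linarith [norm_sub_gauss_gfloor_le z]
    · rw [volume_gfloor_preimage]
      exact ENNReal.mul_ne_top (ENNReal.natCast_ne_top _) volume_cell_ne_top
  have hup : ∀ R, 0 ≤ R → (latticeBall ι R).card * c ≤ (R + d) ^ D * V := by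
    intro R hR
    rw [← hcell, ← hvol _ (by linarith)]
    refine measureReal_mono (fun z hz => ?_) measure_closedBall_lt_top.ne
    simp only [Set.mem_preimage, Finset.mem_coe, mem_latticeBall, Metric.mem_closedBall,
      dist_zero_right] at hz ⊢
    have := norm_add_le (gauss (gfloor z)) (z - gauss (gfloor z))
    rw [add_sub_cancel] at this
    linarith [norm_sub_gauss_gfloor_le z]
  refine ⟨V / c, by positivity, ?_⟩
  have hlim : ∀ e : ℝ, Tendsto (fun R : ℝ => (1 + e * R⁻¹) ^ D * (V / c)) atTop (𝓝 (V / c)) := by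
    intro e
    have : Tendsto (fun R : ℝ => (1 + e * R⁻¹) ^ D * (V / c)) atTop
        (𝓝 ((1 + e * 0) ^ D * (V / c))) :=
      ((tendsto_const_nhds.add (tendsto_inv_atTop_zero.const_mul e)).pow D).mul_const _
    simpa using this
  refine tendsto_of_tendsto_of_tendsto_of_le_of_le' (hlim (-d)) (hlim d) ?_ ?_
  · filter_upwards [eventually_ge_atTop d, eventually_gt_atTop 0] with R h1 h2
    rw [le_div_iff₀ (by positivity)]
    have : (1 + -d * R⁻¹) ^ D * (V / c) * R ^ D = (R - d) ^ D * V / c := by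
      rw [show R - d = (1 + -d * R⁻¹) * R by field_simp; ring, mul_pow]; ring
    rw [this, div_le_iff₀ hc]
    exact hlow R h1
  · filter_upwards [eventually_gt_atTop 0] with R h2
    rw [div_le_iff₀ (by positivity)]
    have : (1 + d * R⁻¹) ^ D * (V / c) * R ^ D = (R + d) ^ D * V / c := by
      rw [show R + d = (1 + d * R⁻¹) * R by field_simp, mul_pow]; ring
    rw [this, le_div_iff₀ hc]
    exact hup R h2.le

lemma exists_latticeBall_radius [Nonempty ι] {C η : ℝ} (hC : 0 ≤ C) (hη : 0 < η) :
    ∃ R : ℝ, 0 ≤ R ∧ 0 < ∑ x ∈ latticeBall ι (R + C), ‖gauss x‖ ^ 2 ∧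
      C ^ 2 * (latticeBall ι (R + C)).card + 4 * (R + C) ^ 2 *
        ((latticeBall ι (R + C)).card - (latticeBall ι R).card)
      ≤ η * ∑ x ∈ latticeBall ι (R + C), ‖gauss x‖ ^ 2 := by
  obtain ⟨L, hL, hlim⟩ := tendsto_card_latticeBall (ι := ι)
  set D := Module.finrank ℝ (EuclideanSpace ℂ ι) with hD
  have hD0 : D ≠ 0 := by
    rw [hD]
    exact Module.finrank_pos.ne'
  set N : ℝ → ℝ := fun R => (latticeBall ι R).card with hN
  set f : ℝ → ℝ := fun R => N R / R ^ D with hf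
  have l1 : Tendsto (fun R => C ^ 2 * (f R * (R⁻¹ * R⁻¹)) + 4 * (f R - f (R - C) *
      (1 + -C * R⁻¹) ^ D)) atTop (𝓝 (C ^ 2 * (L * (0 * 0)) + 4 * (L - L * (1 + -C * 0) ^ D))) := by
    refine ((hlim.mul (tendsto_inv_atTop_zero.mul tendsto_inv_atTop_zero)).const_mul _).add
      ((hlim.sub ((hlim.comp (tendsto_atTop_add_const_right _ (-C) tendsto_id)).mul
        ((tendsto_const_nhds.add (tendsto_inv_atTop_zero.const_mul _)).pow D))).const_mul _)
  have l2 : Tendsto (fun R => (η / 4) * (f R - f (R / 2) * (1 / 2) ^ D)) atTop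
      (𝓝 ((η / 4) * (L - L * (1 / 2) ^ D))) :=
    (hlim.sub ((hlim.comp (tendsto_id.atTop_div_const two_pos)).mul_const _)).const_mul _
  have hhalf : (1 / 2 : ℝ) ^ D < 1 := pow_lt_one₀ (by norm_num) (by norm_num) hD0
  have hpos : 0 < L - L * (1 / 2) ^ D := by nlinarith
  have l3 : ∀ᶠ R in atTop, 0 < f R - f (R / 2) * (1 / 2) ^ D :=
    (hlim.sub ((hlim.comp (tendsto_id.atTop_div_const two_pos)).mul_const _)).eventually
      (lt_mem_nhds hpos)
  have l4 := l1.eventually_lt l2 (by simp only [mul_zero, add_zero, one_pow, mul_one, sub_self]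
                                     positivity)
  obtain ⟨R, h3, h4, h5, h6⟩ := (l3.and (l4.and ((eventually_gt_atTop C).and
    (eventually_gt_atTop 0)))).exists
  have hS : (N R - N (R / 2)) * (R / 2) ^ 2 ≤ ∑ x ∈ latticeBall ι R, ‖gauss x‖ ^ 2 := by
    have hsub : latticeBall ι (R / 2) ⊆ latticeBall ι R := fun x hx => by
      rw [mem_latticeBall] at hx ⊢; linarith
    calc (N R - N (R / 2)) * (R / 2) ^ 2
        = ∑ x ∈ latticeBall ι R \ latticeBall ι (R / 2), (R / 2) ^ 2 := by
          rw [Finset.sum_const, nsmul_eq_mul, Finset.cast_card_sdiff hsub]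
      _ ≤ ∑ x ∈ latticeBall ι R \ latticeBall ι (R / 2), ‖gauss x‖ ^ 2 := by
          refine Finset.sum_le_sum fun x hx => ?_
          rw [Finset.mem_sdiff, mem_latticeBall, mem_latticeBall, not_le] at hx
          exact pow_le_pow_left₀ (by positivity) hx.2.le 2
      _ ≤ _ := Finset.sum_le_sum_of_subset_of_nonneg Finset.sdiff_subset
          fun _ _ _ => by positivity
  have e1 : f R * R ^ D = N R := by simp only [hf]; field_simp
  have e2 : f (R / 2) * (1 / 2) ^ D * R ^ D = N (R / 2) := by
    rw [mul_assoc, ← mul_pow, show 1 / 2 * R = R / 2 by ring]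
    simp only [hf]; field_simp
  have e3 : f (R - C) * (1 + -C * R⁻¹) ^ D * R ^ D = N (R - C) := by
    rw [mul_assoc, ← mul_pow, show (1 + -C * R⁻¹) * R = R - C by field_simp; ring]
    have : R - C ≠ 0 := (sub_pos.2 h5).ne'
    simp only [hf]; field_simp
  have hRD : 0 < R ^ D := by positivity
  refine ⟨R - C, by linarith, ?_, ?_⟩ <;> rw [sub_add_cancel]
  · refine lt_of_lt_of_le ?_ hS
    have := mul_pos h3 hRD
    rw [sub_mul, e1, e2] at this
    positivity
  · refine le_trans ?_ (mul_le_mul_of_nonneg_left hS hη.le)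
    have h7 := (mul_lt_mul_of_pos_right h4 (mul_pos hRD (pow_pos h6 2))).le
    have e4 : (C ^ 2 * (f R * (R⁻¹ * R⁻¹)) + 4 * (f R - f (R - C) * (1 + -C * R⁻¹) ^ D))
        * (R ^ D * R ^ 2) = C ^ 2 * (f R * R ^ D) + 4 * R ^ 2 * (f R * R ^ D -
          f (R - C) * (1 + -C * R⁻¹) ^ D * R ^ D) := by
      field_simp
    have e5 : η / 4 * (f R - f (R / 2) * (1 / 2) ^ D) * (R ^ D * R ^ 2)
        = η * ((f R * R ^ D - f (R / 2) * (1 / 2) ^ D * R ^ D) * (R / 2) ^ 2) := by ring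
    rw [e4, e5, e1, e2, e3] at h7
    exact h7

end Lattice

/-- The permutation matrices, as a homomorphism into the unitary group. -/
def permU (X : Type) [Fintype X] [DecidableEq X] : Equiv.Perm X →* MatU X where
  toFun σ := ⟨Matrix.of fun i j => if i = σ j then 1 else 0, by
    have h : (Matrix.of fun i j => if i = σ j then (1 : ℂ) else 0)ᴴ
        * (Matrix.of fun i j => if i = σ j then (1 : ℂ) else 0) = 1 := by
      ext i j
      by_cases hij : i = j <;> simp [Matrix.mul_apply, Matrix.one_apply, apply_ite, hij, Ne.symm]
    exact ⟨h, mul_eq_one_comm.1 h⟩⟩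
  map_one' := by
    ext i j
    simp only [of_apply, Equiv.Perm.coe_one, id_eq, OneMemClass.coe_one, Matrix.one_apply]
    congr
  map_mul' σ τ := by
    ext i j
    simp [Matrix.mul_apply]
    congr

section Dilation

variable {ι κ : Type} [Fintype ι] [DecidableEq ι] [Fintype κ] [DecidableEq κ]

lemma permU_mul_apply (σ : Equiv.Perm κ) (A : Matrix κ ι ℂ) (x : κ) (b : ι) :
    ((permU κ σ).1 * A) (σ x) b = A x b := by
  simp [permU, Matrix.mul_apply]

lemma l2_opNorm_sq_le_sum (A : Matrix κ ι ℂ) : ‖A‖ ^ 2 ≤ ∑ i, ∑ j, ‖A i j‖ ^ 2 := by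
  have h0 : (0 : ℝ) ≤ ∑ i, ∑ j, ‖A i j‖ ^ 2 := by positivity
  suffices ‖A‖ ≤ √(∑ i, ∑ j, ‖A i j‖ ^ 2) by
    rw [← Real.sq_sqrt h0]
    exact pow_le_pow_left₀ (norm_nonneg _) this 2
  rw [l2_opNorm_def]
  refine ContinuousLinearMap.opNorm_le_bound _ (Real.sqrt_nonneg _) fun x => ?_
  refine le_of_sq_le_sq ?_ (by positivity)
  rw [mul_pow, Real.sq_sqrt h0, EuclideanSpace.norm_sq_eq, EuclideanSpace.norm_sq_eq,
    Finset.sum_mul]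
  refine Finset.sum_le_sum fun i _ => ?_
  refine le_trans ?_ (Finset.sum_mul_sq_le_sq_mul_sq Finset.univ (fun j => ‖A i j‖)
    fun j => ‖x j‖)
  refine pow_le_pow_left₀ (norm_nonneg _) ?_ 2
  simp only [LinearEquiv.trans_apply, LinearMap.coe_toContinuousLinearMap',
    Matrix.toLpLin_apply, Matrix.mulVec, dotProduct]
  refine (norm_sum_le _ _).trans (le_of_eq ?_)
  simp

/-- A unitary matrix as a real linear isometry. -/
def MatU.toIsometry (u : MatU ι) : EuclideanSpace ℂ ι ≃ₗᵢ[ℝ] EuclideanSpace ℂ ι where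
  toFun x := WithLp.toLp 2 (u.1 *ᵥ x.ofLp)
  invFun x := WithLp.toLp 2 (u.1ᴴ *ᵥ x.ofLp)
  map_add' x y := by simp [Matrix.mulVec_add]
  map_smul' c x := by simp [Matrix.mulVec_smul]
  left_inv x := by simp [MatU.star_mul]
  right_inv x := by simp [MatU.mul_star]
  norm_map' x := by
    have key : ∀ (A : Matrix ι ι ℂ) (y : EuclideanSpace ℂ ι), ‖A‖ ≤ 1 →
        ‖WithLp.toLp 2 (A *ᵥ y.ofLp)‖ ≤ ‖y‖ := fun A y hA =>
      (l2_opNorm_mulVec A y).trans (mul_le_of_le_one_left (norm_nonneg _) hA)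
    refine le_antisymm (key _ _ u.norm_le) ?_
    have := key u.1ᴴ (WithLp.toLp 2 (u.1 *ᵥ x.ofLp)) (norm_conjTranspose_le_one u.norm_le)
    simpa [MatU.star_mul] using this

lemma sum_latticeBall_comp {R : ℝ} (e : (ι → ℤ × ℤ) → ι → ℤ × ℤ) (he : Function.Involutive e)
    (hn : ∀ x, ‖gauss (e x)‖ = ‖gauss x‖) (f : (ι → ℤ × ℤ) → ℂ) :
    ∑ x ∈ latticeBall ι R, f (e x) = ∑ x ∈ latticeBall ι R, f x :=
  Finset.sum_nbij' e e (fun x hx => by rw [mem_latticeBall] at hx ⊢; rwa [hn])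
    (fun x hx => by rw [mem_latticeBall] at hx ⊢; rwa [hn]) (fun x _ => he x) (fun x _ => he x)
    fun _ _ => rfl

lemma sum_gauss_off_diag (R : ℝ) {a b : ι} (hab : a ≠ b) :
    ∑ x ∈ latticeBall ι R, gauss x a * star (gauss x b) = 0 := by
  have h := sum_latticeBall_comp (R := R) (fun x : ι → ℤ × ℤ => Function.update x a (-x a))
    (fun x => by simp) ?_ fun x => gauss x a * star (gauss x b)
  · have h2 : ∀ x : ι → ℤ × ℤ, gauss (Function.update x a (-x a)) a
        * star (gauss (Function.update x a (-x a)) b) = -(gauss x a * star (gauss x b)) := by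
      intro x
      simp only [gauss, Function.update_self, Function.update_of_ne hab.symm]
      rw [← neg_mul]
      congr 1
      simp [Complex.ext_iff]
    simp only [h2, Finset.sum_neg_distrib] at h
    linear_combination (-1 / 2 : ℂ) * h
  · intro x
    rw [EuclideanSpace.norm_eq, EuclideanSpace.norm_eq]
    congr 1
    refine Finset.sum_congr rfl fun c _ => ?_
    rcases eq_or_ne c a with rfl | hc
    · simp only [gauss, Function.update_self]
      rw [← Complex.normSq_eq_norm_sq, ← Complex.normSq_eq_norm_sq]
      simp [Complex.normSq_apply]
    · simp [gauss, Function.update_of_ne hc]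

lemma sum_gauss_diag (R : ℝ) (a b : ι) :
    ∑ x ∈ latticeBall ι R, gauss x a * star (gauss x a)
      = ∑ x ∈ latticeBall ι R, gauss x b * star (gauss x b) := by
  have h := sum_latticeBall_comp (R := R) (fun x : ι → ℤ × ℤ => x ∘ Equiv.swap a b)
    (fun x => by funext c; simp) ?_ fun x => gauss x a * star (gauss x a)
  · rw [← h]
    simp [gauss]
  · intro x
    rw [EuclideanSpace.norm_eq, EuclideanSpace.norm_eq]
    congr 1
    exact Equiv.sum_comp (Equiv.swap a b) fun c => ‖gauss x c‖ ^ 2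

lemma sum_gauss (R : ℝ) (a : ι) :
    Fintype.card ι * ∑ x ∈ latticeBall ι R, gauss x a * star (gauss x a)
      = (∑ x ∈ latticeBall ι R, ‖gauss x‖ ^ 2 : ℝ) := by
  have h : ∑ b : ι, ∑ x ∈ latticeBall ι R, gauss x b * star (gauss x b)
      = Fintype.card ι * ∑ x ∈ latticeBall ι R, gauss x a * star (gauss x a) := by
    rw [Finset.sum_congr rfl fun b _ => sum_gauss_diag R b a, Finset.sum_const, nsmul_eq_mul]
    simp
  rw [← h, Finset.sum_comm]
  push_cast
  refine Finset.sum_congr rfl fun x _ => ?_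
  rw [← Complex.ofReal_pow, EuclideanSpace.norm_sq_eq]
  push_cast
  refine Finset.sum_congr rfl fun b _ => ?_
  rw [← Complex.mul_conj']
  rfl

lemma norm_dilation_row {S : Finset (ι → ℤ × ℤ)} (r : MatU ι) (p : Equiv.Perm S) (c : ℝ)
    (y : S) :
    ∑ b, ‖((Matrix.of fun (x : S) a => (c : ℂ) * star (gauss x.1 a)) * r.1
        - (permU S p).1 * Matrix.of fun (x : S) a => (c : ℂ) * star (gauss x.1 a)) (p y) b‖ ^ 2
      = c ^ 2 * ‖gauss (p y).1 - r.toIsometry (gauss y.1)‖ ^ 2 := by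
  have h : ‖gauss (p y).1 - r.toIsometry (gauss y.1)‖
      = ‖r.toIsometry.symm (gauss (p y).1) - gauss y.1‖ := by
    rw [← r.toIsometry.norm_map (r.toIsometry.symm _ - _), map_sub, LinearIsometryEquiv.apply_symm_apply]
  rw [h, EuclideanSpace.norm_sq_eq, Finset.mul_sum]
  refine Finset.sum_congr rfl fun b _ => ?_
  rw [Matrix.sub_apply, permU_mul_apply]
  have h2 : (r.toIsometry.symm (gauss (p y).1) - gauss y.1) b
      = ∑ a, star (r.1 a b) * gauss (p y).1 a - gauss y.1 b := rfl
  have h3 : ((Matrix.of fun (x : S) a => (c : ℂ) * star (gauss x.1 a)) * r.1) (p y) b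
      - (Matrix.of fun (x : S) a => (c : ℂ) * star (gauss x.1 a)) y b
      = c * star (∑ a, star (r.1 a b) * gauss (p y).1 a - gauss y.1 b) := by
    simp only [Matrix.mul_apply, of_apply, star_sub, star_sum, star_mul, star_star, mul_sub,
      Finset.mul_sum, mul_assoc]
  rw [h2, h3, norm_mul, mul_pow, norm_star, Complex.norm_real, Real.norm_eq_abs, sq_abs]

/-- Every finite family of unitary matrices is, up to `ε`, a compression of a family of
permutation matrices along an approximately intertwining isometry. -/
theorem exists_perm_dilation {m : ℕ} {ε : ℝ} (hε : 0 < ε) (r : Fin m → MatU ι) :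
    ∃ (X : Type) (_ : Fintype X) (_ : DecidableEq X) (p : Fin m → Equiv.Perm X)
      (J : Matrix X ι ℂ), Jᴴ * J = 1 ∧ ∀ i, ‖J * (r i).1 - (permU X (p i)).1 * J‖ ≤ ε := by
  rcases isEmpty_or_nonempty ι with hι | hι
  · exact ⟨Empty, inferInstance, inferInstance, fun _ => 1, 0, Matrix.ext fun a => hι.elim a,
      fun i => by simpa using hε.le⟩
  choose f hf hfC using fun i => exists_injective_gauss (r i).toIsometry
  set C := 2 * √(2 * Fintype.card ι)
  have hC : 0 ≤ C := by positivity
  have hn : (0 : ℝ) < Fintype.card ι := by exact_mod_cast Fintype.card_pos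
  obtain ⟨R, hR, hS, hbd⟩ := exists_latticeBall_radius (ι := ι) hC
    (show 0 < ε ^ 2 / Fintype.card ι by positivity)
  set S := ∑ x ∈ latticeBall ι (R + C), ‖gauss x‖ ^ 2
  have hsub : latticeBall ι R ⊆ latticeBall ι (R + C) := fun x hx => by
    rw [mem_latticeBall] at hx ⊢; linarith
  have hfmem : ∀ i, ∀ x ∈ latticeBall ι R, f i x ∈ latticeBall ι (R + C) := by
    intro i x hx
    rw [mem_latticeBall] at hx ⊢
    have h1 := norm_add_le ((r i).toIsometry (gauss x))
      (gauss (f i x) - (r i).toIsometry (gauss x))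
    rw [add_sub_cancel, LinearIsometryEquiv.norm_map] at h1
    linarith [hfC i x]
  have hp : ∀ i, ∃ p : Equiv.Perm (latticeBall ι (R + C)),
      ∀ y, y.1 ∈ latticeBall ι R → (p y).1 = f i y.1 := by
    intro i
    let g : {y : latticeBall ι (R + C) // y.1 ∈ latticeBall ι R} → latticeBall ι (R + C) :=
      fun y => ⟨f i y.1.1, hfmem i _ y.2⟩
    have hg : Function.Injective g := fun y z h =>
      Subtype.ext (Subtype.ext (hf i (congrArg Subtype.val h)))
    classical
    refine ⟨(Equiv.ofInjective g hg : _ ≃ {x // x ∈ Set.range g}).extendSubtype, fun y hy => ?_⟩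
    rw [Equiv.extendSubtype_apply_of_mem _ y hy]
    rfl
  choose p hp using hp
  have hc2 : √(Fintype.card ι / S) ^ 2 = Fintype.card ι / S := Real.sq_sqrt (by positivity)
  have hc3 : ((√(Fintype.card ι / S) : ℝ) : ℂ) * ((√(Fintype.card ι / S) : ℝ) : ℂ)
      = ((Fintype.card ι / S : ℝ) : ℂ) := by
    rw [← Complex.ofReal_mul, ← sq, hc2]
  refine ⟨latticeBall ι (R + C), inferInstance, inferInstance, p,
    Matrix.of fun x a => ((√(Fintype.card ι / S) : ℝ) : ℂ) * star (gauss x.1 a), ?_, fun i => ?_⟩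
  · ext a b
    rw [Matrix.mul_apply]
    simp only [conjTranspose_apply, of_apply, star_mul, star_star]
    have h1 : ∀ x : latticeBall ι (R + C), gauss x.1 a * star ((√(Fintype.card ι / S) : ℝ) : ℂ)
        * (((√(Fintype.card ι / S) : ℝ) : ℂ) * star (gauss x.1 b))
        = ((Fintype.card ι / S : ℝ) : ℂ) * (gauss x.1 a * star (gauss x.1 b)) := by
      intro x
      rw [show star ((√(Fintype.card ι / S) : ℝ) : ℂ) = (√(Fintype.card ι / S) : ℝ) from
        Complex.conj_ofReal _]
      linear_combination (gauss x.1 a * star (gauss x.1 b)) * hc3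
    rw [Finset.sum_congr rfl fun x _ => h1 x, ← Finset.mul_sum, Finset.sum_coe_sort
      (latticeBall ι (R + C)) fun x => gauss x a * star (gauss x b)]
    rcases eq_or_ne a b with rfl | hab
    · have h2 := sum_gauss (R + C) a
      rw [Matrix.one_apply_eq]
      have hS' : (S : ℂ) ≠ 0 := by exact_mod_cast hS.ne'
      push_cast
      rw [div_mul_eq_mul_div, h2]
      exact div_self hS'
    · rw [sum_gauss_off_diag _ hab, Matrix.one_apply_ne hab, mul_zero]
  · refine le_of_sq_le_sq ((l2_opNorm_sq_le_sum _).trans ?_) hε.le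
    rw [← Equiv.sum_comp (p i), Finset.sum_congr rfl fun y _ => norm_dilation_row (r i) (p i) _ y,
      ← Finset.mul_sum, hc2]
    have h1 : ∑ y, ‖gauss (p i y).1 - (r i).toIsometry (gauss y.1)‖ ^ 2
        ≤ ∑ y : latticeBall ι (R + C), (C ^ 2 + if y.1 ∈ latticeBall ι R then 0 else
          4 * (R + C) ^ 2) := by
      refine Finset.sum_le_sum fun y _ => ?_
      split_ifs with hy
      · rw [hp i y hy, add_zero]
        exact pow_le_pow_left₀ (norm_nonneg _) (hfC i _) 2
      · have h2 := mem_latticeBall.1 y.2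
        have h3 := mem_latticeBall.1 (p i y).2
        have h4 := norm_sub_le (gauss (p i y).1) ((r i).toIsometry (gauss y.1))
        rw [LinearIsometryEquiv.norm_map] at h4
        have h5 := pow_le_pow_left₀ (norm_nonneg _) (h4.trans (add_le_add h3 h2)) 2
        nlinarith [sq_nonneg C]
    have h2 : ∑ y : latticeBall ι (R + C), (C ^ 2 + if y.1 ∈ latticeBall ι R then 0 else
          4 * (R + C) ^ 2) = C ^ 2 * (latticeBall ι (R + C)).card + 4 * (R + C) ^ 2 *
        ((latticeBall ι (R + C)).card - (latticeBall ι R).card) := by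
      rw [Finset.sum_coe_sort (latticeBall ι (R + C)) fun y => C ^ 2 + if y ∈ latticeBall ι R
        then 0 else 4 * (R + C) ^ 2, Finset.sum_add_distrib, ← Finset.cast_card_sdiff hsub,
        Finset.sum_ite, Finset.sum_const_zero, zero_add, Finset.sum_const, Finset.sum_const,
        ← Finset.sdiff_eq_filter, nsmul_eq_mul, nsmul_eq_mul]
      ring
    calc Fintype.card ι / S * ∑ y, ‖gauss (p i y).1 - (r i).toIsometry (gauss y.1)‖ ^ 2
        ≤ Fintype.card ι / S * (ε ^ 2 / Fintype.card ι * S) :=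
          mul_le_mul_of_nonneg_left ((h1.trans h2.le).trans hbd) (by positivity)
      _ = ε ^ 2 := by field_simp

end Dilation

section Emb

variable {X Y Z : Type} [Fintype X] [DecidableEq X] [Fintype Y] [DecidableEq Y]
  [Fintype Z] [DecidableEq Z]

/-- The matrix of the linear map that sends the basis vector `x` to the basis vector `f x`. -/
def emb (f : X → Y) : Matrix Y X ℂ := Matrix.of fun y x => if y = f x then 1 else 0

lemma emb_mul_emb (f : Y → Z) (g : X → Y) : emb f * emb g = emb (f ∘ g) := by
  ext z x
  simp [emb, Matrix.mul_apply]

lemma emb_conjTranspose_mul {f : X → Y} (hf : Function.Injective f) : (emb f)ᴴ * emb f = 1 := by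
  ext x x'
  simp [emb, Matrix.mul_apply, Matrix.one_apply, apply_ite, hf.eq_iff, eq_comm]

lemma emb_conjTranspose_mul_of_disjoint {f : X → Y} {g : Z → Y} (h : ∀ x z, f x ≠ g z) :
    (emb f)ᴴ * emb g = 0 := by
  ext x z
  simp [emb, Matrix.mul_apply, apply_ite, (h x z).symm]

lemma permU_coe (p : Equiv.Perm X) : (permU X p).1 = emb p := rfl

lemma norm_emb_le {f : X → Y} (hf : Function.Injective f) : ‖emb f‖ ≤ 1 :=
  norm_le_one_of_isometry (emb_conjTranspose_mul hf)

end Emb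

section Twisted

variable {m : ℕ} (α : FreeGroup (Fin m) ≃* FreeGroup (Fin m))
variable {ι κ : Type} [Fintype ι] [DecidableEq ι] [Fintype κ] [DecidableEq κ]

/-- The pair of a tuple `r` and an element `v` satisfies the relations of the mapping torus of
`α`: conjugation by `v` acts on the words in `r` by `α`. -/
def IsExact {G : Type} [Group G] (r : Fin m → G) (v : G) : Prop :=
  ∀ i, v * r i = FreeGroup.lift r (α (FreeGroup.of i)) * v

/-- The pair of a tuple `r` of unitaries and a unitary `v` satisfies the relations of the
mapping torus of `α` up to `δ`. -/
def IsApprox (δ : ℝ) (r : Fin m → MatU ι) (v : MatU ι) : Prop :=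
  ∀ i, ‖v.1 * (r i).1 - (FreeGroup.lift r (α (FreeGroup.of i))).1 * v.1‖ ≤ δ

lemma IsExact.map {G H : Type} [Group G] [Group H] (f : G →* H) {r : Fin m → G} {v : G}
    (h : IsExact α r v) : IsExact α (f ∘ r) (f v) := by
  intro i
  have h1 : FreeGroup.lift (f ∘ r) = f.comp (FreeGroup.lift r) := by ext; simp
  rw [h1, MonoidHom.comp_apply, ← map_mul, ← h i, map_mul, Function.comp_apply]

lemma IsApprox.iterate (j : ℕ) (g : FreeGroup (Fin m)) : ∃ C : ℝ, 0 < C ∧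
    ∀ (ι : Type) [Fintype ι] [DecidableEq ι] (r : Fin m → MatU ι) (v : MatU ι) (δ : ℝ),
      0 ≤ δ → IsApprox α δ r v →
      ‖(v ^ j).1 * (FreeGroup.lift r g).1 - (FreeGroup.lift r (α^[j] g)).1 * (v ^ j).1‖
        ≤ C * δ := by
  induction j with
  | zero => exact ⟨1, one_pos, fun ι _ _ r v δ hδ _ => by simpa using hδ⟩
  | succ j ih =>
    obtain ⟨C, hC, ih⟩ := ih
    obtain ⟨D, hD, hw⟩ := intertwine_word (α^[j] g)
    refine ⟨C + D, by positivity, fun ι _ _ r v δ hδ h => ?_⟩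
    have h1 := hw ι ι (FreeGroup.lift r) ((FreeGroup.lift r).comp α.toMonoidHom) v.1 δ hδ
      fun i => by simpa using h i
    have h2 := intertwine_comp (MatU.norm_le _) (MatU.norm_le _) (ih ι r v δ hδ h) h1
    rw [add_mul, pow_succ', Function.iterate_succ_apply']
    exact h2

/-- Precomposition with `α`, as a permutation of the finite set of homomorphisms from the free
group to a finite group. -/
def twist (G : Type) [Group G] : Equiv.Perm (Fin m → G) where
  toFun r i := FreeGroup.lift r (α (FreeGroup.of i))
  invFun r i := FreeGroup.lift r (α.symm (FreeGroup.of i))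
  left_inv r := by
    have h : FreeGroup.lift (fun i => FreeGroup.lift r (α (FreeGroup.of i)))
        = (FreeGroup.lift r).comp α.toMonoidHom := by ext; simp
    funext i
    exact (DFunLike.congr_fun h _).trans (by simp)
  right_inv r := by
    have h : FreeGroup.lift (fun i => FreeGroup.lift r (α.symm (FreeGroup.of i)))
        = (FreeGroup.lift r).comp α.symm.toMonoidHom := by ext; simp
    funext i
    exact (DFunLike.congr_fun h _).trans (by simp)

lemma lift_twist {G : Type} [Group G] (r : Fin m → G) :
    FreeGroup.lift (twist α G r) = (FreeGroup.lift r).comp α.toMonoidHom := by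
  ext; simp [twist]

lemma lift_twist_iterate {G : Type} [Group G] (r : Fin m → G) (j : ℕ) (g : FreeGroup (Fin m)) :
    FreeGroup.lift ((twist α G)^[j] r) g = FreeGroup.lift r (α^[j] g) := by
  induction j generalizing g with
  | zero => rfl
  | succ j ih =>
    rw [Function.iterate_succ_apply', lift_twist, MonoidHom.comp_apply, ih,
      Function.iterate_succ_apply]
    rfl

/-- The generators of the free group acting on the disjoint union of finitely many copies of all
permutation representations on `X`. -/
def unionGen (X : Type) (N : ℕ) (i : Fin m) :
    Equiv.Perm (X × ((Fin m → Equiv.Perm X) × ZMod N)) :=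
  Equiv.prodCongrLeft fun y => y.1 i

/-- The permutation of the disjoint union of the permutation representations on `X` that makes
`unionGen` equivariant with respect to `α`, combined with a cyclic shift of the copies. -/
def unionShift (X : Type) (N : ℕ) : Equiv.Perm (X × ((Fin m → Equiv.Perm X) × ZMod N)) :=
  Equiv.prodCongr (Equiv.refl X) (Equiv.prodCongr (twist α _).symm (Equiv.subRight 1))

lemma isExact_union (X : Type) (N : ℕ) : IsExact α (unionGen X N) (unionShift α X N) := by
  let U : FreeGroup (Fin m) →* Equiv.Perm (X × ((Fin m → Equiv.Perm X) × ZMod N)) :=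
    { toFun := fun g => Equiv.prodCongrLeft fun y => FreeGroup.lift y.1 g
      map_one' := by ext x <;> simp
      map_mul' := fun g h => by ext x <;> simp }
  have hU : FreeGroup.lift (unionGen X N) = U := by
    ext i x <;> simp [U, unionGen]
  intro i
  rw [hU]
  have h : ∀ h : Fin m → Equiv.Perm X,
      FreeGroup.lift ((twist α _).symm h) (α (FreeGroup.of i)) = h i := fun h =>
    congrFun ((twist α _).apply_symm_apply h) i
  refine Equiv.ext fun ⟨x, y, j⟩ => ?_
  change ((y i) x, _) = (FreeGroup.lift ((twist α _).symm y) (α (FreeGroup.of i)) x, _)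
  rw [h]
  rfl

/-- Every approximate representation of the mapping torus of `α` is approximately contained in
an exact representation. -/
theorem exists_exact_dilation {ε : ℝ} (hε : 0 < ε) : ∃ δ : ℝ, 0 < δ ∧
    ∀ (ι : Type) [Fintype ι] [DecidableEq ι] (r : Fin m → MatU ι) (v : MatU ι), IsApprox α δ r v →
      ∃ (κ : Type) (_ : Fintype κ) (_ : DecidableEq κ) (R : Fin m → MatU κ) (V : MatU κ)
        (J : Matrix κ ι ℂ), IsExact α R V ∧ Jᴴ * J = 1 ∧
        (∀ i, ‖J * (r i).1 - (R i).1 * J‖ ≤ ε) ∧ ‖J * v.1 - V.1 * J‖ ≤ ε := by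
  obtain ⟨N, hN⟩ := exists_nat_ge ((2 / ε) ^ 2)
  have hN0 : (0 : ℝ) < N := lt_of_lt_of_le (by positivity) hN
  have hNn : N ≠ 0 := by exact_mod_cast hN0.ne'
  have : NeZero N := ⟨hNn⟩
  set c : ℝ := (√N)⁻¹
  have hc0 : 0 ≤ c := by positivity
  have hc1 : c ≤ 1 := inv_le_one_of_one_le₀ (Real.one_le_sqrt.2
    (by exact_mod_cast Nat.one_le_iff_ne_zero.2 hNn))
  have hcc : N * (c * c) = 1 := by
    rw [← mul_inv, Real.mul_self_sqrt hN0.le, mul_inv_cancel₀ hN0.ne']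
  have hcε : 2 * c ≤ ε := by
    have h1 : 2 / ε ≤ √N := Real.le_sqrt_of_sq_le hN
    rw [div_le_iff₀ hε] at h1
    rw [← div_eq_mul_inv, div_le_iff₀ (by positivity)]
    linarith
  choose C hC hCw using fun (j : ℕ) (i : Fin m) => IsApprox.iterate α j (FreeGroup.of i)
  choose D hD hDw using fun (j : ℕ) (i : Fin m) => intertwine_word (α^[j] (FreeGroup.of i))
  set K : ℝ := 1 + ∑ j ∈ Finset.range N, ∑ i, (C j i + D j i)
  have hK : 0 < K := add_pos_of_pos_of_nonneg one_pos (Finset.sum_nonneg fun j _ =>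
    Finset.sum_nonneg fun i _ => (add_pos (hC j i) (hD j i)).le)
  refine ⟨ε / K, by positivity, fun ι _ _ r v hrv => ?_⟩
  obtain ⟨X, _, _, p, J₀, hJ₀, hp⟩ := exists_perm_dilation (show 0 < ε / K by positivity) r
  have hJ₀1 := norm_le_one_of_isometry hJ₀
  set T := twist α (Equiv.Perm X)
  let E : ℕ → Matrix (X × ((Fin m → Equiv.Perm X) × ZMod N)) X ℂ :=
    fun j => emb fun x => (x, T^[j] p, (j : ZMod N))
  have hE1 : ∀ j, (E j)ᴴ * E j = 1 := fun j => emb_conjTranspose_mul fun x y h => congrArg Prod.fst h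
  have hE0 : ∀ j ∈ Finset.range N, ∀ k ∈ Finset.range N, j ≠ k → (E j)ᴴ * E k = 0 := by
    intro j hj k hk hjk
    refine emb_conjTranspose_mul_of_disjoint fun x z h => hjk ?_
    have h1 : (j : ZMod N) = k := congrArg (fun q => q.2.2) h
    rw [ZMod.natCast_eq_natCast_iff', Nat.mod_eq_of_lt (Finset.mem_range.1 hj),
      Nat.mod_eq_of_lt (Finset.mem_range.1 hk)] at h1
    exact h1
  have hgen : ∀ i j, (permU _ (unionGen X N i)).1 * E j = E j * (permU X (T^[j] p i)).1 := by
    intro i j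
    simp only [permU_coe, E, emb_mul_emb]
    rfl
  have hshift : ∀ j, (permU _ (unionShift α X N)).1 * E (j + 1) = E j := by
    intro j
    simp only [permU_coe, E, emb_mul_emb]
    congr 1
    funext x
    refine Prod.ext rfl (Prod.ext ?_ ?_)
    · change T.symm (T^[j + 1] p) = _
      rw [Function.iterate_succ_apply', Equiv.symm_apply_apply]
    · change ((j + 1 : ℕ) : ZMod N) - 1 = j
      push_cast
      ring
  let F : ℕ → Matrix X ι ℂ := fun j => J₀ * (v ^ j).1
  have hF1 : ∀ j, (F j)ᴴ * F j = 1 := by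
    intro j
    simp only [F, conjTranspose_mul]
    rw [Matrix.mul_assoc, ← Matrix.mul_assoc J₀ᴴ, hJ₀, Matrix.one_mul, MatU.star_mul]
  have hFn : ∀ j, ‖F j‖ ≤ 1 := fun j => norm_le_one_of_isometry (hF1 j)
  have hFr : ∀ i j, ‖F j * (r i).1 - (permU X (T^[j] p i)).1 * F j‖
      ≤ (C j i + D j i) * (ε / K) := by
    intro i j
    have h1 := hDw j i ι X (FreeGroup.lift r) ((permU X).comp (FreeGroup.lift p)) J₀ (ε / K)
      (by positivity) fun i => by simpa using hp i
    have h2 := intertwine_comp (MatU.norm_le _) hJ₀1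
      (hCw j i ι r v _ (by positivity) hrv) h1
    rw [add_mul]
    rw [MonoidHom.comp_apply, ← lift_twist_iterate, FreeGroup.lift_apply_of,
      FreeGroup.lift_apply_of] at h2
    exact h2
  refine ⟨_, inferInstance, inferInstance, permU _ ∘ unionGen X N, permU _ (unionShift α X N),
    ∑ j ∈ Finset.range N, (c : ℂ) • (E j * F j), (isExact_union α X N).map α _, ?_, fun i => ?_, ?_⟩
  · rw [conjTranspose_sum, Matrix.sum_mul]
    have h1 : ∀ j ∈ Finset.range N, ((c : ℂ) • (E j * F j))ᴴ
        * ∑ k ∈ Finset.range N, (c : ℂ) • (E k * F k) = ((c * c : ℝ) : ℂ) • 1 := by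
      intro j hj
      have h2 : ∀ k, (E j * F j)ᴴ * (E k * F k) = (F j)ᴴ * ((E j)ᴴ * E k) * F k := fun k => by
        rw [conjTranspose_mul]; simp only [Matrix.mul_assoc]
      rw [Matrix.mul_sum, Finset.sum_eq_single_of_mem j hj]
      · rw [conjTranspose_smul, Matrix.smul_mul, Matrix.mul_smul, h2, hE1, Matrix.mul_one, hF1,
          smul_smul, Complex.star_def, Complex.conj_ofReal]
        push_cast
        rfl
      · intro k hk hkj
        rw [conjTranspose_smul, Matrix.smul_mul, Matrix.mul_smul, h2, hE0 j hj k hk hkj.symm]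
        simp
    rw [Finset.sum_congr rfl h1, Finset.sum_const, Finset.card_range, ← Nat.cast_smul_eq_nsmul ℂ,
      smul_smul]
    have h3 : (N : ℂ) * ((c * c : ℝ) : ℂ) = 1 := by exact_mod_cast hcc
    rw [h3, one_smul]
  · have h1 : (∑ j ∈ Finset.range N, (c : ℂ) • (E j * F j)) * (r i).1
        - ((permU _ ∘ unionGen X N) i).1 * ∑ j ∈ Finset.range N, (c : ℂ) • (E j * F j)
        = ∑ j ∈ Finset.range N,
          (c : ℂ) • (E j * (F j * (r i).1 - (permU X (T^[j] p i)).1 * F j)) := by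
      rw [Matrix.sum_mul, Matrix.mul_sum, ← Finset.sum_sub_distrib]
      refine Finset.sum_congr rfl fun j _ => ?_
      rw [Matrix.mul_sub, ← Matrix.mul_assoc (E j) (permU X (T^[j] p i)).1, ← hgen, smul_sub,
        Matrix.smul_mul, Matrix.mul_smul]
      simp only [Matrix.mul_assoc, Function.comp_apply]
    rw [h1]
    refine (norm_sum_le _ _).trans ?_
    have h2 : ∀ j ∈ Finset.range N,
        ‖(c : ℂ) • (E j * (F j * (r i).1 - (permU X (T^[j] p i)).1 * F j))‖
        ≤ (∑ i, (C j i + D j i)) * (ε / K) := by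
      intro j _
      rw [norm_smul, Complex.norm_real, Real.norm_of_nonneg hc0]
      refine (mul_le_of_le_one_left (norm_nonneg _) hc1).trans
        ((norm_mul_le_left (norm_le_one_of_isometry (hE1 j))).trans ((hFr i j).trans ?_))
      exact mul_le_mul_of_nonneg_right (Finset.single_le_sum (f := fun i => C j i + D j i)
        (fun i _ => (add_pos (hC j i) (hD j i)).le) (Finset.mem_univ i)) (by positivity)
    refine (Finset.sum_le_sum h2).trans ?_
    rw [← Finset.sum_mul, mul_div_assoc', div_le_iff₀ hK, mul_comm]
    exact mul_le_mul_of_nonneg_left (by simp only [K]; linarith) hε.le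
  · set V := (permU _ (unionShift α X N)).1
    have h1 : (∑ j ∈ Finset.range N, (c : ℂ) • (E j * F j)) * v.1
        - V * ∑ j ∈ Finset.range N, (c : ℂ) • (E j * F j)
        = (c : ℂ) • (V * E N * F N) - (c : ℂ) • (V * E 0 * F 0) := by
      rw [← Finset.sum_range_sub (fun j => (c : ℂ) • (V * E j * F j)), Finset.sum_sub_distrib,
        Matrix.sum_mul, Matrix.mul_sum]
      congr 1
      · refine Finset.sum_congr rfl fun j _ => ?_
        rw [hshift, Matrix.smul_mul]
        simp only [F, pow_succ, Submonoid.coe_mul, Matrix.mul_assoc]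
      · refine Finset.sum_congr rfl fun j _ => ?_
        rw [Matrix.mul_smul, Matrix.mul_assoc]
    have h2 : ∀ j, ‖(c : ℂ) • (V * E j * F j)‖ ≤ c := by
      intro j
      rw [norm_smul, Complex.norm_real, Real.norm_of_nonneg hc0]
      refine mul_le_of_le_one_right hc0 ((norm_mul_le_left ((norm_mul_le_left
        (MatU.norm_le _)).trans (norm_le_one_of_isometry (hE1 j)))).trans (hFn j))
    rw [h1]
    linarith [norm_sub_le ((c : ℂ) • (V * E N * F N)) ((c : ℂ) • (V * E 0 * F 0)), h2 N, h2 0]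

end Twisted

section Connected

variable {ι : Type} [Fintype ι] [DecidableEq ι]

/-- The scalar unitary matrices. -/
def scalarU (ι : Type) [Fintype ι] [DecidableEq ι] (z : Circle) : MatU ι :=
  ⟨(z : ℂ) • 1, by
    have h : star (z : ℂ) * z = 1 := by
      rw [Complex.star_def, ← Complex.normSq_eq_conj_mul_self]
      simp
    constructor
    · rw [star_smul, star_one, smul_mul_smul_comm, h, mul_one, one_smul]
    · rw [star_smul, star_one, smul_mul_smul_comm, mul_comm, h, mul_one, one_smul]⟩

lemma continuous_scalarU : Continuous (scalarU ι) :=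
  Continuous.subtype_mk (by fun_prop) _

instance MatU.pathConnectedSpace : PathConnectedSpace (MatU ι) := by
  have key : ∀ u : MatU ι, Joined (1 : MatU ι) u := by
    intro u
    have : Infinite (Set.Ioc (-Real.pi) Real.pi) :=
      (Set.Ioc_infinite (by linarith [Real.pi_pos])).to_subtype
    have : Infinite Circle := Infinite.of_injective _ Circle.argEquiv.symm.injective
    obtain ⟨z, hz⟩ : ∃ z : Circle, -(z : ℂ) ∉ spectrum ℂ u.1 := by
      by_contra! h
      exact Set.infinite_of_injective_forall_mem (f := fun z : Circle => -(z : ℂ))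
        (fun a b h => Subtype.ext (neg_injective h)) h (Matrix.finite_spectrum u.1)
    have h1 : Joined (scalarU ι z) u := by
      refine Unitary.joined _ _ ?_
      rw [Unitary.norm_sub_eq, Unitary.norm_sub_one_lt_two_iff (Subtype.prop _)]
      intro h
      refine hz ?_
      have h2 : ((u * star (scalarU ι z) : MatU ι) : Matrix ι ι ℂ)
          = (Units.mk0 (z : ℂ) z.coe_ne_zero)⁻¹ • u.1 := by
        simp [scalarU, Units.smul_def, ← Circle.coe_inv_eq_conj]
      have h3 : (-1 : ℂ) = (Units.mk0 (z : ℂ) z.coe_ne_zero)⁻¹ • -(z : ℂ) := by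
        simp [Units.smul_def]
      rw [h2, h3, spectrum.smul_mem_smul_iff] at h
      exact h
    have h3 : Joined (1 : MatU ι) (scalarU ι z) := by
      refine ⟨⟨⟨fun t => scalarU ι (Circle.exp (t * Complex.arg z)), ?_⟩, ?_, ?_⟩⟩
      · exact continuous_scalarU.comp (by fun_prop)
      · refine Subtype.ext ?_
        simp [scalarU]
      · simp
    exact h3.trans h1
  exact ⟨⟨1⟩, fun u v => (key u).symm.trans (key v)⟩

end Connected

section Blocks

variable {ι κ K : Type} [Fintype ι] [DecidableEq ι] [Fintype κ] [DecidableEq κ]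
  [Fintype K] [DecidableEq K]

lemma fromBlocks_sub_fromBlocks {ι' κ' : Type} (A A' : Matrix ι ι' ℂ) (B B' : Matrix ι κ' ℂ)
    (C C' : Matrix κ ι' ℂ) (D D' : Matrix κ κ' ℂ) :
    fromBlocks A B C D - fromBlocks A' B' C' D'
      = fromBlocks (A - A') (B - B') (C - C') (D - D') := by
  ext (i | i) (j | j) <;> rfl

/-- Block sums of unitary matrices. -/
def sumU : MatU ι × MatU κ →* MatU (ι ⊕ κ) where
  toFun p := ⟨fromBlocks p.1.1 0 0 p.2.1, by
    constructor <;>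
    simp [star_eq_conjTranspose, fromBlocks_conjTranspose, fromBlocks_multiply, MatU.star_mul,
      MatU.mul_star, fromBlocks_one]⟩
  map_one' := Subtype.ext fromBlocks_one
  map_mul' p q := Subtype.ext (by simp [fromBlocks_multiply])

/-- Block diagonal unitary matrices. -/
def diagU : (K → MatU ι) →* MatU (ι × K) where
  toFun D := ⟨blockDiagonal fun k => (D k).1, by
    constructor
    · rw [star_eq_conjTranspose, blockDiagonal_conjTranspose, ← blockDiagonal_mul]
      simp_rw [MatU.star_mul]
      exact blockDiagonal_one
    · rw [star_eq_conjTranspose, blockDiagonal_conjTranspose, ← blockDiagonal_mul]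
      simp_rw [MatU.mul_star]
      exact blockDiagonal_one⟩
  map_one' := Subtype.ext blockDiagonal_one
  map_mul' p q := Subtype.ext (blockDiagonal_mul (fun k => (p k).1) fun k => (q k).1)

/-- Amplifications of unitary matrices. -/
def ampU (ι : Type) [Fintype ι] [DecidableEq ι] : MatU K →* MatU (ι × K) where
  toFun u := ⟨(1 : Matrix ι ι ℂ) ⊗ₖ u.1, by
    constructor
    · rw [star_eq_conjTranspose, conjTranspose_kronecker, ← mul_kronecker_mul, MatU.star_mul]
      simp
    · rw [star_eq_conjTranspose, conjTranspose_kronecker, ← mul_kronecker_mul, MatU.mul_star]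
      simp⟩
  map_one' := Subtype.ext (by simp)
  map_mul' p q := Subtype.ext (by simp [← mul_kronecker_mul])

lemma continuous_sumU : Continuous (sumU : MatU ι × MatU κ → MatU (ι ⊕ κ)) :=
  Continuous.subtype_mk (Continuous.matrix_fromBlocks (by fun_prop) (by fun_prop) (by fun_prop)
    (by fun_prop)) _

lemma continuous_ampU : Continuous (ampU ι : MatU K → MatU (ι × K)) := by
  refine Continuous.subtype_mk (continuous_matrix fun i j => ?_) _
  simp only [kroneckerMap_apply]
  exact continuous_const.mul (continuous_subtype_val.matrix_elem _ _)

lemma ampU_diagU_const (u : MatU K) (A : MatU ι) :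
    (ampU ι u) * (diagU fun _ => A) = (diagU fun _ => A) * (ampU ι u) := by
  refine Subtype.ext ?_
  change ((1 : Matrix ι ι ℂ) ⊗ₖ u.1) * blockDiagonal (fun _ => A.1)
    = blockDiagonal (fun _ => A.1) * ((1 : Matrix ι ι ℂ) ⊗ₖ u.1)
  rw [← kronecker_one, ← mul_kronecker_mul, ← mul_kronecker_mul]
  simp

lemma ampU_permU_diagU {D D' : K → MatU ι} {σ : Equiv.Perm K} {b : ℝ} (hb : 0 ≤ b)
    (h : ∀ k, ‖(D k).1 - (D' (σ k)).1‖ ≤ b) :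
    ‖(ampU ι (permU K σ)).1 * (diagU D).1 - (diagU D').1 * (ampU ι (permU K σ)).1‖ ≤ b := by
  have h1 : (diagU D').1 * (ampU ι (permU K σ)).1
      = (ampU ι (permU K σ)).1 * (diagU (D' ∘ σ)).1 := by
    ext ⟨i, k⟩ ⟨j, l⟩
    simp [diagU, ampU, Matrix.mul_apply, Fintype.sum_prod_type, blockDiagonal_apply,
      Matrix.one_apply, permU_coe, emb]
    split_ifs with hk
    · rw [hk]
    · rfl
  rw [h1, ← Matrix.mul_sub]
  refine (norm_mul_le_left (MatU.norm_le _)).trans ?_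
  have h2 : (diagU D).1 - (diagU (D' ∘ σ)).1
      = blockDiagonal fun k => (D k).1 - (D' (σ k)).1 := (blockDiagonal_sub _ _).symm
  rw [h2]
  exact norm_blockDiagonal_le _ hb h

/-- The decomposition of a product with `Option K`. -/
def optElim (ι K : Type) (p : ι × Option K) : ι ⊕ (ι × K) :=
  p.2.elim (Sum.inl p.1) fun k => Sum.inr (p.1, k)

/-- The isometry that is the identity on the summand `none` and `J` on the other summands. -/
def hatJ (J : Matrix κ (ι × K) ℂ) : Matrix (ι ⊕ κ) (ι × Option K) ℂ :=
  (fromBlocks 1 0 0 J : Matrix (ι ⊕ κ) (ι ⊕ (ι × K)) ℂ) * emb (optElim ι K)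

lemma emb_conjTranspose_mul_self {X Y : Type} [Fintype X] [DecidableEq X] [Fintype Y]
    [DecidableEq Y] {f : X → Y} (hf : Function.Bijective f) : emb f * (emb f)ᴴ = 1 := by
  ext y y'
  obtain ⟨x, rfl⟩ := hf.2 y
  obtain ⟨x', rfl⟩ := hf.2 y'
  simp [emb, Matrix.mul_apply, Matrix.one_apply, apply_ite, hf.1.eq_iff, eq_comm]

lemma bijective_optElim : Function.Bijective (optElim ι K) := by
  constructor
  · rintro ⟨i, _ | k⟩ ⟨j, _ | l⟩ h <;> simp_all [optElim]
  · rintro (i | ⟨i, k⟩)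
    · exact ⟨(i, none), rfl⟩
    · exact ⟨(i, some k), rfl⟩

lemma hatJ_conjTranspose_mul {J : Matrix κ (ι × K) ℂ} (hJ : Jᴴ * J = 1) :
    (hatJ J)ᴴ * hatJ J = 1 := by
  rw [hatJ, conjTranspose_mul, Matrix.mul_assoc, ← Matrix.mul_assoc _ (fromBlocks 1 0 0 J),
    fromBlocks_conjTranspose, fromBlocks_multiply]
  simp [hJ, emb_conjTranspose_mul bijective_optElim.1]

lemma hatJ_mul_conjTranspose (J : Matrix κ (ι × K) ℂ) :
    1 - hatJ J * (hatJ J)ᴴ = fromBlocks 0 0 0 (1 - J * Jᴴ) := by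
  rw [hatJ, conjTranspose_mul, Matrix.mul_assoc, ← Matrix.mul_assoc (emb _),
    emb_conjTranspose_mul_self bijective_optElim, Matrix.one_mul,
    fromBlocks_conjTranspose, fromBlocks_multiply, ← fromBlocks_one, fromBlocks_sub_fromBlocks]
  simp

lemma hatJ_mul_diagU (J : Matrix κ (ι × K) ℂ) (D : Option K → MatU ι) (Θ : MatU κ) :
    hatJ J * (diagU D).1 - (sumU (D none, Θ)).1 * hatJ J
      = (fromBlocks 0 0 0 (J * (diagU fun k => D (some k)).1 - Θ.1 * J) :
        Matrix (ι ⊕ κ) (ι ⊕ (ι × K)) ℂ) * emb (optElim ι K) := by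
  have h : emb (optElim ι K) * (diagU D).1
      = (fromBlocks (D none).1 0 0 (diagU fun k => D (some k)).1 :
        Matrix (ι ⊕ (ι × K)) (ι ⊕ (ι × K)) ℂ) * emb (optElim ι K) := by
    ext (i | ⟨i, k⟩) ⟨j, _ | l⟩
    · simp [emb, diagU, Matrix.mul_apply, Fintype.sum_prod_type, blockDiagonal_apply, optElim]
    · simp [emb, diagU, Matrix.mul_apply, Fintype.sum_prod_type, blockDiagonal_apply, optElim]
    · simp [emb, diagU, Matrix.mul_apply, Fintype.sum_prod_type, blockDiagonal_apply, optElim]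
    · by_cases hkl : k = l
      · subst hkl
        simp [emb, diagU, Matrix.mul_apply, Fintype.sum_prod_type, blockDiagonal_apply, optElim]
      · simp [emb, diagU, Matrix.mul_apply, Fintype.sum_prod_type, blockDiagonal_apply, optElim,
          hkl]
  rw [hatJ, Matrix.mul_assoc, h, sumU]
  simp only [MonoidHom.coe_mk, OneHom.coe_mk, ← Matrix.mul_assoc, ← Matrix.sub_mul,
    fromBlocks_multiply]
  simp [fromBlocks_sub_fromBlocks]

lemma hatJ_intertwine {J : Matrix κ (ι × K) ℂ} (hJ : Jᴴ * J = 1) {D D' : Option K → MatU ι}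
    {u : MatU (Option K)} {Θ : MatU κ} {a b : ℝ} (hD : ∀ k, D (some k) = D' (some k))
    (hΘ : ‖J * (diagU fun k => D (some k)).1 - Θ.1 * J‖ ≤ a)
    (hu : ‖(ampU ι u).1 * (diagU D).1 - (diagU D').1 * (ampU ι u).1‖ ≤ b) :
    ‖extU (hatJ J) (ampU ι u).1 * (sumU (D none, Θ)).1
      - (sumU (D' none, Θ)).1 * extU (hatJ J) (ampU ι u).1‖ ≤ 4 * a + b := by
  have ha : 0 ≤ a := (norm_nonneg _).trans hΘ
  have key : ∀ D'' : Option K → MatU ι, (∀ k, D (some k) = D'' (some k)) →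
      ‖hatJ J * (diagU D'').1 - (sumU (D'' none, Θ)).1 * hatJ J‖ ≤ a := by
    intro D'' h
    rw [hatJ_mul_diagU]
    simp_rw [← h]
    exact (norm_mul_le_right (norm_emb_le bijective_optElim.1)).trans
      (norm_fromBlocks_le _ _ ha (by simpa using ha) hΘ)
  refine extU_intertwine (u := ampU ι u) (D := diagU D) (D' := diagU D') (X := sumU (D none, Θ))
    (X' := sumU (D' none, Θ)) (hatJ_conjTranspose_mul hJ) (key D fun _ => rfl) (key D' hD) hu ?_
  rw [hatJ_mul_conjTranspose]
  simp only [sumU, MonoidHom.coe_mk, OneHom.coe_mk, fromBlocks_multiply, fromBlocks_sub_fromBlocks]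
  simp only [Matrix.zero_mul, Matrix.mul_zero, add_zero, zero_add, sub_zero]
  refine norm_fromBlocks_le _ _ (by positivity) (by simpa using ha) ?_
  have h1 := intertwine_comp (norm_conjTranspose_le_one (norm_le_one_of_isometry hJ))
    (norm_le_one_of_isometry hJ) (intertwine_adjoint hΘ) hΘ
  have h2 : (1 - J * Jᴴ) * Θ.1 - Θ.1 * (1 - J * Jᴴ) = -(J * Jᴴ * Θ.1 - Θ.1 * (J * Jᴴ)) := by
    simp only [Matrix.sub_mul, Matrix.mul_sub, Matrix.one_mul, Matrix.mul_one]; abel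
  rw [h2, norm_neg]
  linarith

/-- The cyclic permutation `none → 0 → 1 → ⋯ → M → none`. -/
def chainPerm (M : ℕ) : Equiv.Perm (Option (Fin (M + 1))) :=
  (finSuccEquiv (M + 1)).permCongr (finRotate (M + 2))

lemma chainPerm_none (M : ℕ) : chainPerm M none = some 0 := by
  simp [chainPerm, Equiv.permCongr_apply]

lemma chainPerm_some (M : ℕ) (k : Fin M) :
    chainPerm M (some k.castSucc) = some k.succ := by
  simp only [chainPerm, Equiv.permCongr_apply, finSuccEquiv_symm_some, finRotate_apply]
  have h : (k.castSucc.succ : Fin (M + 2)) + 1 = k.succ.succ := by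
    refine Fin.ext ?_
    rw [Fin.val_add_one_of_lt]
    · simp
    · simp [Fin.lt_def]
  rw [h, finSuccEquiv_succ]

lemma chainPerm_last (M : ℕ) : chainPerm M (some (Fin.last M)) = none := by
  simp [chainPerm, Equiv.permCongr_apply]

/-- The unitary that moves the first entry of a chain to the last one. -/
def chainU {M : ℕ} {J : Matrix κ (ι × Fin (M + 1)) ℂ} (hJ : Jᴴ * J = 1) : MatU (ι ⊕ κ) :=
  ⟨extU (hatJ J) (ampU ι (permU _ (chainPerm M))).1, extU_mem (hatJ_conjTranspose_mul hJ) _⟩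

lemma chainU_intertwine {M : ℕ} {J : Matrix κ (ι × Fin (M + 1)) ℂ} (hJ : Jᴴ * J = 1)
    {h : Fin (M + 1) → MatU ι} {Θ : MatU κ} {a b : ℝ} (hb : 0 ≤ b)
    (hΘ : ‖J * (diagU h).1 - Θ.1 * J‖ ≤ a)
    (hh : ∀ k : Fin M, ‖(h k.castSucc).1 - (h k.succ).1‖ ≤ b) :
    ‖(chainU hJ).1 * (sumU (h 0, Θ)).1 - (sumU (h (Fin.last M), Θ)).1 * (chainU hJ).1‖
      ≤ 4 * a + b := by
  refine hatJ_intertwine hJ (D := fun k => k.elim (h 0) h)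
    (D' := fun k => k.elim (h (Fin.last M)) h) (fun _ => rfl) hΘ (ampU_permU_diagU hb ?_)
  rintro (_ | k)
  · simpa [chainPerm_none] using hb
  · refine Fin.lastCases ?_ (fun k => ?_) k
    · simpa [chainPerm_last] using hb
    · simpa [chainPerm_some] using hh k

end Blocks

section Homotopy

variable {m : ℕ} (α : FreeGroup (Fin m) ≃* FreeGroup (Fin m))
variable {ι κ K L : Type} [Fintype ι] [DecidableEq ι] [Fintype κ] [DecidableEq κ]
  [Fintype K] [DecidableEq K] [Fintype L] [DecidableEq L]

/-- Every tuple of unitaries is approximately contained in an exact representation of the mapping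
torus of `α`. -/
theorem exists_exact_dilation_tuple {ε : ℝ} (hε : 0 < ε) (r : Fin m → MatU ι) :
    ∃ (κ : Type) (_ : Fintype κ) (_ : DecidableEq κ) (R : Fin m → MatU κ) (V : MatU κ)
      (J : Matrix κ ι ℂ), IsExact α R V ∧ Jᴴ * J = 1 ∧ ∀ i, ‖J * (r i).1 - (R i).1 * J‖ ≤ ε := by
  obtain ⟨X, _, _, p, J, hJ, hp⟩ := exists_perm_dilation hε r
  let E : Matrix (X × ((Fin m → Equiv.Perm X) × ZMod 1)) X ℂ := emb fun x => (x, p, 0)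
  have hE : Eᴴ * E = 1 := emb_conjTranspose_mul fun x y h => congrArg Prod.fst h
  refine ⟨_, inferInstance, inferInstance, permU _ ∘ unionGen X 1, permU _ (unionShift α X 1),
    E * J, (isExact_union α X 1).map α _, ?_, fun i => ?_⟩
  · rw [conjTranspose_mul, Matrix.mul_assoc, ← Matrix.mul_assoc Eᴴ, hE, Matrix.one_mul, hJ]
  · have h : (permU _ (unionGen X 1 i)).1 * E = E * (permU X (p i)).1 := by
      simp only [permU_coe, E, emb_mul_emb]
      rfl
    rw [Function.comp_apply, ← Matrix.mul_assoc, h, Matrix.mul_assoc, Matrix.mul_assoc,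
      ← Matrix.mul_sub]
    exact (norm_mul_le_left (norm_le_one_of_isometry hE)).trans (hp i)

/-- A continuous square partition of unity on the unit interval with supports of size `1 / N`. -/
lemma exists_sq_partition {N : ℕ} (hN : 0 < N) : ∃ e : unitInterval → Fin (N + 1) → ℝ,
    Continuous e ∧ (∀ t, ∑ l, e t l ^ 2 = 1) ∧ ∀ t l, e t l ≠ 0 → |(t : ℝ) - l / N| < 1 / N := by
  have hN' : (0 : ℝ) < N := by exact_mod_cast hN
  let h : unitInterval → Fin (N + 1) → ℝ := fun t l => max 0 (1 - |N * (t : ℝ) - l|)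
  have hpos : ∀ t, 0 < ∑ l, h t l ^ 2 := by
    intro t
    have h0 : (0 : ℝ) ≤ N * t := mul_nonneg hN'.le t.2.1
    have h1 : ⌊(N : ℝ) * t⌋₊ < N + 1 := by
      rw [Nat.floor_lt h0]
      push_cast
      nlinarith [t.2.2]
    refine Finset.sum_pos' (fun l _ => sq_nonneg _) ⟨⟨_, h1⟩, Finset.mem_univ _, ?_⟩
    refine pow_pos (lt_max_of_lt_right ?_) 2
    have h2 := Nat.floor_le h0
    have h3 := Nat.lt_floor_add_one ((N : ℝ) * t)
    rw [abs_of_nonneg (by simpa using h2)]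
    simp only
    linarith
  have hc : Continuous h := by fun_prop
  refine ⟨fun t l => h t l / √(∑ l, h t l ^ 2), ?_, fun t => ?_, fun t l hl => ?_⟩
  · refine continuous_pi fun l => Continuous.div (by fun_prop) (by fun_prop) fun t => ?_
    exact (Real.sqrt_pos.2 (hpos t)).ne'
  · simp_rw [div_pow]
    rw [← Finset.sum_div, Real.sq_sqrt (hpos t).le, div_self (hpos t).ne']
  · have h1 : h t l ≠ 0 := fun h0 => hl (by simp [h0])
    have h2 : |N * (t : ℝ) - l| < 1 := by
      by_contra! h2
      exact h1 (max_eq_left (by linarith))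
    have h3 : (t : ℝ) - l / N = (N * t - l) / N := by field_simp
    rw [h3, abs_div, abs_of_pos hN']
    exact (div_lt_div_iff_of_pos_right hN').2 h2

/-- The matrix that tensors a vector with the vector `e`. -/
def tensorVec (ι K : Type) [DecidableEq ι] [DecidableEq K] (e : L → ℝ) :
    Matrix (ι × (K × L)) (ι × K) ℂ :=
  Matrix.of fun p q => if p.1 = q.1 ∧ p.2.1 = q.2 then (e p.2.2 : ℂ) else 0

lemma tensorVec_conjTranspose_mul {e : L → ℝ} (he : ∑ l, e l ^ 2 = 1) :
    (tensorVec ι K e)ᴴ * tensorVec ι K e = 1 := by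
  have h : ∑ l, (e l : ℂ) * e l = 1 := by
    rw [← Complex.ofReal_one, ← he]
    push_cast
    simp only [sq]
  ext ⟨i, k⟩ ⟨j, l⟩
  by_cases hij : i = j
  · by_cases hkl : k = l
    · subst hij hkl
      simp [tensorVec, Matrix.mul_apply, Fintype.sum_prod_type, apply_ite, ite_and, h]
    · subst hij
      simp [tensorVec, Matrix.mul_apply, Fintype.sum_prod_type, apply_ite, ite_and, hkl, Ne.symm hkl]
  · simp [tensorVec, Matrix.mul_apply, Fintype.sum_prod_type, apply_ite, ite_and, hij, Ne.symm hij]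

lemma tensorVec_intertwine {e : L → ℝ} (he : ∑ l, e l ^ 2 = 1) {D : K → MatU ι}
    {G : K × L → MatU ι} {b : ℝ} (hb : 0 ≤ b)
    (h : ∀ k l, e l ≠ 0 → ‖(D k).1 - (G (k, l)).1‖ ≤ b) :
    ‖tensorVec ι K e * (diagU D).1 - (diagU G).1 * tensorVec ι K e‖ ≤ b := by
  have h1 : tensorVec ι K e * (diagU D).1 - (diagU G).1 * tensorVec ι K e
      = (blockDiagonal fun p : K × L => if e p.2 ≠ 0 then (D p.1).1 - (G p).1 else 0)
        * tensorVec ι K e := by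
    have key : ∀ (G : K × L → Matrix ι ι ℂ) i k l j k',
        (blockDiagonal G * tensorVec ι K e) (i, (k, l)) (j, k')
          = if k = k' then G (k, l) i j * e l else 0 := by
      intro G i k l j k'
      rw [Matrix.mul_apply, Fintype.sum_prod_type,
        Finset.sum_eq_single_of_mem j (Finset.mem_univ _), Finset.sum_eq_single_of_mem (k, l)
          (Finset.mem_univ _)]
      · simp [tensorVec, blockDiagonal_apply]
      · intro q _ hq
        simp [blockDiagonal_apply, hq.symm]
      · intro x _ hx
        simp [tensorVec, hx]
    have key' : ∀ i k l j k', (tensorVec ι K e * (diagU D).1) (i, (k, l)) (j, k')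
          = if k = k' then (D k).1 i j * e l else 0 := by
      intro i k l j k'
      rw [Matrix.mul_apply, Fintype.sum_prod_type,
        Finset.sum_eq_single_of_mem i (Finset.mem_univ _), Finset.sum_eq_single_of_mem k
          (Finset.mem_univ _)]
      · simp [tensorVec, diagU, blockDiagonal_apply, mul_comm]
      · intro q _ hq
        simp [tensorVec, hq.symm]
      · intro x _ hx
        simp [tensorVec, hx.symm]
    ext ⟨i, k, l⟩ ⟨j, k'⟩
    rw [key, Matrix.sub_apply, key']
    change _ - (blockDiagonal (fun p => (G p).1) * tensorVec ι K e) _ _ = _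
    rw [key]
    by_cases hl : e l = 0
    · simp [hl]
    · simp only [hl, ne_eq, not_false_eq_true, if_true, Matrix.sub_apply]
      split_ifs
      · ring
      · simp
  rw [h1]
  refine (norm_mul_le_right (norm_le_one_of_isometry (tensorVec_conjTranspose_mul he))).trans
    (norm_blockDiagonal_le _ hb fun p => ?_)
  split_ifs with hp
  · exact h _ _ hp
  · simpa using hb

lemma continuous_tensorVec : Continuous (tensorVec ι K : (L → ℝ) → _) := by
  refine continuous_matrix fun p q => ?_
  simp only [tensorVec, Matrix.of_apply]
  split_ifs
  · fun_prop
  · exact continuous_const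

/-- The point `k / M` of the unit interval. -/
def gridPoint {M : ℕ} (k : Fin (M + 1)) : unitInterval :=
  ⟨k / M, by positivity, div_le_one_of_le₀ (by exact_mod_cast k.is_le) (by positivity)⟩

lemma exists_modulus (H : unitInterval × unitInterval → Fin m → MatU ι) (hH : Continuous H)
    {η : ℝ} (hη : 0 < η) : ∃ M : ℕ, 0 < M ∧ ∀ s s' t t' : unitInterval,
      |(s : ℝ) - s'| ≤ 1 / M → |(t : ℝ) - t'| ≤ 1 / M →
      ∀ i, ‖(H (s, t) i).1 - (H (s', t') i).1‖ ≤ η := by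
  have h := Metric.uniformContinuous_iff.1 (CompactSpace.uniformContinuous_of_continuous hH) η hη
  obtain ⟨δ, hδ, h⟩ := h
  obtain ⟨M, hM⟩ := exists_nat_one_div_lt hδ
  refine ⟨M + 1, M.succ_pos, fun s s' t t' hs ht i => ?_⟩
  push_cast at hs ht
  have h1 : dist (s, t) (s', t') < δ :=
    max_lt (lt_of_le_of_lt hs hM) (lt_of_le_of_lt ht hM)
  have h2 := (dist_le_pi_dist (H (s, t)) (H (s', t')) i).trans (h h1).le
  rwa [Subtype.dist_eq, dist_eq_norm] at h2

/-- Homotopic paths of tuples of unitaries become approximately conjugate through a continuous path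
of unitaries, after adding an exact representation. -/
theorem exists_path_intertwiner {ε : ℝ} (hε : 0 < ε)
    (H : unitInterval × unitInterval → Fin m → MatU ι) (hH : Continuous H)
    (h0 : ∀ s, H (s, 0) = H (0, 0)) (h1 : ∀ s, H (s, 1) = H (0, 1)) :
    ∃ (κ : Type) (_ : Fintype κ) (_ : DecidableEq κ) (R : Fin m → MatU κ) (V : MatU κ)
      (C : unitInterval → MatU (ι ⊕ κ)), IsExact α R V ∧ Continuous C ∧
      (∀ t i, ‖(C t).1 * (sumU (H (0, t) i, R i)).1 - (sumU (H (1, t) i, R i)).1 * (C t).1‖ ≤ ε) ∧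
      ∀ t, t = 0 ∨ t = 1 → JoinedIn {c : MatU (ι ⊕ κ) | ∀ i, ‖c.1 * (sumU (H (0, t) i, R i)).1
        - (sumU (H (0, t) i, R i)).1 * c.1‖ ≤ ε} 1 (C t) := by
  have hη : 0 < ε / 9 := by positivity
  obtain ⟨M, hM, hmod⟩ := exists_modulus H hH hη
  have hM' : (0 : ℝ) < M := by exact_mod_cast hM
  obtain ⟨e, hec, he1, hes⟩ := exists_sq_partition hM
  obtain ⟨κ, _, _, R, V, J, hRV, hJ, hJR⟩ := exists_exact_dilation_tuple α hη fun i =>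
    diagU fun p : Fin (M + 1) × Fin (M + 1) => H (gridPoint p.1, gridPoint p.2) i
  let S : unitInterval → Matrix (ι × (Fin (M + 1) × Fin (M + 1))) (ι × Fin (M + 1)) ℂ :=
    fun t => tensorVec ι (Fin (M + 1)) (e t)
  have hS : ∀ t, (J * S t)ᴴ * (J * S t) = 1 := fun t => by
    rw [conjTranspose_mul, Matrix.mul_assoc, ← Matrix.mul_assoc Jᴴ, hJ, Matrix.one_mul,
      tensorVec_conjTranspose_mul (he1 t)]
  have hSR : ∀ t i, ‖(J * S t) * (diagU fun k => H (gridPoint k, t) i).1 - (R i).1 * (J * S t)‖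
      ≤ ε / 9 + ε / 9 := by
    intro t i
    refine intertwine_comp (norm_le_one_of_isometry (tensorVec_conjTranspose_mul (he1 t)))
      (norm_le_one_of_isometry hJ) (tensorVec_intertwine (he1 t) hη.le fun k l hl => ?_) (hJR i)
    exact hmod _ _ _ _ (by simp) (hes t l hl).le i
  have g0 : gridPoint (0 : Fin (M + 1)) = 0 := Subtype.ext (by simp [gridPoint])
  have g1 : gridPoint (Fin.last M) = 1 := Subtype.ext (by simp [gridPoint, hM'.ne'])
  refine ⟨κ, inferInstance, inferInstance, R, V, fun t => chainU (hS t), hRV, ?_, ?_, ?_⟩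
  · have hc : Continuous fun t => J * S t :=
      continuous_const.matrix_mul (continuous_tensorVec.comp hec)
    refine Continuous.subtype_mk ?_ _
    have hc' : Continuous fun t => hatJ (J * S t) :=
      (Continuous.matrix_fromBlocks continuous_const continuous_const continuous_const
        hc).matrix_mul continuous_const
    exact ((hc'.matrix_mul continuous_const).matrix_mul hc'.matrix_conjTranspose).add
      (continuous_const.sub (hc'.matrix_mul hc'.matrix_conjTranspose))
  · intro t i
    have := chainU_intertwine (hS t) hη.le (hSR t i) fun k => hmod _ _ _ _ (by
      simp only [gridPoint, Fin.val_castSucc, Fin.val_succ]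
      rw [← sub_div, abs_div, abs_of_pos hM']
      simp) (by simp) i
    rw [g0, g1] at this
    linarith
  · intro t ht
    have hcon : ∀ s, H (s, t) = H (0, t) := by
      rcases ht with rfl | rfl
      exacts [h0, h1]
    obtain ⟨γ⟩ := PathConnectedSpace.joined (1 : MatU (Option (Fin (M + 1))))
      (permU _ (chainPerm M))
    let E : MatU (Option (Fin (M + 1))) → MatU (ι ⊕ κ) := fun u =>
      ⟨extU (hatJ (J * S t)) (ampU ι u).1, extU_mem (hatJ_conjTranspose_mul (hS t)) _⟩
    have hE : Continuous E := by
      refine Continuous.subtype_mk ?_ _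
      exact ((continuous_const.matrix_mul (continuous_subtype_val.comp continuous_ampU)).matrix_mul
        continuous_const).add continuous_const
    have hE1 : E 1 = 1 := Subtype.ext (by simp [E, extU])
    refine ⟨(γ.map hE).cast hE1.symm rfl, fun s i => ?_⟩
    have := hatJ_intertwine (hS t) (D := fun _ => H (0, t) i) (D' := fun _ => H (0, t) i)
      (u := γ s) (Θ := R i) (fun _ => rfl)
      (by have h2 := hSR t i; simp only [hcon] at h2; exact h2) (b := 0) (by
        have h := congrArg Subtype.val (ampU_diagU_const (γ s) (H (0, t) i))
        simp only [Submonoid.coe_mul] at h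
        rw [h]; simp)
    change ‖(E (γ s)).1 * _ - _ * (E (γ s)).1‖ ≤ ε
    refine le_trans this ?_
    linarith

end Homotopy

section Htpc

variable {G H : Type} [Group G] [TopologicalSpace G] [IsTopologicalGroup G]
  [Group H] [TopologicalSpace H] [IsTopologicalGroup H]

/-- Homotopy relative to the endpoints of functions on the unit interval. -/
def Htpc (f g : unitInterval → G) : Prop :=
  ∃ F : unitInterval × unitInterval → G, Continuous F ∧ (∀ t, F (0, t) = f t) ∧
    (∀ t, F (1, t) = g t) ∧ (∀ s, F (s, 0) = f 0) ∧ ∀ s, F (s, 1) = f 1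

lemma Htpc.refl {f : unitInterval → G} (hf : Continuous f) : Htpc f f :=
  ⟨fun p => f p.2, by fun_prop, fun _ => rfl, fun _ => rfl, fun _ => rfl, fun _ => rfl⟩

lemma Htpc.left {f g : unitInterval → G} (h : Htpc f g) : Continuous f := by
  obtain ⟨F, hF, h0, -, -, -⟩ := h
  have : f = fun t => F (0, t) := funext fun t => (h0 t).symm
  rw [this]
  fun_prop

lemma Htpc.right {f g : unitInterval → G} (h : Htpc f g) : Continuous g := by
  obtain ⟨F, hF, -, h1, -, -⟩ := h
  have : g = fun t => F (1, t) := funext fun t => (h1 t).symm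
  rw [this]
  fun_prop

lemma Htpc.zero {f g : unitInterval → G} (h : Htpc f g) : f 0 = g 0 := by
  obtain ⟨F, hF, -, h1, h2, -⟩ := h
  rw [← h1, h2]

lemma Htpc.one {f g : unitInterval → G} (h : Htpc f g) : f 1 = g 1 := by
  obtain ⟨F, hF, -, h1, -, h2⟩ := h
  rw [← h1, h2]

lemma Htpc.mul {f g f' g' : unitInterval → G} (h : Htpc f g) (h' : Htpc f' g') :
    Htpc (f * f') (g * g') := by
  obtain ⟨F, hF, a, b, c, d⟩ := h
  obtain ⟨F', hF', a', b', c', d'⟩ := h'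
  exact ⟨F * F', hF.mul hF', by simp [*], by simp [*], by simp [*], by simp [*]⟩

lemma Htpc.trans {f g k : unitInterval → G} (h : Htpc f g) (h' : Htpc g k) : Htpc f k := by
  have h2 := (h.mul (Htpc.refl h.right.inv)).mul h'
  simpa using h2

lemma Htpc.map {f g : unitInterval → G} (h : Htpc f g) (φ : G →* H) (hφ : Continuous φ) :
    Htpc (fun t => φ (f t)) fun t => φ (g t) := by
  obtain ⟨F, hF, a, b, c, d⟩ := h
  exact ⟨fun p => φ (F p), hφ.comp hF, by simp [*], by simp [*], by simp [*], by simp [*]⟩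

end Htpc

section Reflection

variable {ι : Type} [Fintype ι] [DecidableEq ι]

/-- The complex reflection `1 - c w w*`. -/
def reflMat (w : EuclideanSpace ℂ ι) (c : ℂ) : Matrix ι ι ℂ :=
  1 - c • vecMulVec w.ofLp (star w.ofLp)

lemma reflMat_mul (w : EuclideanSpace ℂ ι) (c d : ℂ) :
    reflMat w c * reflMat w d = reflMat w (c + d - c * d * (‖w‖ : ℂ) ^ 2) := by
  have h : star w.ofLp ⬝ᵥ w.ofLp = (‖w‖ : ℂ) ^ 2 := by
    rw [dotProduct_comm, ← EuclideanSpace.inner_eq_star_dotProduct, inner_self_eq_norm_sq_to_K]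
    rfl
  simp only [reflMat, Matrix.mul_sub, Matrix.sub_mul, Matrix.one_mul, Matrix.mul_one,
    Matrix.smul_mul, Matrix.mul_smul, vecMulVec_mul_vecMulVec, h, sub_smul, add_smul, mul_smul]
  rw [vecMulVec_smul]
  module

lemma reflMat_star (w : EuclideanSpace ℂ ι) (c : ℂ) : star (reflMat w c) = reflMat w (star c) := by
  simp [reflMat, star_eq_conjTranspose]

lemma reflMat_mem {w : EuclideanSpace ℂ ι} {c : ℂ} (h : c + star c = c * star c * (‖w‖ : ℂ) ^ 2) :
    reflMat w c ∈ unitary (Matrix ι ι ℂ) := by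
  constructor
  · rw [reflMat_star, reflMat_mul, add_comm, h, mul_comm (star c), sub_self]
    simp [reflMat]
  · rw [reflMat_star, reflMat_mul, h, sub_self]
    simp [reflMat]

lemma reflMat_mulVec (w x : EuclideanSpace ℂ ι) (c : ℂ) :
    reflMat w c *ᵥ x.ofLp = (x - (c * inner ℂ w x) • w).ofLp := by
  rw [reflMat, sub_mulVec, one_mulVec, smul_mulVec, vecMulVec_mulVec, dotProduct_comm,
    ← EuclideanSpace.inner_eq_star_dotProduct]
  ext i
  simp
  ring

/-- The homotopy from the identity to a rotation that moves `ξ` to `ζ`. -/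
def rotScalar (ξ ζ : EuclideanSpace ℂ ι) (s : ℝ) : ℂ :=
  (((‖ξ + (s : ℂ) • ζ‖ ^ 2 / 2 : ℝ) : ℂ) + (s * (inner ℂ ζ ξ).im : ℝ) * Complex.I)⁻¹

lemma rotScalar_add_star {ξ ζ : EuclideanSpace ℂ ι} {s : ℝ} (h : ξ + (s : ℂ) • ζ ≠ 0) :
    rotScalar ξ ζ s + star (rotScalar ξ ζ s)
      = rotScalar ξ ζ s * star (rotScalar ξ ζ s) * (‖ξ + (s : ℂ) • ζ‖ : ℂ) ^ 2 := by
  have hp : 0 < ‖ξ + (s : ℂ) • ζ‖ ^ 2 := by positivity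
  set D : ℂ := ((‖ξ + (s : ℂ) • ζ‖ ^ 2 / 2 : ℝ) : ℂ) + (s * (inner ℂ ζ ξ).im : ℝ) * Complex.I
    with hD
  have hc : D ≠ 0 := by
    intro h0
    have h1 : D.re = ‖ξ + (s : ℂ) • ζ‖ ^ 2 / 2 := by
      rw [hD, Complex.add_re, Complex.re_ofReal_mul, Complex.I_re, Complex.ofReal_re]
      ring
    rw [h0, Complex.zero_re] at h1
    linarith
  have hc' : star D ≠ 0 := star_ne_zero.2 hc
  have hs : D + star D = (‖ξ + (s : ℂ) • ζ‖ : ℂ) ^ 2 := by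
    rw [hD]
    simp
    ring
  have hr : rotScalar ξ ζ s = D⁻¹ := rfl
  rw [hr, star_inv₀, ← hs]
  field_simp
  ring

lemma rotScalar_zero {ξ ζ : EuclideanSpace ℂ ι} (h : ‖ξ‖ = 1) : rotScalar ξ ζ 0 = 2 := by
  simp [rotScalar, h]

lemma rotScalar_one {ξ ζ : EuclideanSpace ℂ ι} (hξ : ‖ξ‖ = 1) (hζ : ‖ζ‖ = 1) :
    rotScalar ξ ζ 1 = (1 + inner ℂ ζ ξ)⁻¹ := by
  have h : ‖ξ + ((1 : ℝ) : ℂ) • ζ‖ ^ 2 / 2 = 1 + (inner ℂ ζ ξ).re := by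
    rw [Complex.ofReal_one, one_smul, norm_add_sq (𝕜 := ℂ), hξ, hζ, inner_re_symm]
    simp only [RCLike.re_to_complex]
    ring
  rw [rotScalar, h]
  congr 1
  apply Complex.ext <;> simp

lemma rotScalar_self {ξ : EuclideanSpace ℂ ι} (h : ‖ξ‖ = 1) (s : ℝ) :
    rotScalar ξ ξ s = 2 * (((1 + s : ℝ) : ℂ) ^ 2)⁻¹ := by
  have h1 : ‖ξ + (s : ℂ) • ξ‖ ^ 2 = (1 + s) ^ 2 := by
    have : ξ + (s : ℂ) • ξ = ((1 + s : ℝ) : ℂ) • ξ := by push_cast; module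
    rw [this, norm_smul, h, mul_one, Complex.norm_real, Real.norm_eq_abs, sq_abs]
  have h2 : (inner ℂ ξ ξ : ℂ).im = 0 := inner_self_im (𝕜 := ℂ) ξ
  rw [rotScalar, h1, h2]
  push_cast
  rw [mul_zero, zero_mul, add_zero, inv_div, div_eq_mul_inv]

lemma reflMat_smul (w : EuclideanSpace ℂ ι) (r : ℝ) (c : ℂ) :
    reflMat ((r : ℂ) • w) c = reflMat w (c * (r : ℂ) ^ 2) := by
  have : star ((r : ℂ) • w).ofLp = (r : ℂ) • star w.ofLp := by
    ext i; simp
  rw [reflMat, reflMat, this, WithLp.ofLp_smul, smul_vecMulVec, vecMulVec_smul]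
  module

lemma exists_htpc_rotation {ξ ζ : unitInterval → EuclideanSpace ℂ ι} (hξ : Continuous ξ)
    (hζ : Continuous ζ) (nξ : ∀ t, ‖ξ t‖ = 1) (nζ : ∀ t, ‖ζ t‖ = 1) (hne : ∀ t, ξ t + ζ t ≠ 0)
    (h0 : ζ 0 = ξ 0) (h1 : ζ 1 = ξ 1) :
    ∃ κ : unitInterval → MatU ι, Htpc (fun _ => 1) κ ∧
      ∀ t, (κ t).1 *ᵥ (ξ t).ofLp = (ζ t).ofLp := by
  have hw : ∀ p : unitInterval × unitInterval, ξ p.2 + ((p.1 : ℝ) : ℂ) • ζ p.2 ≠ 0 := by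
    intro p hp
    have h2 : ξ p.2 = -(((p.1 : ℝ) : ℂ) • ζ p.2) := eq_neg_of_add_eq_zero_left hp
    have h3 : (p.1 : ℝ) = 1 := by
      have := congrArg norm h2
      rw [norm_neg, norm_smul, nξ, nζ, mul_one, Complex.norm_real, Real.norm_eq_abs,
        abs_of_nonneg p.1.2.1] at this
      exact this.symm
    rw [h3, Complex.ofReal_one, one_smul] at hp
    exact hne _ hp
  have hr2 : ∀ t, reflMat (ξ t) 2 ∈ unitary (Matrix ι ι ℂ) := fun t =>
    reflMat_mem (by rw [nξ]; simp; norm_num)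
  have hr1 : ∀ p : unitInterval × unitInterval,
      reflMat (ξ p.2 + ((p.1 : ℝ) : ℂ) • ζ p.2) (rotScalar (ξ p.2) (ζ p.2) p.1)
        ∈ unitary (Matrix ι ι ℂ) := fun p => reflMat_mem (rotScalar_add_star (hw p))
  have hsq : ∀ t, reflMat (ξ t) 2 * reflMat (ξ t) 2 = 1 := fun t => by
    rw [reflMat_mul, nξ]
    norm_num [reflMat]
  let K : unitInterval × unitInterval → MatU ι := fun p =>
    ⟨_, hr1 p⟩ * ⟨_, hr2 p.2⟩
  have hsc : Continuous fun p : unitInterval × unitInterval =>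
      rotScalar (ξ p.2) (ζ p.2) p.1 := by
    unfold rotScalar
    refine Continuous.inv₀ (by fun_prop) fun p h => ?_
    have h2 := congrArg Complex.re h
    rw [Complex.add_re, Complex.re_ofReal_mul, Complex.I_re, Complex.ofReal_re] at h2
    have := norm_pos_iff.2 (hw p)
    simp at h2
    exact hw p h2
  have hcont : ∀ {Y : Type} [TopologicalSpace Y] {f : Y → EuclideanSpace ℂ ι} {c : Y → ℂ},
      Continuous f → Continuous c → Continuous fun y => reflMat (f y) (c y) := by
    intro Y _ f c hf hc
    have hf' : Continuous fun y => (f y).ofLp := (PiLp.continuous_ofLp 2 _).comp hf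
    unfold reflMat
    exact continuous_const.sub (hc.smul (hf'.matrix_vecMulVec hf'.star))
  have hend : ∀ (s t : unitInterval), ζ t = ξ t → K (s, t) = 1 := by
    intro s t h
    apply Subtype.ext
    change reflMat (ξ t + ((s : ℝ) : ℂ) • ζ t) (rotScalar (ξ t) (ζ t) s) * reflMat (ξ t) 2 = 1
    have h2 : ξ t + ((s : ℝ) : ℂ) • ξ t = ((1 + (s : ℝ) : ℝ) : ℂ) • ξ t := by push_cast; module
    have h3 : ((1 + (s : ℝ) : ℝ) : ℂ) ≠ 0 := by
      exact_mod_cast (by linarith [s.2.1] : (0 : ℝ) < 1 + s).ne'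
    rw [h, h2, rotScalar_self (nξ t), reflMat_smul, mul_assoc, inv_mul_cancel₀ (pow_ne_zero 2 h3),
      mul_one, hsq]
  refine ⟨fun t => K (1, t), ⟨K, ?_, fun t => ?_, fun _ => rfl, fun s => hend s 0 h0,
    fun s => hend s 1 h1⟩, fun t => ?_⟩
  · exact ((hcont (by fun_prop) hsc).subtype_mk _).mul
      ((hcont (by fun_prop) continuous_const).subtype_mk _)
  · apply Subtype.ext
    change reflMat (ξ t + ((0 : ℝ) : ℂ) • ζ t) (rotScalar (ξ t) (ζ t) 0) * reflMat (ξ t) 2 = 1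
    rw [rotScalar_zero (nξ t), Complex.ofReal_zero, zero_smul, add_zero, hsq]
  · change (reflMat (ξ t + ((1 : ℝ) : ℂ) • ζ t) (rotScalar (ξ t) (ζ t) 1) * reflMat (ξ t) 2)
      *ᵥ (ξ t).ofLp = (ζ t).ofLp
    have hi : (inner ℂ (ξ t) (ξ t) : ℂ) = 1 := by
      rw [inner_self_eq_norm_sq_to_K, nξ]; simp
    have h2 : (1 : ℂ) + inner ℂ (ζ t) (ξ t) ≠ 0 := by
      intro h
      have h3 := congrArg Complex.re h
      have h4 : ‖ξ t + ζ t‖ ^ 2 = 2 * (1 + (inner ℂ (ζ t) (ξ t) : ℂ).re) := by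
        rw [norm_add_sq (𝕜 := ℂ), nξ, nζ, inner_re_symm]
        simp only [RCLike.re_to_complex]
        ring
      rw [Complex.add_re, Complex.one_re, Complex.zero_re] at h3
      rw [h3, mul_zero] at h4
      exact hne t (by simpa using h4)
    rw [← mulVec_mulVec, reflMat_mulVec (ξ t) (ξ t), hi, reflMat_mulVec, rotScalar_one (nξ t) (nζ t),
      Complex.ofReal_one, one_smul, mul_one]
    congr 1
    have h5 : ξ t - (2 : ℂ) • ξ t = -ξ t := by module
    rw [h5, inner_neg_right, inner_add_left, hi, mul_neg, inv_mul_cancel₀ h2]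
    module

end Reflection

section Avoid

variable {E : Type} [NormedAddCommGroup E] [NormedSpace ℝ E]

lemma exists_notMem_span (hd : 4 ≤ Module.finrank ℝ E) (e : E) {N : ℕ} (x : Fin (N + 1) → E) :
    ∃ η : E, ∀ j : Fin N, η ∉ Submodule.span ℝ {e, x j.castSucc, x j.succ} := by
  classical
  by_contra! h
  rcases isEmpty_or_nonempty (Fin N) with hN | hN
  · obtain ⟨j, -⟩ := h 0
    exact hN.elim j
  obtain ⟨j, hj⟩ := Subspace.exists_eq_top_of_iUnion_eq_univ
    (p := fun j : Fin N => Submodule.span ℝ {e, x j.castSucc, x j.succ})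
    (Set.eq_univ_of_forall fun η => Set.mem_iUnion.2 (h η))
  have h1 := finrank_span_finset_le_card (R := ℝ) ({e, x j.castSucc, x j.succ} : Finset E)
  have h2 : Set.finrank ℝ ((({e, x j.castSucc, x j.succ} : Finset E) : Set E))
      = Module.finrank ℝ E := by
    push_cast
    rw [Set.finrank]
    rw [hj, finrank_top]
  have h3 := Finset.card_le_three (a := e) (b := x j.castSucc) (c := x j.succ)
  omega

lemma exists_avoiding_field (hd : 4 ≤ Module.finrank ℝ E) {ξ : unitInterval → E} {e : E}
    (hξ : Continuous ξ) (nξ : ∀ t, ‖ξ t‖ = 1) (h0 : ξ 0 = e) (h1 : ξ 1 = e) :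
    ∃ h : unitInterval → E, Continuous h ∧ (∀ t, ‖h t‖ = 1) ∧ h 0 = e ∧ h 1 = e ∧
      (∀ t, ξ t + h t ≠ 0) ∧ ∀ t, h t + e ≠ 0 := by
  obtain ⟨δ, hδ, hunif⟩ := Metric.uniformContinuous_iff.1
    (CompactSpace.uniformContinuous_of_continuous hξ) (1 / 2) (by norm_num)
  obtain ⟨M, hM⟩ := exists_nat_one_div_lt hδ
  set N := M + 1 with hN
  have hNpos : 0 < N := M.succ_pos
  have hN' : (0 : ℝ) < N := by exact_mod_cast hNpos
  obtain ⟨f, hfc, hf1, hfs⟩ := exists_sq_partition hNpos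
  have hfs' : ∀ t l, f t l ≠ 0 → dist (ξ (gridPoint l)) (ξ t) ≤ 1 / 2 := by
    intro t l hl
    refine (hunif ?_).le
    rw [dist_comm, Subtype.dist_eq, Real.dist_eq]
    refine (hfs t l hl).trans ?_
    rw [hN]
    exact_mod_cast hM
  obtain ⟨η₀, hη₀⟩ := exists_notMem_span hd e fun l : Fin (N + 1) => ξ (gridPoint l)
  set c : ℝ := (2 * (‖η₀‖ + 1))⁻¹ with hc
  have hcpos : 0 < c := by positivity
  have hcη : c * ‖η₀‖ < 1 / 2 := by
    rw [hc, inv_mul_lt_iff₀ (by positivity)]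
    linarith
  let q : unitInterval → E := fun t =>
    ∑ l, f t l ^ 2 • ξ (gridPoint l) + ((t : ℝ) * (1 - t) * c) • η₀
  have hqc : Continuous q := by
    have : ∀ l, Continuous fun t => f t l := fun l => (continuous_apply l).comp hfc
    fun_prop
  have hqξ : ∀ t, ‖q t - ξ t‖ < 1 := by
    intro t
    have e1 : q t - ξ t = ∑ l, f t l ^ 2 • (ξ (gridPoint l) - ξ t)
        + ((t : ℝ) * (1 - t) * c) • η₀ := by
      simp only [q, smul_sub, Finset.sum_sub_distrib, ← Finset.sum_smul, hf1, one_smul]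
      abel
    have e2 : ‖∑ l, f t l ^ 2 • (ξ (gridPoint l) - ξ t)‖ ≤ 1 / 2 := by
      calc _ ≤ ∑ l, f t l ^ 2 * (1 / 2) := by
            refine norm_sum_le_of_le _ fun l _ => ?_
            rw [norm_smul, Real.norm_eq_abs, abs_sq]
            by_cases hl : f t l = 0
            · simp [hl]
            · gcongr
              rw [← dist_eq_norm]
              exact hfs' t l hl
        _ = 1 / 2 := by rw [← Finset.sum_mul, hf1, one_mul]
    have e3 : ‖((t : ℝ) * (1 - t) * c) • η₀‖ < 1 / 2 := by
      have a1 : (0 : ℝ) ≤ t := t.2.1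
      have a2 : (t : ℝ) ≤ 1 := t.2.2
      rw [norm_smul, Real.norm_eq_abs, abs_of_nonneg (by have := sub_nonneg.2 a2; positivity)]
      have : (t : ℝ) * (1 - t) ≤ 1 := by nlinarith
      calc _ = (t : ℝ) * (1 - t) * (c * ‖η₀‖) := by ring
        _ ≤ 1 * (c * ‖η₀‖) := by gcongr
        _ < 1 / 2 := by linarith
    rw [e1]
    linarith [norm_add_le (∑ l, f t l ^ 2 • (ξ (gridPoint l) - ξ t))
      (((t : ℝ) * (1 - t) * c) • η₀)]
  have hq0 : ∀ t, q t ≠ 0 := by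
    intro t h
    have := hqξ t
    rw [h, zero_sub, norm_neg, nξ] at this
    exact lt_irrefl _ this
  have hend : ∀ t : unitInterval, t = 0 ∨ t = 1 → q t = e := by
    intro t ht
    have key : ∀ l, f t l ^ 2 • ξ (gridPoint l) = f t l ^ 2 • e := by
      intro l
      by_cases hl : f t l = 0
      · simp [hl]
      have hl' := hfs t l hl
      have hg : gridPoint l = t := by
        have h3 : |(t : ℝ) * N - l| < 1 := by
          have : (t : ℝ) * N - l = (t - l / N) * N := by field_simp
          rw [this, abs_mul, abs_of_pos hN', ← lt_div_iff₀ hN']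
          exact hl'
        apply Subtype.ext
        simp only [gridPoint]
        rcases ht with rfl | rfl
        · simp only [Set.Icc.coe_zero, zero_mul, zero_sub, abs_neg] at h3 ⊢
          have : (l : ℕ) = 0 := by
            rw [abs_of_nonneg (by positivity)] at h3
            have : (l : ℕ) < 1 := by exact_mod_cast h3
            omega
          simp [this]
        · simp only [Set.Icc.coe_one, one_mul] at h3 ⊢
          have : (l : ℕ) = N := by
            have h4 : ((N : ℝ)) < l + 1 := by linarith [(abs_lt.1 h3).2]
            have h5 : N < (l : ℕ) + 1 := by exact_mod_cast h4
            have := l.2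
            omega
          rw [this, div_self hN'.ne']
      rw [hg]
      rcases ht with rfl | rfl
      exacts [by rw [h0], by rw [h1]]
    have key2 : (t : ℝ) * (1 - t) = 0 := by
      rcases ht with rfl | rfl <;> simp
    simp only [q, key, key2, ← Finset.sum_smul, hf1]
    simp
  have ne : ‖e‖ = 1 := by rw [← h0, nξ]
  have havoid : ∀ t, ∀ r : ℝ, 0 ≤ r → q t + r • e ≠ 0 := by
    intro t r hr h
    by_cases ht : t = 0 ∨ t = 1
    · rw [hend t ht] at h
      have : (1 + r) • e = 0 := by rw [add_smul, one_smul, h]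
      rcases smul_eq_zero.1 this with h | h
      · linarith
      · simp [h] at ne
    push Not at ht
    have t0 : (0 : ℝ) < t := unitInterval.pos_iff_ne_zero.2 ht.1
    have t1 : (t : ℝ) < 1 := unitInterval.lt_one_iff_ne_one.2 ht.2
    have hj : ⌊(t : ℝ) * N⌋₊ < N := by
      rw [Nat.floor_lt (by positivity)]
      nlinarith
    set j : Fin N := ⟨_, hj⟩ with hjdef
    have hj1 : ((j : ℕ) : ℝ) ≤ t * N := Nat.floor_le (by positivity)
    have hj2 : (t : ℝ) * N < (j : ℕ) + 1 := Nat.lt_floor_add_one _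
    set p := Submodule.span ℝ {e, ξ (gridPoint j.castSucc), ξ (gridPoint j.succ)} with hp
    have hmem : ∀ l, f t l ^ 2 • ξ (gridPoint l) ∈ p := by
      intro l
      by_cases hl : f t l = 0
      · simp [hl]
      have h3 : |(t : ℝ) * N - l| < 1 := by
        have : (t : ℝ) * N - l = (t - l / N) * N := by field_simp
        rw [this, abs_mul, abs_of_pos hN', ← lt_div_iff₀ hN']
        exact hfs t l hl
      rw [abs_lt] at h3
      have h4 : (l : ℕ) = j ∨ (l : ℕ) = j + 1 := by
        have h5 : ((l : ℕ) : ℝ) < j + 2 := by linarith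
        have h6 : ((j : ℕ) : ℝ) < l + 1 := by linarith
        have h5' : (l : ℕ) < j + 2 := by exact_mod_cast h5
        have h6' : (j : ℕ) < l + 1 := by exact_mod_cast h6
        omega
      refine p.smul_mem _ (Submodule.subset_span ?_)
      rcases h4 with h4 | h4
      · have : l = j.castSucc := Fin.ext h4
        simp [this]
      · have : l = j.succ := Fin.ext h4
        simp [this]
    have he : r • e ∈ p := p.smul_mem _ (Submodule.subset_span (by simp))
    have h5 : ((t : ℝ) * (1 - t) * c) • η₀ ∈ p := by
      have : ((t : ℝ) * (1 - t) * c) • η₀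
          = -(∑ l, f t l ^ 2 • ξ (gridPoint l)) - r • e := by
        have h' : ∑ l, f t l ^ 2 • ξ (gridPoint l) + ((t : ℝ) * (1 - t) * c) • η₀ + r • e = 0 := h
        rw [← sub_eq_zero, ← h']
        abel
      rw [this]
      exact p.sub_mem (p.neg_mem (p.sum_mem fun l _ => hmem l)) he
    have hne : (t : ℝ) * (1 - t) * c ≠ 0 := by
      have := sub_pos.2 t1
      positivity
    exact hη₀ j ((p.smul_mem_iff hne).1 h5)
  refine ⟨fun t => ‖q t‖⁻¹ • q t, ?_, fun t => ?_, ?_, ?_, fun t h => ?_, fun t h => ?_⟩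
  · exact (hqc.norm.inv₀ fun t => norm_ne_zero_iff.2 (hq0 t)).smul hqc
  · rw [norm_smul, norm_inv, norm_norm, inv_mul_cancel₀ (norm_ne_zero_iff.2 (hq0 t))]
  · simp only [hend 0 (Or.inl rfl), ne, inv_one, one_smul]
  · simp only [hend 1 (Or.inr rfl), ne, inv_one, one_smul]
  · have hn := norm_pos_iff.2 (hq0 t)
    have h2 : q t - ξ t = -((1 + ‖q t‖) • ξ t) := by
      have : q t = -(‖q t‖ • ξ t) := by
        have h3 : ‖q t‖⁻¹ • q t = -ξ t := eq_neg_of_add_eq_zero_right h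
        rw [← smul_neg, ← h3, smul_inv_smul₀ hn.ne']
      rw [add_smul, one_smul]
      nth_rw 1 [this]
      abel
    have := hqξ t
    rw [h2, norm_neg, norm_smul, nξ, mul_one, Real.norm_eq_abs, abs_of_pos (by linarith)] at this
    linarith
  · have hn := norm_pos_iff.2 (hq0 t)
    refine havoid t ‖q t‖ hn.le ?_
    have h3 := congrArg (fun x => ‖q t‖ • x) h
    simpa [smul_smul, mul_inv_cancel₀ hn.ne'] using h3

end Avoid

section Loops

variable {ι κ : Type} [Fintype ι] [DecidableEq ι] [Fintype κ] [DecidableEq κ]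

/-- Relabelling the basis of a space of unitary matrices. -/
def reindexU (e : ι ≃ κ) : MatU ι →* MatU κ where
  toFun u := ⟨reindex e e u.1, by
    constructor
    · rw [star_eq_conjTranspose, conjTranspose_reindex, reindex_apply, reindex_apply,
        submatrix_mul_equiv, MatU.star_mul]
      simp
    · rw [star_eq_conjTranspose, conjTranspose_reindex, reindex_apply, reindex_apply,
        submatrix_mul_equiv, MatU.mul_star]
      simp⟩
  map_one' := Subtype.ext (by simp)
  map_mul' u v := Subtype.ext (by simp [submatrix_mul_equiv])

lemma continuous_reindexU (e : ι ≃ κ) : Continuous (reindexU e) :=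
  Continuous.subtype_mk (continuous_subtype_val.matrix_reindex e e) _

lemma exists_block_of_mulVec {u : MatU (Unit ⊕ κ)}
    (h : u.1 *ᵥ Pi.single (Sum.inl ()) 1 = Pi.single (Sum.inl ()) 1) :
    u.1 = fromBlocks 1 0 0 u.1.toBlocks₂₂ := by
  have h' : u.1ᴴ *ᵥ Pi.single (Sum.inl ()) 1 = Pi.single (Sum.inl ()) 1 := by
    conv_lhs => rw [← h]
    rw [mulVec_mulVec, MatU.star_mul, one_mulVec]
  rw [mulVec_single_one] at h h'
  ext i j
  rcases i with i | i <;> rcases j with j | j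
  · simpa using congrFun h (Sum.inl ())
  · have := congrFun h' (Sum.inr j)
    simpa using this
  · simpa using congrFun h (Sum.inr i)
  · rfl

lemma exists_htpc_block [Nonempty κ] {γ : unitInterval → MatU (Unit ⊕ κ)} (hγ : Continuous γ)
    (h0 : γ 0 = 1) (h1 : γ 1 = 1) :
    ∃ γ' : unitInterval → MatU κ, Continuous γ' ∧ γ' 0 = 1 ∧ γ' 1 = 1 ∧
      Htpc γ fun t => sumU ((1 : MatU Unit), γ' t) := by
  let e : EuclideanSpace ℂ (Unit ⊕ κ) := EuclideanSpace.single (Sum.inl ()) 1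
  have hd : 4 ≤ Module.finrank ℝ (EuclideanSpace ℂ (Unit ⊕ κ)) := by
    have h2 : Module.finrank ℝ (EuclideanSpace ℂ (Unit ⊕ κ))
        = 2 * Module.finrank ℂ (EuclideanSpace ℂ (Unit ⊕ κ)) := finrank_real_of_complex _
    rw [h2, finrank_euclideanSpace, Fintype.card_sum, Fintype.card_unit]
    have := Fintype.card_pos (α := κ)
    omega
  let ξ : unitInterval → EuclideanSpace ℂ (Unit ⊕ κ) := fun t =>
    WithLp.toLp 2 ((γ t).1 *ᵥ e.ofLp)
  have hξ : Continuous ξ :=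
    (PiLp.continuous_toLp 2 _).comp
      ((continuous_subtype_val.comp hγ).matrix_mulVec continuous_const)
  have ne : ‖e‖ = 1 := by simp [e]
  have nξ : ∀ t, ‖ξ t‖ = 1 := by
    intro t
    have h2 : ‖ξ t‖ ^ 2 = ‖e‖ ^ 2 := by
      have : (inner ℂ (ξ t) (ξ t) : ℂ) = inner ℂ e e := by
        rw [EuclideanSpace.inner_eq_star_dotProduct, EuclideanSpace.inner_eq_star_dotProduct]
        simp only [ξ]
        rw [star_mulVec, dotProduct_comm, ← dotProduct_mulVec, mulVec_mulVec, MatU.star_mul,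
          one_mulVec, dotProduct_comm]
      rw [inner_self_eq_norm_sq_to_K, inner_self_eq_norm_sq_to_K] at this
      exact_mod_cast this
    rw [ne] at h2
    nlinarith [norm_nonneg (ξ t)]
  have hξ0 : ξ 0 = e := by simp [ξ, h0]
  have hξ1 : ξ 1 = e := by simp [ξ, h1]
  obtain ⟨h, hh, nh, hh0, hh1, hne1, hne2⟩ := exists_avoiding_field hd hξ nξ hξ0 hξ1
  obtain ⟨κ₁, H1, hκ1⟩ := exists_htpc_rotation hξ hh nξ nh hne1 (hh0.trans hξ0.symm)
    (hh1.trans hξ1.symm)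
  obtain ⟨κ₂, H2, hκ2⟩ := exists_htpc_rotation (ζ := fun _ => e) hh continuous_const nh
    (fun _ => ne) hne2 hh0.symm hh1.symm
  have H : Htpc γ (κ₂ * κ₁ * γ) := by
    have := (H2.mul H1).mul (Htpc.refl hγ)
    have e1 : ((fun _ => 1) * (fun _ => 1) * γ : unitInterval → MatU (Unit ⊕ κ)) = γ := by
      funext t; simp
    rwa [e1] at this
  have hfix : ∀ t, ((κ₂ * κ₁ * γ) t).1 *ᵥ Pi.single (Sum.inl ()) 1 = Pi.single (Sum.inl ()) 1 := by
    intro t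
    have e1 : ((κ₂ * κ₁ * γ) t).1 = (κ₂ t).1 * ((κ₁ t).1 * (γ t).1) := by
      simp [mul_assoc]
    have e2 : (γ t).1 *ᵥ Pi.single (Sum.inl ()) 1 = (ξ t).ofLp := rfl
    rw [e1, ← mulVec_mulVec, ← mulVec_mulVec, e2, hκ1, hκ2]
    rfl
  have hblock := fun t => exists_block_of_mulVec (hfix t)
  have hmem : ∀ t, ((κ₂ * κ₁ * γ) t).1.toBlocks₂₂ ∈ unitary (Matrix κ κ ℂ) := by
    intro t
    have a1 := MatU.star_mul ((κ₂ * κ₁ * γ) t)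
    have a2 := MatU.mul_star ((κ₂ * κ₁ * γ) t)
    rw [hblock t] at a1 a2
    rw [fromBlocks_conjTranspose, fromBlocks_multiply, ← fromBlocks_one, fromBlocks_inj] at a1 a2
    constructor
    · simpa [star_eq_conjTranspose] using a1.2.2.2
    · simpa [star_eq_conjTranspose] using a2.2.2.2
  have hcont : Continuous fun t => ((κ₂ * κ₁ * γ) t).1.toBlocks₂₂ :=
    continuous_matrix fun i j => (continuous_subtype_val.comp H.right).matrix_elem _ _
  have hone : ∀ t, (κ₂ * κ₁ * γ) t = 1 → ((κ₂ * κ₁ * γ) t).1.toBlocks₂₂ = 1 := by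
    intro t ht
    rw [ht]
    ext i j
    simp [toBlocks₂₂, one_apply]
  refine ⟨fun t => ⟨_, hmem t⟩, hcont.subtype_mk _, Subtype.ext (hone 0 ?_),
    Subtype.ext (hone 1 ?_), ?_⟩
  · rw [← H.zero, h0]
  · rw [← H.one, h1]
  · convert H using 1
    funext t
    exact Subtype.ext (hblock t).symm

/-- The loop of winding number `k` in the scalars. -/
def windU (k : ℤ) (t : unitInterval) : MatU Unit :=
  scalarU Unit (Circle.exp (2 * Real.pi * k * t))

lemma continuous_windU (k : ℤ) : Continuous (windU k) :=
  continuous_scalarU.comp (by fun_prop)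

lemma scalarU_one : scalarU ι 1 = 1 := Subtype.ext (by simp [scalarU])

lemma scalarU_mul (z w : Circle) : scalarU ι (z * w) = scalarU ι z * scalarU ι w :=
  Subtype.ext (by simp [scalarU, smul_smul, mul_comm])

lemma windU_zero (k : ℤ) : windU k 0 = 1 := by
  simp [windU, scalarU_one]

lemma windU_one (k : ℤ) : windU k 1 = 1 := by
  have : Circle.exp (2 * Real.pi * k) = 1 := by
    rw [Circle.exp_eq_one]
    exact ⟨k, by ring⟩
  simp [windU, this, scalarU_one]

lemma windU_neg (k : ℤ) (t : unitInterval) : windU (-k) t = (windU k t)⁻¹ := by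
  rw [eq_inv_iff_mul_eq_one, windU, windU, ← scalarU_mul, ← Circle.exp_add]
  simp [scalarU_one]

/-- Every loop of unitary matrices becomes null-homotopic after adding a scalar loop. -/
def LoopsSplit (ι : Type) [Fintype ι] [DecidableEq ι] : Prop :=
  ∀ γ : unitInterval → MatU ι, Continuous γ → γ 0 = 1 → γ 1 = 1 →
    ∃ k : ℤ, Htpc (fun t => sumU (γ t, windU k t)) fun _ => 1

lemma LoopsSplit.congr (h : LoopsSplit ι) (e : ι ≃ κ) : LoopsSplit κ := by
  intro γ hγ h0 h1
  obtain ⟨k, hk⟩ := h (fun t => reindexU e.symm (γ t)) ((continuous_reindexU _).comp hγ)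
    (by rw [h0, map_one]) (by rw [h1, map_one])
  refine ⟨k, ?_⟩
  convert hk.map (reindexU (e.sumCongr (Equiv.refl Unit))) (continuous_reindexU _) using 1
  · funext t
    apply Subtype.ext
    ext (i | i) (j | j) <;> simp [sumU, reindexU]
  · simp

lemma LoopsSplit.unit_sum [Nonempty κ] (h : LoopsSplit κ) : LoopsSplit (Unit ⊕ κ) := by
  intro γ hγ h0 h1
  obtain ⟨γ', hγ', h0', h1', H⟩ := exists_htpc_block hγ h0 h1
  obtain ⟨k, hk⟩ := h γ' hγ' h0' h1'
  refine ⟨k, ?_⟩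
  have H1 : Htpc (fun t => sumU (γ t, windU k t))
      fun t => sumU (sumU ((1 : MatU Unit), γ' t), windU k t) := by
    have a := H.map (sumU.comp (MonoidHom.inl _ (MatU Unit)))
      (continuous_sumU.comp (continuous_id.prodMk continuous_const))
    have b := (Htpc.refl (continuous_windU k)).map (sumU.comp (MonoidHom.inr (MatU (Unit ⊕ κ)) _))
      (continuous_sumU.comp (continuous_const.prodMk continuous_id))
    convert a.mul b using 1 <;>
    · funext t
      simp [← map_mul]
  refine H1.trans ?_
  have a := hk.map (sumU.comp (MonoidHom.inr (MatU Unit) _))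
      (continuous_sumU.comp (continuous_const.prodMk continuous_id))
  convert a.map (reindexU (Equiv.sumAssoc Unit κ Unit).symm) (continuous_reindexU _) using 1
  · funext t
    apply Subtype.ext
    ext ((i | i) | i) ((j | j) | j) <;> simp [sumU, reindexU]
  · funext t
    exact ((congrArg _ (map_one sumU)).trans (map_one _)).symm

lemma htpc_whitehead {w : unitInterval → MatU ι} (hw : Continuous w) (h0 : w 0 = 1)
    (h1 : w 1 = 1) : Htpc (fun t => sumU (w t, (w t)⁻¹)) fun _ => 1 := by
  let σ : MatU (ι ⊕ ι) := ⟨fromBlocks 0 1 1 0, by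
    constructor <;>
    simp [star_eq_conjTranspose, fromBlocks_conjTranspose, fromBlocks_multiply, fromBlocks_one]⟩
  have hσ : ∀ u v : MatU ι, σ * sumU (u, v) * σ⁻¹ = sumU (v, u) := by
    intro u v
    rw [mul_inv_eq_iff_eq_mul]
    apply Subtype.ext
    simp [σ, sumU, fromBlocks_multiply]
  obtain ⟨r⟩ := PathConnectedSpace.joined σ (1 : MatU (ι ⊕ ι))
  have hc : Continuous fun p : unitInterval × unitInterval => sumU (w p.2, (1 : MatU ι)) :=
    continuous_sumU.comp (by fun_prop)
  refine ⟨fun p => sumU (w p.2, (1 : MatU ι)) * r p.1 * (sumU (w p.2, (1 : MatU ι)))⁻¹ *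
    (r p.1)⁻¹, ?_, fun t => ?_, fun t => ?_, fun s => ?_, fun s => ?_⟩
  · fun_prop
  · dsimp only
    rw [r.source, ← map_inv, mul_assoc, mul_assoc, ← mul_assoc σ, hσ, ← map_mul]
    simp
  · dsimp only
    rw [r.target]
    simp
  · simp only [h0, inv_one, ← Prod.one_eq_mk, map_one]
    simp
  · simp only [h1, inv_one, ← Prod.one_eq_mk, map_one]
    simp

lemma loopsSplit_unit : LoopsSplit Unit := by
  intro γ hγ h0 h1
  have hn : ∀ t, ‖(γ t).1 () ()‖ = 1 := by
    intro t
    have := congrFun (congrFun (MatU.star_mul (γ t)) ()) ()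
    simp only [mul_apply, conjTranspose_apply, one_apply_eq, Finset.univ_unique,
      Finset.sum_singleton, PUnit.default_eq_unit] at this
    have h2 := congrArg norm this
    rw [norm_mul, norm_star, norm_one] at h2
    nlinarith [norm_nonneg ((γ t).1 () ())]
  have hm : ∀ t, (γ t).1 () () ∈ Submonoid.unitSphere ℂ := fun t => by
    simp [Submonoid.unitSphere, hn]
  let f : C(unitInterval, Circle) := ⟨fun t => ⟨_, hm t⟩,
    Continuous.subtype_mk ((continuous_subtype_val.comp hγ).matrix_elem _ _) _⟩
  have hfv : ∀ t, (f t : ℂ) = (γ t).1 () () := fun _ => rfl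
  have hf : ∀ t, γ t = scalarU Unit (f t) := by
    intro t
    apply Subtype.ext
    ext i j
    simp [scalarU, hfv]
  have hf0 : f 0 = Circle.exp 0 := by
    apply Subtype.ext
    simp [hfv, h0]
  have hf1 : f 1 = 1 := by
    apply Subtype.ext
    simp [hfv, h1]
  obtain ⟨g, hg, hg0⟩ := Circle.isCoveringMap_exp.exists_path_lifts f 0 hf0
  have hg' : ∀ t, Circle.exp (g t) = f t := fun t => congrFun hg t
  obtain ⟨k, hk⟩ := Circle.exp_eq_one.1 ((hg' 1).trans hf1)
  have H : Htpc γ (windU k) := by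
    refine ⟨fun p => scalarU Unit (Circle.exp ((1 - (p.1 : ℝ)) * g p.2
      + p.1 * (2 * Real.pi * k * p.2))), continuous_scalarU.comp (by fun_prop),
      fun t => ?_, fun t => ?_, fun s => ?_, fun s => ?_⟩
    · simp [hg', hf]
    · simp [windU]
    · simp [hg0, h0, scalarU_one]
    · have e1 : (1 - (s : ℝ)) * g 1 + s * (2 * Real.pi * k * ((1 : unitInterval) : ℝ)) = g 1 := by
        rw [hk, Set.Icc.coe_one]
        ring
      dsimp only
      rw [e1, hg', ← hf]
  refine ⟨-k, Htpc.trans ?_ (htpc_whitehead (continuous_windU k) (windU_zero k) (windU_one k))⟩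
  have a := H.map (sumU.comp (MonoidHom.inl _ (MatU Unit)))
    (continuous_sumU.comp (continuous_id.prodMk continuous_const))
  have b := (Htpc.refl (continuous_windU (-k))).map (sumU.comp (MonoidHom.inr (MatU Unit) _))
    (continuous_sumU.comp (continuous_const.prodMk continuous_id))
  convert a.mul b using 1 <;>
  · funext t
    simp [← map_mul, windU_neg]

lemma loopsSplit (ι : Type) [Fintype ι] [DecidableEq ι] : LoopsSplit ι := by
  have key : ∀ n, LoopsSplit (Fin n) := by
    intro n
    induction n with
    | zero =>
      intro γ hγ h0 h1
      refine ⟨0, ?_⟩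
      have : (fun t => sumU (γ t, windU 0 t)) = fun _ => 1 := by
        funext t
        have e1 : γ t = 1 := Subtype.ext (Subsingleton.elim _ _)
        have e2 : windU 0 t = 1 := by simp [windU, scalarU_one]
        rw [e1, e2]
        exact map_one sumU
      rw [this]
      exact Htpc.refl continuous_const
    | succ n ih =>
      rcases n with - | n
      · exact loopsSplit_unit.congr (Fintype.equivOfCardEq (by simp))
      · exact ih.unit_sum.congr (Fintype.equivOfCardEq (by simp; ring))
  exact (key _).congr (Fintype.equivFin ι).symm

end Loops

section Abelianized

variable {m : ℕ} {α : FreeGroup (Fin m) ≃* FreeGroup (Fin m)}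

/-- The exponent sums of a word. -/
def expo (m : ℕ) : FreeGroup (Fin m) →* Multiplicative (Fin m → ℤ) :=
  FreeGroup.lift fun i => Multiplicative.ofAdd (Pi.single i 1)

/-- The element of the abelianization with given exponents. -/
def ofExpo (m : ℕ) : Multiplicative (Fin m → ℤ) →* Abelianization (FreeGroup (Fin m)) where
  toFun y := ∏ i, Abelianization.of (FreeGroup.of i) ^ y.toAdd i
  map_one' := by simp
  map_mul' y z := by simp [_root_.zpow_add, Finset.prod_mul_distrib]

lemma ofExpo_expo (x : Abelianization (FreeGroup (Fin m))) :
    ofExpo m (Abelianization.lift (expo m) x) = x := by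
  have : (ofExpo m).comp (Abelianization.lift (expo m)) = MonoidHom.id _ := by
    apply Abelianization.hom_ext
    ext i
    simp only [MonoidHom.comp_apply, Abelianization.lift_apply_of, expo, FreeGroup.lift_apply_of,
      MonoidHom.id_apply]
    simp only [ofExpo, MonoidHom.coe_mk, OneHom.coe_mk, toAdd_ofAdd]
    rw [Finset.prod_eq_single i] <;> simp +contextual
  exact DFunLike.congr_fun this x

/-- The matrix of the action of an automorphism on exponent sums. -/
def expoMatrix (α : FreeGroup (Fin m) ≃* FreeGroup (Fin m)) : Matrix (Fin m) (Fin m) ℤ :=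
  fun i => (expo m (α (FreeGroup.of i))).toAdd

lemma det_one_sub_expoMatrix (hfix : ∀ x : Abelianization (FreeGroup (Fin m)),
      Abelianization.map α.toMonoidHom x = x → x = 1) : (1 - expoMatrix α).det ≠ 0 := by
  intro hdet
  obtain ⟨z, hz, h⟩ := Matrix.exists_vecMul_eq_zero_iff.2 hdet
  rw [Matrix.vecMul_sub, Matrix.vecMul_one, sub_eq_zero] at h
  have e1 : ∀ y, Abelianization.lift (expo m) (ofExpo m y) = y := by
    intro y
    simp only [ofExpo, MonoidHom.coe_mk, OneHom.coe_mk, map_prod, map_zpow,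
      Abelianization.lift_apply_of, expo, FreeGroup.lift_apply_of]
    apply Multiplicative.toAdd.injective
    rw [toAdd_prod]
    funext j
    simp [Finset.sum_apply, Pi.single_apply]
  have e2 : Abelianization.lift (expo m)
      (Abelianization.map α.toMonoidHom (ofExpo m (Multiplicative.ofAdd z)))
        = Multiplicative.ofAdd z := by
    simp only [ofExpo, MonoidHom.coe_mk, OneHom.coe_mk, map_prod, map_zpow,
      Abelianization.lift_apply_of, Abelianization.map_of, toAdd_ofAdd]
    apply Multiplicative.toAdd.injective
    rw [toAdd_prod, toAdd_ofAdd]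
    funext j
    rw [congrFun h j]
    simp [Finset.sum_apply, Matrix.vecMul, dotProduct, expoMatrix]
  have e3 := hfix (ofExpo m (Multiplicative.ofAdd z)) (by
    rw [← ofExpo_expo (Abelianization.map _ _), e2])
  have e4 := e1 (Multiplicative.ofAdd z)
  rw [e3, map_one] at e4
  exact hz (Multiplicative.ofAdd.injective e4.symm)

lemma exists_hom_sub_eq (hfix : ∀ x : Abelianization (FreeGroup (Fin m)),
      Abelianization.map α.toMonoidHom x = x → x = 1) (k : Fin m → ℝ) :
    ∃ a : FreeGroup (Fin m) →* Multiplicative ℝ, ∀ i,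
      (a (FreeGroup.of i)).toAdd - (a (α (FreeGroup.of i))).toAdd = k i := by
  set B : Matrix (Fin m) (Fin m) ℝ := (1 - expoMatrix α).map (Int.cast : ℤ → ℝ) with hB
  have hdet : IsUnit B.det := by
    have : B.det = (((1 - expoMatrix α).det : ℤ) : ℝ) :=
      ((Int.castRingHom ℝ).map_det _).symm
    rw [this]
    exact isUnit_iff_ne_zero.2 (by exact_mod_cast det_one_sub_expoMatrix hfix)
  set y : Fin m → ℝ := B⁻¹ *ᵥ k with hy
  have hBy : B *ᵥ y = k := by rw [hy, mulVec_mulVec, Matrix.mul_nonsing_inv _ hdet, one_mulVec]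
  let s : Multiplicative (Fin m → ℤ) →* Multiplicative ℝ :=
    { toFun := fun z => Multiplicative.ofAdd (∑ j, (z.toAdd j : ℝ) * y j)
      map_one' := by simp
      map_mul' := fun z w => by
        rw [← ofAdd_add, ← Finset.sum_add_distrib]
        simp [add_mul] }
  refine ⟨s.comp (expo m), fun i => ?_⟩
  rw [← hBy, mulVec, dotProduct]
  simp only [MonoidHom.comp_apply, s, MonoidHom.coe_mk, OneHom.coe_mk, toAdd_ofAdd]
  rw [← Finset.sum_sub_distrib]
  refine Finset.sum_congr rfl fun j _ => ?_
  simp [hB, expoMatrix, expo, sub_mul, Pi.single_apply, one_apply, eq_comm]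

end Abelianized

section Reindex

variable {ι κ : Type} [Fintype ι] [DecidableEq ι] [Fintype κ] [DecidableEq κ]

lemma norm_reindex_le (e : ι ≃ κ) (A : Matrix ι ι ℂ) : ‖reindex e e A‖ ≤ ‖A‖ := by
  let U : Matrix κ ι ℂ := (1 : Matrix ι ι ℂ).submatrix e.symm id
  have hU : Uᴴ * U = 1 := by
    simp only [U, conjTranspose_submatrix, conjTranspose_one]
    rw [submatrix_mul_equiv]
    simp
  have h : reindex e e A = U * A * Uᴴ := by
    ext i j
    simp [U, mul_apply, one_apply]
  rw [h]
  exact (norm_mul_le_right (norm_conjTranspose_le_one (norm_le_one_of_isometry hU))).trans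
    (norm_mul_le_left (norm_le_one_of_isometry hU))

lemma IsApprox.reindex {m : ℕ} {α : FreeGroup (Fin m) ≃* FreeGroup (Fin m)} {δ : ℝ}
    {r : Fin m → MatU ι} {v : MatU ι} (h : IsApprox α δ r v) (e : ι ≃ κ) :
    IsApprox α δ (reindexU e ∘ r) (reindexU e v) := by
  intro i
  have h1 : FreeGroup.lift (reindexU e ∘ r) = (reindexU e).comp (FreeGroup.lift r) := by
    ext; simp
  have h2 := (norm_reindex_le e _).trans (h i)
  have h3 : (reindexU e v * reindexU e (r i)).1
      - (reindexU e (FreeGroup.lift r (α (FreeGroup.of i))) * reindexU e v).1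
      = Matrix.reindex e e (v.1 * (r i).1 - (FreeGroup.lift r (α (FreeGroup.of i))).1 * v.1) := by
    rw [← map_mul, ← map_mul]
    rfl
  rw [← h3] at h2
  rw [h1]
  exact h2

end Reindex

section PathToExact

variable {ι κ : Type} [Fintype ι] [DecidableEq ι] [Fintype κ] [DecidableEq κ]
variable {m : ℕ} {α : FreeGroup (Fin m) ≃* FreeGroup (Fin m)}

lemma continuous_lift_apply {Y : Type} [TopologicalSpace Y] {c : Y → Fin m → MatU ι}
    (hc : Continuous c) (g : FreeGroup (Fin m)) : Continuous fun y => FreeGroup.lift (c y) g := by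
  induction g using FreeGroup.induction_on with
  | C1 => simpa using continuous_const
  | of i =>
    simp only [FreeGroup.lift_apply_of]
    exact (continuous_apply i).comp hc
  | inv_of i h =>
    simp only [map_inv]
    exact h.inv
  | mul g h hg hh =>
    simp only [map_mul]
    exact hg.mul hh

lemma lift_sumU (r : Fin m → MatU ι) (s : Fin m → MatU κ) (g : FreeGroup (Fin m)) :
    FreeGroup.lift (fun i => sumU (r i, s i)) g
      = sumU (FreeGroup.lift r g, FreeGroup.lift s g) := by
  have : FreeGroup.lift (fun i => sumU (r i, s i))
      = sumU.comp ((FreeGroup.lift r).prod (FreeGroup.lift s)) := by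
    ext; simp
  rw [this]
  rfl

lemma isExact_sumU {r : Fin m → MatU ι} {v : MatU ι} {s : Fin m → MatU κ} {w : MatU κ}
    (h : IsExact α r v) (h' : IsExact α s w) :
    IsExact α (fun i => sumU (r i, s i)) (sumU (v, w)) := by
  intro i
  rw [lift_sumU, ← map_mul, ← map_mul, Prod.mk_mul_mk, Prod.mk_mul_mk, h i, h' i]

lemma norm_sumU_sub_le {a a' : MatU ι} {b b' : MatU κ} {c : ℝ} (ha : ‖a.1 - a'.1‖ ≤ c)
    (hb : ‖b.1 - b'.1‖ ≤ c) : ‖(sumU (a, b)).1 - (sumU (a', b')).1‖ ≤ c := by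
  have : (sumU (a, b)).1 - (sumU (a', b')).1 = fromBlocks (a.1 - a'.1) 0 0 (b.1 - b'.1) := by
    ext (i | i) (j | j) <;> simp [sumU]
  rw [this]
  exact norm_fromBlocks_le _ _ ((norm_nonneg _).trans ha) ha hb

/-- The scalar unitary path attached to a real character. -/
def charU (a : FreeGroup (Fin m) →* Multiplicative ℝ) (t : ℝ) : FreeGroup (Fin m) →* MatU Unit where
  toFun g := scalarU Unit (Circle.exp (2 * Real.pi * t * (a g).toAdd))
  map_one' := by simp [scalarU_one]
  map_mul' g h := by rw [← scalarU_mul, ← Circle.exp_add, map_mul a, toAdd_mul, mul_add]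

lemma lift_charU (a : FreeGroup (Fin m) →* Multiplicative ℝ) (t : ℝ) (g : FreeGroup (Fin m)) :
    FreeGroup.lift (fun i => charU a t (FreeGroup.of i)) g = charU a t g := by
  have : FreeGroup.lift (fun i => charU a t (FreeGroup.of i)) = charU a t := by ext; simp
  rw [this]

lemma charU_zero (a : FreeGroup (Fin m) →* Multiplicative ℝ) : charU a 0 = 1 := by
  ext1 i
  simp [charU, scalarU_one]

lemma isExact_charU {a : FreeGroup (Fin m) →* Multiplicative ℝ} {k : Fin m → ℤ}
    (ha : ∀ i, (a (FreeGroup.of i)).toAdd - (a (α (FreeGroup.of i))).toAdd = k i) :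
    IsExact α (fun i => charU a 1 (FreeGroup.of i)) 1 := by
  intro i
  rw [lift_charU, one_mul, mul_one]
  have h : Circle.exp (2 * Real.pi * k i) = 1 := Circle.exp_eq_one.2 ⟨k i, by ring⟩
  change scalarU Unit _ = scalarU Unit _
  congr 1
  rw [mul_one, eq_add_of_sub_eq (ha i), mul_add, Circle.exp_add, h, one_mul]

lemma joinedIn_one_of_norm_le {u : MatU ι} {δ : ℝ} (hδ : 0 < δ) (hδ' : δ < 1)
    (hu : ‖u.1 - 1‖ ≤ δ) : JoinedIn {w : MatU ι | ‖w.1 - 1‖ ≤ 2 * δ} 1 u := by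
  have h := Unitary.isPathConnected_ball (1 : MatU ι) (2 * δ) (by linarith) (by linarith)
  refine (h.joinedIn 1 (Metric.mem_ball_self (by linarith)) u ?_).mono fun w hw => ?_
  · rw [Metric.mem_ball, Subtype.dist_eq, dist_eq_norm]
    exact lt_of_le_of_lt hu (by linarith)
  · rw [Metric.mem_ball, Subtype.dist_eq, dist_eq_norm] at hw
    exact hw.le

lemma IsApprox.exists_path_intertwiner_data (hfix : ∀ x : Abelianization (FreeGroup (Fin m)),
      Abelianization.map α.toMonoidHom x = x → x = 1) {δ : ℝ} (hδ : 0 < δ) (hδ' : δ < 1)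
    {r : Fin m → MatU ι} {v : MatU ι} (h : IsApprox α δ r v) :
    ∃ (χ : Fin m → MatU Unit) (c : unitInterval → Fin m → MatU (ι ⊕ Unit))
      (H : unitInterval × unitInterval → Fin m → MatU (ι ⊕ Unit)),
      IsExact α χ 1 ∧ Continuous c ∧ c 0 = 1 ∧ (c 1 = fun i => sumU (r i, χ i)) ∧ Continuous H ∧
      (∀ s, H (s, 0) = H (0, 0)) ∧ (∀ s, H (s, 1) = H (0, 1)) ∧
      (∀ t i, H (1, t) i = FreeGroup.lift (c t) (α (FreeGroup.of i))) ∧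
      ∀ t i, ‖(sumU (v, 1)).1 * (c t i).1 - (H (0, t) i).1 * (sumU (v, 1)).1‖ ≤ 2 * δ := by
  have γ := fun i => (PathConnectedSpace.joined (1 : MatU ι) (r i)).somePath
  have hu : ∀ i, ‖(FreeGroup.lift r (α (FreeGroup.of i)) * (v * r i * v⁻¹)⁻¹).1 - 1‖ ≤ δ := by
    intro i
    have e1 : (FreeGroup.lift r (α (FreeGroup.of i)) * (v * r i * v⁻¹)⁻¹).1 - 1
        = -((v.1 * (r i).1 - (FreeGroup.lift r (α (FreeGroup.of i))).1 * v.1)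
          * ((r i)⁻¹ * v⁻¹).1) := by
      have e2 : (FreeGroup.lift r (α (FreeGroup.of i)) * (v * r i * v⁻¹)⁻¹)
          = (FreeGroup.lift r (α (FreeGroup.of i)) * v) * ((r i)⁻¹ * v⁻¹) := by group
      have e3 : (v.1 * (r i).1) * ((r i)⁻¹ * v⁻¹).1 = 1 := by
        have : (v * r i) * ((r i)⁻¹ * v⁻¹) = 1 := by group
        exact congrArg Subtype.val this
      rw [e2, Matrix.sub_mul, e3, neg_sub]
      rfl
    rw [e1, norm_neg]
    exact (norm_mul_le_right (MatU.norm_le _)).trans (h i)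
  have hw := fun i => joinedIn_one_of_norm_le hδ hδ' (hu i)
  choose w hwn using hw
  let b : unitInterval → Fin m → MatU ι := fun t i => γ i t
  have hb : Continuous b := continuous_pi fun i => (γ i).continuous
  let P : Fin m → unitInterval → MatU ι := fun i t => w i t * (v * γ i t * v⁻¹)
  have hP : ∀ i, Continuous (P i) := fun i => by
    have := (γ i).continuous
    have := (w i).continuous
    fun_prop
  let Q : Fin m → unitInterval → MatU ι := fun i t => FreeGroup.lift (b t) (α (FreeGroup.of i))
  have hQ : ∀ i, Continuous (Q i) := fun i => continuous_lift_apply hb _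
  have hb0 : b 0 = 1 := by funext i; simp [b]
  have hb1 : b 1 = r := by funext i; simp [b]
  have hQ0 : ∀ i, Q i 0 = 1 := by
    intro i
    have : FreeGroup.lift (1 : Fin m → MatU ι) = 1 := by ext1; simp
    simp [Q, hb0, this]
  have hloop := fun i => loopsSplit ι (fun t => (Q i t)⁻¹ * P i t) ((hQ i).inv.mul (hP i))
    (by simp [hQ0, P]) (by simp [Q, P, hb1]; group)
  choose k hk using hloop
  obtain ⟨a, ha⟩ := exists_hom_sub_eq hfix fun i => (k i : ℝ)
  let c : unitInterval → Fin m → MatU (ι ⊕ Unit) :=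
    fun t i => sumU (b t i, charU a t (FreeGroup.of i))
  have hchar : ∀ g, Continuous fun t : unitInterval => charU a t g := fun g =>
    continuous_scalarU.comp (by fun_prop)
  have hc : Continuous c := continuous_pi fun i =>
    continuous_sumU.comp (((continuous_apply i).comp hb).prodMk (hchar _))
  have hcQ : ∀ i t, FreeGroup.lift (c t) (α (FreeGroup.of i))
      = sumU (Q i t, charU a t (α (FreeGroup.of i))) := by
    intro i t
    rw [lift_sumU, lift_charU]
  have hH : ∀ i, Htpc (fun t => sumU (P i t, charU a t (FreeGroup.of i)))
      fun t => FreeGroup.lift (c t) (α (FreeGroup.of i)) := by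
    intro i
    have h1 := (Htpc.refl (continuous_lift_apply hc (α (FreeGroup.of i)))).mul (hk i)
    convert h1 using 1
    · funext t
      rw [Pi.mul_apply, hcQ, ← map_mul, Prod.mk_mul_mk, mul_inv_cancel_left, windU]
      congr 2
      change scalarU Unit _ = scalarU Unit _ * scalarU Unit _
      rw [← scalarU_mul, ← Circle.exp_add, ← ha i]
      congr 2
      ring
    · funext t
      simp
  choose F hF hF0 hF1 hFs hFt using hH
  refine ⟨fun i => charU a 1 (FreeGroup.of i), c, fun p i => F i p, isExact_charU ha, hc,
    ?_, ?_, continuous_pi fun i => hF i, fun s => ?_, fun s => ?_, fun t i => ?_, fun t i => ?_⟩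
  · funext i
    simp only [c, hb0, Set.Icc.coe_zero, charU_zero]
    exact map_one sumU
  · funext i
    simp [c, hb1]
  · funext i
    dsimp only
    rw [hFs, hF0]
  · funext i
    dsimp only
    rw [hFt, hF0]
  · exact hF1 i t
  · dsimp only
    rw [hF0]
    have e1 : (sumU (v, (1 : MatU Unit))).1 * (c t i).1
        = (sumU (v * γ i t, charU a t (FreeGroup.of i))).1 := by
      have : sumU (v, (1 : MatU Unit)) * c t i = sumU (v * γ i t, charU a t (FreeGroup.of i)) := by
        rw [← map_mul, Prod.mk_mul_mk, one_mul]
      exact congrArg Subtype.val this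
    have e2 : (sumU (P i t, charU a t (FreeGroup.of i))).1 * (sumU (v, (1 : MatU Unit))).1
        = (sumU (w i t * (v * γ i t), charU a t (FreeGroup.of i))).1 := by
      have : sumU (P i t, charU a t (FreeGroup.of i)) * sumU (v, (1 : MatU Unit))
          = sumU (w i t * (v * γ i t), charU a t (FreeGroup.of i)) := by
        rw [← map_mul, Prod.mk_mul_mk, mul_one]
        congr 2
        simp only [P]
        group
      exact congrArg Subtype.val this
    rw [e1, e2]
    refine norm_sumU_sub_le ?_ (by rw [sub_self, norm_zero]; positivity)
    have e3 : (v * γ i t).1 - (w i t * (v * γ i t)).1 = -(((w i t).1 - 1) * (v * γ i t).1) := by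
      rw [Matrix.sub_mul, Matrix.one_mul, neg_sub]
      rfl
    rw [e3, norm_neg]
    exact (norm_mul_le_right (MatU.norm_le _)).trans (hwn i t)

end PathToExact

section PathToExact

variable {ι κ : Type} [Fintype ι] [DecidableEq ι] [Fintype κ] [DecidableEq κ]
variable {m : ℕ} {α : FreeGroup (Fin m) ≃* FreeGroup (Fin m)}

lemma isApprox_of_intertwiner {c h : Fin m → MatU ι} {R : Fin m → MatU κ} {V : MatU κ}
    {v : MatU ι} {C : MatU (ι ⊕ κ)} {a b : ℝ} (hRV : IsExact α R V) (ha : 0 ≤ a)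
    (hv : ∀ i, ‖v.1 * (c i).1 - (h i).1 * v.1‖ ≤ a)
    (hC : ∀ i, ‖C.1 * (sumU (h i, R i)).1
      - (sumU (FreeGroup.lift c (α (FreeGroup.of i)), R i)).1 * C.1‖ ≤ b) :
    IsApprox α (a + b) (fun i => sumU (c i, R i)) (sumU (1, V) * C * sumU (v, 1)) := by
  intro i
  have h1 : ‖(sumU (v, (1 : MatU κ))).1 * (sumU (c i, R i)).1
      - (sumU (h i, R i)).1 * (sumU (v, (1 : MatU κ))).1‖ ≤ a := by
    change ‖(sumU (v, (1 : MatU κ)) * sumU (c i, R i)).1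
      - (sumU (h i, R i) * sumU (v, (1 : MatU κ))).1‖ ≤ a
    rw [← map_mul, ← map_mul, Prod.mk_mul_mk, Prod.mk_mul_mk, one_mul, mul_one]
    exact norm_sumU_sub_le (hv i) (by simpa using ha)
  have h2 : ‖(sumU ((1 : MatU ι), V)).1 * (sumU (FreeGroup.lift c (α (FreeGroup.of i)), R i)).1
      - (FreeGroup.lift (fun i => sumU (c i, R i)) (α (FreeGroup.of i))).1
        * (sumU ((1 : MatU ι), V)).1‖ ≤ 0 := by
    change ‖(sumU ((1 : MatU ι), V) * sumU (FreeGroup.lift c (α (FreeGroup.of i)), R i)).1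
      - (FreeGroup.lift (fun i => sumU (c i, R i)) (α (FreeGroup.of i))
        * sumU ((1 : MatU ι), V)).1‖ ≤ 0
    rw [lift_sumU, ← map_mul, ← map_mul, Prod.mk_mul_mk, Prod.mk_mul_mk, one_mul, mul_one, hRV i]
    simp
  have h3 := intertwine_comp (MatU.norm_le _)
    ((norm_mul_le_right (MatU.norm_le C)).trans (MatU.norm_le (sumU ((1 : MatU ι), V)))) h1
    (intertwine_comp (MatU.norm_le _) (MatU.norm_le _) (hC i) h2)
  rw [add_zero] at h3
  exact h3

/-- After adding an exact representation, an approximate representation of the mapping torus of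
`α` is connected to an exact one by a path of approximate representations. -/
theorem exists_joinedIn_exact (hfix : ∀ x : Abelianization (FreeGroup (Fin m)),
      Abelianization.map α.toMonoidHom x = x → x = 1) {ε : ℝ} (hε : 0 < ε) : ∃ δ : ℝ, 0 < δ ∧
    ∀ (ι : Type) [Fintype ι] [DecidableEq ι] (r : Fin m → MatU ι) (v : MatU ι), IsApprox α δ r v →
      ∃ (κ : Type) (_ : Fintype κ) (_ : DecidableEq κ) (R : Fin m → MatU κ) (V : MatU κ)
        (R' : Fin m → MatU (ι ⊕ κ)) (V' : MatU (ι ⊕ κ)), IsExact α R V ∧ IsExact α R' V' ∧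
        JoinedIn {p : (Fin m → MatU (ι ⊕ κ)) × MatU (ι ⊕ κ) | IsApprox α ε p.1 p.2}
          (fun i => sumU (r i, R i), sumU (v, V)) (R', V') := by
  refine ⟨min (ε / 4) (1 / 2), by positivity, fun ι _ _ r v h => ?_⟩
  set δ := min (ε / 4) (1 / 2)
  have hδ : 0 < δ := by positivity
  have hδ1 : δ < 1 := (min_le_right _ _).trans_lt (by norm_num)
  have hδ2 : 2 * δ + ε / 2 ≤ ε := by linarith [min_le_left (ε / 4) (1 / 2)]
  obtain ⟨χ, c, H, hχ, hc, hc0, hc1, hH, hH0, hH1, hHc, hHv⟩ :=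
    h.exists_path_intertwiner_data hfix hδ hδ1
  obtain ⟨κ, _, _, R, V, C, hRV, hC, hCH, hCj⟩ :=
    exists_path_intertwiner α (half_pos hε) H hH hH0 hH1
  let w : MatU (ι ⊕ Unit) := sumU (v, 1)
  let S := {p : (Fin m → MatU ((ι ⊕ Unit) ⊕ κ)) × MatU ((ι ⊕ Unit) ⊕ κ) | IsApprox α ε p.1 p.2}
  let f : unitInterval → MatU ((ι ⊕ Unit) ⊕ κ) →
    (Fin m → MatU ((ι ⊕ Unit) ⊕ κ)) × MatU ((ι ⊕ Unit) ⊕ κ) :=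
    fun t u => (fun i => sumU (c t i, R i), sumU (1, V) * u * sumU (w, 1))
  have hmono : ∀ {r : Fin m → MatU ((ι ⊕ Unit) ⊕ κ)} {v}, IsApprox α (2 * δ + ε / 2) r v →
      IsApprox α ε r v := fun h i => (h i).trans hδ2
  have hf : Continuous fun p : unitInterval × MatU ((ι ⊕ Unit) ⊕ κ) => f p.1 p.2 := by
    refine (continuous_pi fun i => continuous_sumU.comp ?_).prodMk ?_
    · exact (((continuous_apply i).comp hc).comp continuous_fst).prodMk continuous_const
    · fun_prop
  have hpath : JoinedIn S (f 0 (C 0)) (f 1 (C 1)) := by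
    refine ⟨⟨⟨fun t => f t (C t), hf.comp (continuous_id.prodMk hC)⟩, rfl, rfl⟩, fun t => ?_⟩
    refine hmono (isApprox_of_intertwiner hRV (by positivity) (hHv t) fun i => ?_)
    rw [← hHc]
    exact hCH t i
  have hend : ∀ t, t = 0 ∨ t = 1 → JoinedIn S (f t 1) (f t (C t)) := by
    intro t ht
    have hHt : H (1, t) = H (0, t) := by
      rcases ht with rfl | rfl
      · exact hH0 1
      · exact hH1 1
    refine ((hCj t ht).map (hf.comp (continuous_const.prodMk continuous_id))).mono ?_
    rintro _ ⟨u, hu, rfl⟩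
    refine hmono (isApprox_of_intertwiner hRV (by positivity) (hHv t) fun i => ?_)
    rw [← hHc, hHt]
    exact hu i
  have key := (hend 1 (Or.inr rfl)).trans (hpath.symm.trans (hend 0 (Or.inl rfl)).symm)
  let e := Equiv.sumAssoc ι Unit κ
  have hexact : IsExact α (1 : Fin m → MatU (ι ⊕ Unit)) w := by
    intro i
    have : FreeGroup.lift (1 : Fin m → MatU (ι ⊕ Unit)) = 1 := by ext1; simp
    rw [this]
    simp
  refine ⟨Unit ⊕ κ, inferInstance, inferInstance, fun i => sumU (χ i, R i), sumU (1, V),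
    reindexU e ∘ fun i => sumU ((1 : Fin m → MatU (ι ⊕ Unit)) i, R i), reindexU e (sumU (w, V)),
    isExact_sumU hχ hRV, (isExact_sumU hexact hRV).map α _, ?_⟩
  have hw : sumU ((1 : MatU (ι ⊕ Unit)), V) * 1 * sumU (w, 1) = sumU (w, V) := by
    rw [mul_one, ← map_mul, Prod.mk_mul_mk, one_mul, mul_one]
  have hcont : Continuous fun p : (Fin m → MatU ((ι ⊕ Unit) ⊕ κ)) × MatU ((ι ⊕ Unit) ⊕ κ) =>
      (reindexU e ∘ p.1, reindexU e p.2) := by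
    refine (continuous_pi fun i => ?_).prodMk ((continuous_reindexU e).comp continuous_snd)
    exact (continuous_reindexU e).comp ((continuous_apply i).comp continuous_fst)
  have key' := (key.map hcont).mono (U := (fun p => (reindexU e ∘ p.1, reindexU e p.2)) '' S)
    (V := {p | IsApprox α ε p.1 p.2}) (by rintro _ ⟨p, hp, rfl⟩; exact IsApprox.reindex hp e)
  simp only [f, hw, hc0, hc1] at key'
  convert key' using 2
  · funext i
    apply Subtype.ext
    ext (i | i | i) (j | j | j) <;> simp [sumU, reindexU, e]
  · apply Subtype.ext
    ext (i | i | i) (j | j | j) <;> simp [sumU, reindexU, e, w]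

end PathToExact

section Stability

variable {ι κ K : Type} [Fintype ι] [DecidableEq ι] [Fintype κ] [DecidableEq κ]
  [Fintype K] [DecidableEq K]
variable {m : ℕ} {α : FreeGroup (Fin m) ≃* FreeGroup (Fin m)}

lemma lift_diagU (r : K → Fin m → MatU ι) (g : FreeGroup (Fin m)) :
    FreeGroup.lift (fun i => diagU fun k => r k i) g
      = diagU fun k => FreeGroup.lift (r k) g := by
  have : FreeGroup.lift (fun i => diagU fun k => r k i)
      = diagU.comp (MonoidHom.pi fun k => FreeGroup.lift (r k)) := by
    ext1 i
    rw [FreeGroup.lift_apply_of]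
    exact congrArg diagU (funext fun k => (FreeGroup.lift_apply_of).symm)
  rw [this]
  rfl

lemma isApprox_diagU {r : K → Fin m → MatU ι} {v : K → MatU ι} {δ : ℝ} (hδ : 0 ≤ δ)
    (h : ∀ k, IsApprox α δ (r k) (v k)) :
    IsApprox α δ (fun i => diagU fun k => r k i) (diagU v) := by
  intro i
  have : (diagU v * diagU fun k => r k i).1
      - ((diagU fun k => FreeGroup.lift (r k) (α (FreeGroup.of i))) * diagU v).1
      = blockDiagonal fun k => (v k).1 * (r k i).1
        - (FreeGroup.lift (r k) (α (FreeGroup.of i))).1 * (v k).1 := by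
    rw [← map_mul, ← map_mul]
    exact (blockDiagonal_sub _ _).symm
  rw [lift_diagU]
  exact this ▸ norm_blockDiagonal_le _ hδ fun k => h k i

lemma norm_sub_conj_le {A B W : MatU ι} {c : ℝ} (h : ‖W.1 * A.1 - B.1 * W.1‖ ≤ c) :
    ‖A.1 - (MulAut.conj W⁻¹ B).1‖ ≤ c := by
  have : A.1 - (MulAut.conj W⁻¹ B).1 = (W⁻¹).1 * (W.1 * A.1 - B.1 * W.1) := by
    rw [Matrix.mul_sub]
    congr 1
    · exact congrArg Subtype.val (inv_mul_cancel_left W A).symm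
    · rw [MulAut.conj_apply, inv_inv, mul_assoc]
      rfl
  rw [this]
  exact (norm_mul_le_left (MatU.norm_le _)).trans h

/-- An approximate representation of the mapping torus of `α` that is connected to an exact one
by approximate representations is, after adding an exact representation, close to an exact
representation. -/
theorem exists_near_exact_of_joinedIn {ε : ℝ} (hε : 0 < ε) : ∃ δ : ℝ, 0 < δ ∧
    ∀ (ι : Type) [Fintype ι] [DecidableEq ι] (r : Fin m → MatU ι) (v : MatU ι)
      (R' : Fin m → MatU ι) (V' : MatU ι), IsExact α R' V' →
      JoinedIn {p : (Fin m → MatU ι) × MatU ι | IsApprox α δ p.1 p.2} (r, v) (R', V') →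
      ∃ (κ : Type) (_ : Fintype κ) (_ : DecidableEq κ) (R : Fin m → MatU κ) (V : MatU κ)
        (Q : Fin m → MatU (ι ⊕ κ)) (W : MatU (ι ⊕ κ)), IsExact α R V ∧ IsExact α Q W ∧
        (∀ i, ‖(sumU (r i, R i)).1 - (Q i).1‖ ≤ ε) ∧ ‖(sumU (v, V)).1 - W.1‖ ≤ ε := by
  obtain ⟨δ, hδ, h⟩ := exists_exact_dilation α (ε := ε / 8) (by positivity)
  refine ⟨δ, hδ, fun ι _ _ r v R' V' hR' hj => ?_⟩
  obtain ⟨p, hp⟩ := hj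
  have hu := Metric.uniformContinuous_iff.1
    (CompactSpace.uniformContinuous_of_continuous p.continuous) (ε / 2) (half_pos hε)
  obtain ⟨η, hη, hu⟩ := hu
  obtain ⟨N, hN⟩ := exists_nat_one_div_lt hη
  let q : Fin (N + 1 + 1) → (Fin m → MatU ι) × MatU ι := fun k => p (gridPoint k)
  have hq0 : q 0 = (r, v) := by
    have : gridPoint (0 : Fin (N + 1 + 1)) = 0 := Subtype.ext (by simp [gridPoint])
    simp [q, this]
  have hq1 : q (Fin.last (N + 1)) = (R', V') := by
    have : gridPoint (Fin.last (N + 1)) = 1 :=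
      Subtype.ext (div_self (by simp; positivity))
    simp only [q, this, p.target]
  have hqd : ∀ k : Fin (N + 1), dist (q k.castSucc) (q k.succ) ≤ ε / 2 := by
    intro k
    refine (hu ?_).le
    rw [Subtype.dist_eq, Real.dist_eq]
    refine lt_of_le_of_lt (le_of_eq ?_) hN
    simp only [gridPoint]
    rw [abs_sub_comm, abs_of_nonneg]
    all_goals
      push_cast [Fin.val_castSucc, Fin.val_succ]
      rw [← sub_div, add_sub_cancel_left]
    positivity
  obtain ⟨κ, _, _, R, V, J, hRV, hJ, hJR, hJV⟩ := h _ (fun i => diagU fun k => (q k).1 i)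
    (diagU fun k => (q k).2) (isApprox_diagU hδ.le fun k => hp _)
  have hR : ∀ i, ‖(chainU hJ).1 * (sumU (r i, R i)).1
      - (sumU (R' i, R i)).1 * (chainU hJ).1‖ ≤ ε := by
    intro i
    have h1 := chainU_intertwine hJ (h := fun k => (q k).1 i) (half_pos hε).le (hJR i) fun k => by
      have h2 := (dist_le_pi_dist (q k.castSucc).1 (q k.succ).1 i).trans
        ((le_max_left _ _).trans (hqd k))
      rwa [Subtype.dist_eq, dist_eq_norm] at h2
    simp only [hq0, hq1] at h1
    linarith
  have hV : ‖(chainU hJ).1 * (sumU (v, V)).1 - (sumU (V', V)).1 * (chainU hJ).1‖ ≤ ε := by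
    have h1 := chainU_intertwine hJ (h := fun k => (q k).2) (half_pos hε).le hJV fun k => by
      have h2 : dist (q k.castSucc).2 (q k.succ).2 ≤ _ := (le_max_right _ _).trans (hqd k)
      rwa [Subtype.dist_eq, dist_eq_norm] at h2
    simp only [hq0, hq1] at h1
    linarith
  exact ⟨κ, inferInstance, inferInstance, R, V, _, _, hRV,
    (isExact_sumU hR' hRV).map α (MulAut.conj (chainU hJ)⁻¹).toMonoidHom,
    fun i => norm_sub_conj_le (hR i), norm_sub_conj_le hV⟩

/-- Approximate representations of the mapping torus of `α` are, after adding an exact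
representation, close to exact ones. -/
theorem exists_near_exact (hfix : ∀ x : Abelianization (FreeGroup (Fin m)),
      Abelianization.map α.toMonoidHom x = x → x = 1) {ε : ℝ} (hε : 0 < ε) : ∃ δ : ℝ, 0 < δ ∧
    ∀ (ι : Type) [Fintype ι] [DecidableEq ι] (r : Fin m → MatU ι) (v : MatU ι), IsApprox α δ r v →
      ∃ (κ : Type) (_ : Fintype κ) (_ : DecidableEq κ) (R : Fin m → MatU κ) (V : MatU κ)
        (Q : Fin m → MatU (ι ⊕ κ)) (W : MatU (ι ⊕ κ)), IsExact α R V ∧ IsExact α Q W ∧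
        (∀ i, ‖(sumU (r i, R i)).1 - (Q i).1‖ ≤ ε) ∧ ‖(sumU (v, V)).1 - W.1‖ ≤ ε := by
  obtain ⟨δ₁, hδ₁, h₁⟩ := exists_near_exact_of_joinedIn (α := α) hε
  obtain ⟨δ₂, hδ₂, h₂⟩ := exists_joinedIn_exact hfix hδ₁
  refine ⟨δ₂, hδ₂, fun ι _ _ r v h => ?_⟩
  obtain ⟨κ, _, _, R, V, R', V', hRV, hR', hj⟩ := h₂ ι r v h
  obtain ⟨κ', _, _, S, U, Q, W, hSU, hQW, hQ, hW⟩ := h₁ _ _ _ R' V' hR' hj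
  let e := Equiv.sumAssoc ι κ κ'
  have hassoc : ∀ (a : MatU ι) (b : MatU κ) (c : MatU κ') (d : MatU ((ι ⊕ κ) ⊕ κ')),
      ‖(sumU (sumU (a, b), c)).1 - d.1‖ ≤ ε → ‖(sumU (a, sumU (b, c))).1 - (reindexU e d).1‖ ≤ ε := by
    intro a b c d hd
    have : (sumU (a, sumU (b, c))).1 - (reindexU e d).1
        = reindex e e ((sumU (sumU (a, b), c)).1 - d.1) := by
      ext (i | i | i) (j | j | j) <;> simp [sumU, reindexU, e]
    rw [this]
    exact (norm_reindex_le e _).trans hd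
  exact ⟨κ ⊕ κ', inferInstance, inferInstance, _, _, _, _, isExact_sumU hRV hSU,
    hQW.map α (reindexU e), fun i => hassoc _ _ _ _ (hQ i), hassoc _ _ _ _ hW⟩

end Stability

section Polar

variable {ι : Type} [Fintype ι] [DecidableEq ι]

open scoped ComplexOrder in
/-- A contraction with an approximate contractive left inverse is close to a unitary. -/
lemma exists_unitary_near {A B : Matrix ι ι ℂ} {δ : ℝ} (hA : ‖A‖ ≤ 1) (hB : ‖B‖ ≤ 1) (hδ : δ < 1)
    (h : ‖B * A - 1‖ ≤ δ) : ∃ u : MatU ι, ‖A - u.1‖ ≤ δ := by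
  have hH : (Aᴴ * A).IsHermitian := isHermitian_conjTranspose_mul_self A
  set U : MatU ι := hH.eigenvectorUnitary
  set lam : ι → ℝ := hH.eigenvalues
  let σ : ι → ℝ := fun i => √(lam i)
  let A' := A * U.1
  have hA' : A'ᴴ * A' = diagonal fun i => (lam i : ℂ) := by
    have h1 := hH.conjStarAlgAut_star_eigenvectorUnitary
    rw [Unitary.conjStarAlgAut_star_apply] at h1
    rw [conjTranspose_mul, Matrix.mul_assoc, ← Matrix.mul_assoc Aᴴ, ← Matrix.mul_assoc]
    exact h1
  have hpos : ∀ i, 0 ≤ lam i := (posSemidef_conjTranspose_mul_self A).eigenvalues_nonneg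
  have hσ : ∀ i, |σ i - 1| ≤ δ := by
    intro i
    let e : Matrix ι Unit ℂ := emb fun _ => i
    have he : eᴴ * e = 1 := emb_conjTranspose_mul (Function.injective_of_subsingleton _)
    have hen : ‖U.1 * e‖ = 1 := by
      have h1 := l2_opNorm_conjTranspose_mul_self (U.1 * e)
      rw [conjTranspose_mul, Matrix.mul_assoc, ← Matrix.mul_assoc _ U.1, U.star_mul,
        Matrix.one_mul, he, norm_one] at h1
      nlinarith [norm_nonneg (U.1 * e)]
    have hσn : ‖A' * e‖ = σ i := by
      have h1 := l2_opNorm_conjTranspose_mul_self (A' * e)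
      have h2 : (A' * e)ᴴ * (A' * e) = (lam i : ℂ) • (1 : Matrix Unit Unit ℂ) := by
        rw [conjTranspose_mul, Matrix.mul_assoc, ← Matrix.mul_assoc _ A', hA']
        ext
        simp [e, emb, mul_apply, diagonal_apply]
      rw [h2, norm_smul, norm_one, mul_one, Complex.norm_real, Real.norm_of_nonneg (hpos i)] at h1
      simp only [σ, h1, Real.sqrt_mul_self (norm_nonneg _)]
    have h1 : ‖A' * e‖ ≤ 1 := by
      rw [Matrix.mul_assoc]
      exact (norm_mul_le_left hA).trans hen.le
    have h2 : 1 ≤ ‖A' * e‖ + δ := by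
      have h3 : U.1 * e = B * (A' * e) - (B * A - 1) * (U.1 * e) := by
        rw [Matrix.sub_mul, Matrix.one_mul]
        simp only [A', Matrix.mul_assoc]
        abel
      calc (1 : ℝ) = ‖U.1 * e‖ := hen.symm
        _ ≤ ‖B * (A' * e)‖ + ‖(B * A - 1) * (U.1 * e)‖ := by
          conv_lhs => rw [h3]
          exact norm_sub_le _ _
        _ ≤ ‖A' * e‖ + δ := add_le_add (norm_mul_le_left hB) ((norm_mul_le_right hen.le).trans h)
    rw [hσn] at h1 h2
    rw [abs_le]
    constructor <;> linarith
  have hσ0 : ∀ i, 0 < σ i := fun i => by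
    have := abs_le.1 (hσ i)
    linarith
  let u' := A' * diagonal fun i => ((σ i)⁻¹ : ℂ)
  have hu' : u'ᴴ * u' = 1 := by
    rw [conjTranspose_mul, Matrix.mul_assoc, ← Matrix.mul_assoc _ A', hA', diagonal_conjTranspose,
      diagonal_mul_diagonal, diagonal_mul_diagonal, ← diagonal_one]
    congr 1
    funext i
    have h1 : (lam i : ℂ) = σ i * σ i := by
      rw [← Complex.ofReal_mul, Real.mul_self_sqrt (hpos i)]
    have h2 : (σ i : ℂ) ≠ 0 := by exact_mod_cast (hσ0 i).ne'
    simp [h1]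
    field_simp
  have hAu : A' - u' = u' * diagonal fun i => ((σ i - 1 : ℝ) : ℂ) := by
    rw [Matrix.mul_assoc, diagonal_mul_diagonal]
    nth_rw 1 [← Matrix.mul_one A', ← Matrix.mul_sub, ← diagonal_one]
    rw [diagonal_sub]
    congr 2
    funext i
    have h2 : (σ i : ℂ) ≠ 0 := by exact_mod_cast (hσ0 i).ne'
    push_cast
    field_simp
  have hmem : u' ∈ unitary (Matrix ι ι ℂ) := ⟨hu', mul_eq_one_comm.1 hu'⟩
  refine ⟨⟨u', hmem⟩ * U⁻¹, ?_⟩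
  have h1 : A - (⟨u', hmem⟩ * U⁻¹ : MatU ι).1 = (A' - u') * (U⁻¹).1 := by
    have : A = A' * (U⁻¹).1 := by
      rw [Matrix.mul_assoc, MatU.coe_inv, MatU.mul_star, Matrix.mul_one]
    rw [Matrix.sub_mul, ← this]
    rfl
  rw [h1, hAu]
  refine (norm_mul_le_right (MatU.norm_le _)).trans
    ((norm_mul_le_left (norm_le_one_of_isometry hu')).trans ?_)
  rw [l2_opNorm_diagonal]
  refine (pi_norm_le_iff_of_nonneg ((norm_nonneg _).trans h)).2 fun i => ?_
  rw [Complex.norm_real]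
  exact hσ i

end Polar

section Words

variable {Γ X : Type} [Group Γ]

lemma IsQuasiRep.mono {T T' : Set Γ} {δ δ' : ℝ} {n : ℕ} {φ : Γ → Matrix (Fin n) (Fin n) ℂ}
    (h : IsQuasiRep T δ φ) (hT : T' ⊆ T) (hδ : δ ≤ δ') : IsQuasiRep T' δ' φ :=
  ⟨h.1, h.2.1, fun s hs t ht => (h.2.2 s (hT hs) t (hT ht)).trans_le hδ⟩

/-- Unitaries close to the images of generators under an approximate representation determine it
approximately on every fixed word. -/
lemma IsQuasiRep.exists_norm_sub_lift_le (f : FreeGroup X →* Γ) (g : FreeGroup X) :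
    ∀ η : ℝ, 0 < η → ∃ (T : Set Γ) (δ : ℝ), T.Finite ∧ 0 < δ ∧
      ∀ (n : ℕ) (φ : Γ → Matrix (Fin n) (Fin n) ℂ) (u : X → MatU (Fin n)), IsQuasiRep T δ φ →
        (∀ x, ‖φ (f (FreeGroup.of x)) - (u x).1‖ ≤ δ) →
        ‖φ (f g) - (FreeGroup.lift u g).1‖ ≤ η := by
  induction g using FreeGroup.induction_on with
  | C1 =>
    refine fun η hη => ⟨∅, 1, Set.finite_empty, one_pos, fun n φ u h hu => ?_⟩
    rw [map_one, map_one, h.1]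
    simpa using hη.le
  | of x =>
    refine fun η hη => ⟨∅, η, Set.finite_empty, hη, fun n φ u h hu => ?_⟩
    simpa using hu x
  | inv_of x _ =>
    refine fun η hη => ⟨{f (FreeGroup.of x), (f (FreeGroup.of x))⁻¹}, η / 2, by simp,
      half_pos hη, fun n φ u h hu => ?_⟩
    have h1 := h.2.2 (f (FreeGroup.of x)) (by simp) (f (FreeGroup.of x))⁻¹ (by simp)
    rw [mul_inv_cancel, h.1] at h1
    rw [map_inv, map_inv, FreeGroup.lift_apply_of]
    set a := f (FreeGroup.of x)
    have h2 : φ a⁻¹ - ((u x)⁻¹).1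
        = ((u x)⁻¹).1 * ((φ a * φ a⁻¹ - 1) - (φ a - (u x).1) * φ a⁻¹) := by
      have : ((u x)⁻¹).1 * (u x).1 = 1 := (u x).star_mul
      simp only [Matrix.mul_sub, Matrix.sub_mul, ← Matrix.mul_assoc, this, Matrix.one_mul,
        Matrix.mul_one]
      abel
    rw [h2]
    refine (norm_mul_le_left (MatU.norm_le _)).trans ((norm_sub_le _ _).trans ?_)
    have h3 := (norm_mul_le_right (A := φ a - (u x).1) (h.2.1 a⁻¹)).trans (hu x)
    linarith
  | mul g g' hg hg' =>
    intro η hη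
    obtain ⟨T, δ, hT, hδ, hg⟩ := hg (η / 3) (by positivity)
    obtain ⟨T', δ', hT', hδ', hg'⟩ := hg' (η / 3) (by positivity)
    refine ⟨T ∪ T' ∪ {f g, f g'}, min (min δ δ') (η / 3), (hT.union hT').union (by simp),
      by positivity, fun n φ u h hu => ?_⟩
    have h1 := (h.2.2 (f g) (by simp) (f g') (by simp)).trans_le (min_le_right _ _)
    have h2 := hg n φ u (h.mono (fun x hx => Or.inl (Or.inl hx))
      ((min_le_left _ _).trans (min_le_left _ _)))
      fun x => (hu x).trans ((min_le_left _ _).trans (min_le_left _ _))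
    have h3 := hg' n φ u (h.mono (fun x hx => Or.inl (Or.inr hx))
      ((min_le_left _ _).trans (min_le_right _ _)))
      fun x => (hu x).trans ((min_le_left _ _).trans (min_le_right _ _))
    rw [map_mul, map_mul]
    have h4 : φ (f g * f g') - (FreeGroup.lift u g * FreeGroup.lift u g').1
        = -(φ (f g) * φ (f g') - φ (f g * f g'))
          + ((φ (f g) - (FreeGroup.lift u g).1) * φ (f g')
          + (FreeGroup.lift u g).1 * (φ (f g') - (FreeGroup.lift u g').1)) := by
      rw [Matrix.sub_mul, Matrix.mul_sub]
      change _ - (FreeGroup.lift u g).1 * (FreeGroup.lift u g').1 = _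
      abel
    rw [h4]
    refine (norm_add_le _ _).trans ((add_le_add le_rfl (norm_add_le _ _)).trans ?_)
    rw [norm_neg]
    have h5 := (norm_mul_le_right (A := φ (f g) - (FreeGroup.lift u g).1)
      (h.2.1 (f g'))).trans h2
    have h6 := (norm_mul_le_left (B := φ (f g') - (FreeGroup.lift u g').1)
      (MatU.norm_le (FreeGroup.lift u g))).trans h3
    linarith

/-- Uniform version for finitely many words, where the unitaries are provided as well. -/
lemma IsQuasiRep.exists_lift [Finite X] (f : FreeGroup X →* Γ) {S : Set (FreeGroup X)}
    (hS : S.Finite) {η : ℝ} (hη : 0 < η) : ∃ (T : Set Γ) (δ : ℝ), T.Finite ∧ 0 < δ ∧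
      ∀ (n : ℕ) (φ : Γ → Matrix (Fin n) (Fin n) ℂ), IsQuasiRep T δ φ →
        ∃ u : X → MatU (Fin n), ∀ g ∈ S, ‖φ (f g) - (FreeGroup.lift u g).1‖ ≤ η := by
  have h1 : ∃ (T : Set Γ) (δ : ℝ), T.Finite ∧ 0 < δ ∧
      ∀ (n : ℕ) (φ : Γ → Matrix (Fin n) (Fin n) ℂ) (u : X → MatU (Fin n)), IsQuasiRep T δ φ →
        (∀ x, ‖φ (f (FreeGroup.of x)) - (u x).1‖ ≤ δ) →
        ∀ g ∈ S, ‖φ (f g) - (FreeGroup.lift u g).1‖ ≤ η := by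
    induction S, hS using Set.Finite.induction_on with
    | empty => exact ⟨∅, 1, Set.finite_empty, one_pos, by simp⟩
    | @insert g S _ _ ih =>
      obtain ⟨T, δ, hT, hδ, h⟩ := ih
      obtain ⟨T', δ', hT', hδ', h'⟩ := IsQuasiRep.exists_norm_sub_lift_le f g η hη
      refine ⟨T ∪ T', min δ δ', hT.union hT', by positivity, fun n φ u hφ hu g' hg' => ?_⟩
      rcases hg' with rfl | hg'
      · exact h' n φ u (hφ.mono Set.subset_union_right (min_le_right _ _))
          fun x => (hu x).trans (min_le_right _ _)
      · exact h n φ u (hφ.mono Set.subset_union_left (min_le_left _ _))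
          (fun x => (hu x).trans (min_le_left _ _)) g' hg'
  obtain ⟨T, δ, hT, hδ, h⟩ := h1
  let G := Set.range fun x => f (FreeGroup.of x)
  refine ⟨T ∪ (G ∪ G⁻¹), min δ (1 / 2), hT.union ((Set.finite_range _).union
    (Set.finite_range _).inv), by positivity, fun n φ hφ => ?_⟩
  have hu : ∀ x, ∃ u : MatU (Fin n), ‖φ (f (FreeGroup.of x)) - u.1‖ ≤ min δ (1 / 2) := by
    intro x
    refine exists_unitary_near (B := φ (f (FreeGroup.of x))⁻¹) (hφ.2.1 _) (hφ.2.1 _)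
      ((min_le_right _ _).trans_lt (by norm_num)) ?_
    have h2 := hφ.2.2 (f (FreeGroup.of x))⁻¹ (by simp [G]) (f (FreeGroup.of x)) (by simp [G])
    rw [inv_mul_cancel, hφ.1] at h2
    exact h2.le
  choose u hu using hu
  exact ⟨u, h n φ u (hφ.mono Set.subset_union_left (min_le_left _ _))
    fun x => (hu x).trans (min_le_left _ _)⟩

end Words

section Transfer

variable {m : ℕ} {α : FreeGroup (Fin m) ≃* FreeGroup (Fin m)}

/-- The generators of `F ⋊_α ℤ`, `none` being the generator of `ℤ`. -/
def mappingTorusGen (α : FreeGroup (Fin m) ≃* FreeGroup (Fin m)) :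
    FreeGroup (Option (Fin m)) →* FreeByCyclic m α :=
  FreeGroup.lift fun x => x.elim (SemidirectProduct.inr (Multiplicative.ofAdd 1))
    fun i => SemidirectProduct.inl (FreeGroup.of i)

lemma mappingTorusGen_map (g : FreeGroup (Fin m)) :
    mappingTorusGen α (FreeGroup.map some g) = SemidirectProduct.inl g := by
  have : (mappingTorusGen α).comp (FreeGroup.map some) = SemidirectProduct.inl := by
    ext1 i
    simp [mappingTorusGen]
  exact DFunLike.congr_fun this g

lemma mappingTorusGen_surjective (α : FreeGroup (Fin m) ≃* FreeGroup (Fin m)) :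
    Function.Surjective (mappingTorusGen α) := by
  intro x
  refine ⟨FreeGroup.map some x.left * FreeGroup.of none ^ x.right.toAdd, ?_⟩
  rw [map_mul, mappingTorusGen_map, map_zpow]
  simp only [mappingTorusGen, FreeGroup.lift_apply_of, Option.elim]
  rw [← map_zpow, ← ofAdd_zsmul, smul_eq_mul, mul_one, ofAdd_toAdd]
  exact SemidirectProduct.inl_left_mul_inr_right x

lemma mappingTorusGen_relation (i : Fin m) :
    mappingTorusGen α (FreeGroup.of none * FreeGroup.of (some i))
      = mappingTorusGen α (FreeGroup.map some (α (FreeGroup.of i)) * FreeGroup.of none) := by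
  rw [map_mul, map_mul, mappingTorusGen_map, ← mul_inv_eq_iff_eq_mul]
  simp only [mappingTorusGen, FreeGroup.lift_apply_of, Option.elim]
  rw [← map_inv, ← SemidirectProduct.inl_aut]
  simp

/-- The homomorphism on `F ⋊_α ℤ` determined by elements satisfying its relations. -/
lemma IsExact.exists_hom {G : Type} [Group G] {r : Fin m → G} {v : G} (h : IsExact α r v) :
    ∃ Φ : FreeByCyclic m α →* G, ∀ x : Option (Fin m),
      Φ (mappingTorusGen α (FreeGroup.of x)) = x.elim v r := by
  have h1 : ∀ g, FreeGroup.lift r (α g) = v * FreeGroup.lift r g * v⁻¹ := by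
    have : (FreeGroup.lift r).comp α.toMonoidHom
        = (MulAut.conj v).toMonoidHom.comp (FreeGroup.lift r) := by
      ext1 i
      simpa using (mul_inv_eq_of_eq_mul (h i)).symm
    exact fun g => DFunLike.congr_fun this g
  have h2 : ∀ (n : ℕ) g, FreeGroup.lift r ((α ^ n : MulAut (FreeGroup (Fin m))) g)
      = v ^ n * FreeGroup.lift r g * (v ^ n)⁻¹ := by
    intro n
    induction n with
    | zero => simp
    | succ n ih =>
      intro g
      rw [pow_succ', MulAut.mul_apply]
      refine (h1 _).trans ?_
      rw [ih]
      group
  have h3 : ∀ (n : ℤ) g, FreeGroup.lift r ((α ^ n : MulAut (FreeGroup (Fin m))) g)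
      = v ^ n * FreeGroup.lift r g * (v ^ n)⁻¹ := by
    intro n g
    obtain ⟨k, rfl | rfl⟩ := n.eq_nat_or_neg
    · simpa using h2 k g
    · have h4 := h2 k ((α ^ (-(k : ℤ)) : MulAut (FreeGroup (Fin m))) g)
      rw [← MulAut.mul_apply, ← zpow_natCast, ← _root_.zpow_add, add_neg_cancel, zpow_zero,
        MulAut.one_apply] at h4
      rw [h4, _root_.zpow_neg, zpow_natCast]
      group
  refine ⟨SemidirectProduct.lift (FreeGroup.lift r) (zpowersHom G v) fun z => ?_, ?_⟩
  · ext1 i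
    exact h3 z.toAdd (FreeGroup.of i)
  · rintro (_ | i) <;> simp [mappingTorusGen]

lemma isUnitaryRep_hom {Γ : Type} [Group Γ] {k : ℕ} (θ : Γ →* MatU (Fin k)) :
    IsUnitaryRep fun g => (θ g).1 :=
  ⟨congrArg Subtype.val (map_one θ), fun x y => congrArg Subtype.val (map_mul θ x y), fun x => (θ x).2⟩

end Transfer

end

/-- Let `Γ = F ⋊_α ℤ` be a free-by-cyclic group such that the
automorphism of the abelianization of `F` induced by `α` has no fixed point other than the
identity (equivalently, `1` is not an eigenvalue of the induced map on `H₁(F;ℝ)`).  Then `Γ`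
is weakly stable. -/
theorem statement14 (m : ℕ) (hm : 1 ≤ m)
    (α : FreeGroup (Fin m) ≃* FreeGroup (Fin m))
    (hfix : ∀ x : Abelianization (FreeGroup (Fin m)),
      Abelianization.map α.toMonoidHom x = x → x = 1)
    (S : Set (FreeByCyclic m α)) (hS : S.Finite) (ε : ℝ) (hε : 0 < ε) :
    ∃ (T : Set (FreeByCyclic m α)) (δ : ℝ), T.Finite ∧ 0 < δ ∧
      ∀ (n : ℕ), 1 ≤ n → ∀ φ : FreeByCyclic m α → Matrix (Fin n) (Fin n) ℂ,
        IsQuasiRep T δ φ →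
        ∃ (k : ℕ) (θ : FreeByCyclic m α → Matrix (Fin k) (Fin k) ℂ)
          (π : FreeByCyclic m α → Matrix (Fin (n + k)) (Fin (n + k)) ℂ),
          IsUnitaryRep θ ∧ IsUnitaryRep π ∧
          ∀ s ∈ S, ‖blockSum (φ s) (θ s) - π s‖ < ε := by
  choose w hw using mappingTorusGen_surjective α
  choose C hC hCw using fun s => intertwine_word (w s)
  obtain ⟨D, hD⟩ := (hS.image C).bddAbove
  obtain ⟨η, hη, hηC⟩ : ∃ η : ℝ, 0 < η ∧ ∀ s ∈ S, C s * η ≤ ε / 3 := by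
    refine ⟨ε / 3 / max D 1, by positivity, fun s hs => ?_⟩
    have h1 : C s ≤ max D 1 := (hD ⟨s, hs, rfl⟩).trans (le_max_left _ _)
    rw [mul_div_assoc', div_le_iff₀ (by positivity), mul_comm]
    gcongr
  obtain ⟨δ₁, hδ₁, h₁⟩ := exists_near_exact hfix hη
  let A : Set (FreeGroup (Option (Fin m))) :=
    Set.range (fun i => FreeGroup.of none * FreeGroup.of (some i)) ∪
      Set.range fun i => FreeGroup.map some (α (FreeGroup.of i)) * FreeGroup.of none
  obtain ⟨T, δ, hT, hδ, h⟩ := IsQuasiRep.exists_lift (mappingTorusGen α) (S := A ∪ w '' S)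
    (((Set.finite_range _).union (Set.finite_range _)).union (hS.image _))
    (η := min (δ₁ / 2) (ε / 3)) (by positivity)
  refine ⟨T, δ, hT, hδ, fun n _ φ hφ => ?_⟩
  obtain ⟨u, hu⟩ := h n φ hφ
  have happrox : IsApprox α δ₁ (fun i => u (some i)) (u none) := by
    intro i
    have h2 := (hu _ (Or.inl (Or.inl ⟨i, rfl⟩))).trans (min_le_left _ _)
    have h3 := (hu _ (Or.inl (Or.inr ⟨i, rfl⟩))).trans (min_le_left _ _)
    rw [mappingTorusGen_relation] at h2
    have h4 : FreeGroup.lift u (FreeGroup.map some (α (FreeGroup.of i)))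
        = FreeGroup.lift (fun i => u (some i)) (α (FreeGroup.of i)) := by
      have : (FreeGroup.lift u).comp (FreeGroup.map some)
          = FreeGroup.lift fun i => u (some i) := by ext1; simp
      exact DFunLike.congr_fun this _
    rw [map_mul (FreeGroup.lift u), FreeGroup.lift_apply_of, FreeGroup.lift_apply_of,
      norm_sub_rev] at h2
    rw [map_mul (FreeGroup.lift u), h4, FreeGroup.lift_apply_of] at h3
    refine (norm_sub_le_norm_sub_add_norm_sub _ _ _).trans ((add_le_add h2 h3).trans ?_)
    linarith
  obtain ⟨κ, _, _, R, V, Q, W, hRV, hQW, hQ, hW⟩ := h₁ _ _ _ happrox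
  obtain ⟨θ, hθ⟩ := hRV.exists_hom
  obtain ⟨π, hπ⟩ := hQW.exists_hom
  let e := Fintype.equivFin κ
  let e' : Fin n ⊕ κ ≃ Fin (n + Fintype.card κ) := ((Equiv.refl _).sumCongr e).trans finSumFinEquiv
  refine ⟨Fintype.card κ, fun g => (reindexU e (θ g)).1, fun g => (reindexU e' (π g)).1,
    isUnitaryRep_hom ((reindexU e).comp θ), isUnitaryRep_hom ((reindexU e').comp π),
    fun s hs => ?_⟩
  have h2 : ‖(sumU (FreeGroup.lift u (w s), θ s)).1 - (π s).1‖ ≤ ε / 3 := by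
    have h3 := hCw s (Fin n ⊕ κ) (Fin n ⊕ κ)
      (sumU.comp ((FreeGroup.lift u).prod (θ.comp (mappingTorusGen α))))
      (π.comp (mappingTorusGen α)) 1 η hη.le ?_
    · rw [Matrix.one_mul, Matrix.mul_one] at h3
      simp only [MonoidHom.comp_apply, MonoidHom.prod_apply, hw] at h3
      exact h3.trans (hηC s hs)
    · intro x
      rw [Matrix.one_mul, Matrix.mul_one]
      simp only [MonoidHom.comp_apply, MonoidHom.prod_apply, hθ, hπ, FreeGroup.lift_apply_of]
      rcases x with _ | i
      · exact hW
      · exact hQ i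
  have h3 := (hu _ (Or.inr ⟨s, hs, rfl⟩)).trans (min_le_right _ _)
  rw [hw] at h3
  have h4 : blockSum (φ s) (reindexU e (θ s)).1 - (reindexU e' (π s)).1
      = Matrix.reindex e' e' (Matrix.fromBlocks (φ s - (FreeGroup.lift u (w s)).1) 0 0 0
        + ((sumU (FreeGroup.lift u (w s), θ s)).1 - (π s).1)) := by
    have h5 : Matrix.fromBlocks (φ s - (FreeGroup.lift u (w s)).1) 0 0 0
        + (sumU (FreeGroup.lift u (w s), θ s)).1 = Matrix.fromBlocks (φ s) 0 0 (θ s).1 := by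
      ext (i | i) (j | j) <;> simp [sumU]
    rw [← add_sub_assoc, h5]
    ext i j
    obtain ⟨i, rfl⟩ := finSumFinEquiv.surjective i
    obtain ⟨j, rfl⟩ := finSumFinEquiv.surjective j
    rcases i with i | i <;> rcases j with j | j <;> simp [blockSum, reindexU, e']
  rw [h4]
  refine (norm_reindex_le e' _).trans_lt ((norm_add_le _ _).trans_lt ?_)
  have h6 : ‖Matrix.fromBlocks (φ s - (FreeGroup.lift u (w s)).1) 0 0 (0 : Matrix κ κ ℂ)‖ ≤ ε / 3 :=
    norm_fromBlocks_le _ _ (by positivity) h3 (by rw [norm_zero]; positivity)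
  linarith

end
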